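/- arXiv:1603.02961 — 3 statements merged into one kernel-verified Lean document; each statement's English description precedes it below -/
import Mathlib

section
/- There exists ε > 0 with the following property. Let N ≥ 1 be an integer, let γ ∈ (1, 1+ε), and let U : ℝ → ℝ be an even, smooth, nonconstant, 2π-periodic solution of ((γ − U(z))·U'(z))' + U(z) = 0 with sup_{z∈ℝ} |U(z)| ≤ ε, and assume additionally 1 − 3U''(z) > 0 for all z (which holds automatically once ε is small enough); let I denote the constant value of the first-order invariant. For λ ∈ ℝ, let E_λ be the real vector space of smooth 2πN-periodic functions v : ℝ → ℝ with ∫₀^{2πN} v = 0 satisfying −( (1 − 3U''(z))^{−5/3}·v''(z) )'' + (γ³ − 6I)^{−2/3}·v(z) = λ·v(z) for all z ∈ ℝ. Then: (i) the set of λ > 0 with E_λ ≠ {0} is finite, and the sum of dim E_λ over these λ equals 2N − 2; (ii) E₀ is one-dimensional and is spanned by U'; (iii) the set of λ < 0 with E_λ ≠ {0} is infinite. -/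
open Real

/-- The eigenspace `E_λ`: smooth `2πN`-periodic zero-mean solutions `v` of
`−((1 − 3U'')^{−5/3} v'')'' + (γ³ − 6I)^{−2/3} v = λ v`, i.e. `M_γ v = λ v`. -/
def EigSetM (U : ℝ → ℝ) (γ I lam : ℝ) (N : ℕ) : Set (ℝ → ℝ) :=
  {v | ContDiff ℝ (⊤ : ℕ∞) v ∧ Function.Periodic v (2 * π * N) ∧
    (∫ z in (0:ℝ)..(2 * π * N), v z) = 0 ∧
    ∀ z : ℝ,
      -(iteratedDeriv 2
          (fun w => (1 - 3 * iteratedDeriv 2 U w) ^ (-(5:ℝ)/3) * iteratedDeriv 2 v w) z)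
        + (γ ^ 3 - 6 * I) ^ (-(2:ℝ)/3) * v z = lam * v z}

section

open Module.End in
/-- Eigenvalue-restricted orthogonal complement: restricting a compact symmetric operator to
the orthogonal complement of some of its eigenspaces removes those eigenvalues. -/
theorem exists_restrict_compl_eigenspaces {H : Type*} [NormedAddCommGroup H]
    [InnerProductSpace ℝ H] [CompleteSpace H] {T : H →L[ℝ] H} (hT : IsCompactOperator T)
    (hS : (T : H →ₗ[ℝ] H).IsSymmetric) (A : Set ℝ) {V : Submodule ℝ H}
    (hV : V = (⨆ ν ∈ A, eigenspace (T : H →ₗ[ℝ] H) ν)ᗮ) :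
    ∃ S : V →L[ℝ] V,
      IsCompactOperator S ∧ (S : V →ₗ[ℝ] V).IsSymmetric ∧ (∀ x, (S x : H) = T x) ∧
        ∀ ν ∈ A, ¬ HasEigenvalue (S : V →ₗ[ℝ] V) ν := by
  subst hV
  set G := ⨆ ν ∈ A, eigenspace (T : H →ₗ[ℝ] H) ν with hG
  have inv : ∀ v ∈ Gᗮ, (T : H →ₗ[ℝ] H) v ∈ Gᗮ := by
    intro v hv
    simp only [hG, Submodule.iSup_eq_span, Submodule.mem_orthogonal] at hv ⊢
    have key : ∀ ν ∈ A, ∀ x ∈ eigenspace (T : H →ₗ[ℝ] H) ν, inner ℝ x (T v) = 0 := by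
      intro ν hν x hx
      have h1 : inner ℝ x (T v) = inner ℝ (T x) v := (hS x v).symm
      rw [h1]
      have h2 : T x = ν • x := mem_eigenspace_iff.mp hx
      rw [h2, inner_smul_left, hv x, mul_zero]
      rw [← Submodule.iSup_eq_span]
      refine Submodule.mem_iSup_of_mem ν ?_
      rw [← Submodule.iSup_eq_span]
      exact Submodule.mem_iSup_of_mem hν hx
    intro u hu
    have hle : (⨆ ν ∈ A, eigenspace (T : H →ₗ[ℝ] H) ν) ≤ (ℝ ∙ (T v))ᗮ := by
      refine iSup₂_le fun ν hν x hx => ?_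
      rw [Submodule.mem_orthogonal_singleton_iff_inner_left]
      exact key ν hν x hx
    have := hle (by simpa only [Submodule.iSup_eq_span] using hu)
    rwa [Submodule.mem_orthogonal_singleton_iff_inner_left] at this
  refine ⟨T.restrict inv, hT.restrict' inv, hS.restrict_invariant inv, fun x => rfl, ?_⟩
  intro ν hν hev
  obtain ⟨x, hx⟩ := hev.exists_hasEigenvector
  have hx1 := hx.apply_eq_smul
  have hx2 : T (x : H) = ν • (x : H) := congrArg Subtype.val hx1
  have hmem : (x : H) ∈ G := by
    refine Submodule.mem_iSup_of_mem ν (Submodule.mem_iSup_of_mem hν ?_)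
    exact mem_eigenspace_iff.mpr hx2
  have h0 := (Submodule.mem_orthogonal _ _).mp x.2 x hmem
  exact hx.2 (Subtype.ext (inner_self_eq_zero.mp h0))

open Module.End in
/-- Strict Rayleigh bound on the orthogonal complement of the eigenspaces above a level. -/
theorem inner_lt_of_mem_compl_eigenspaces {H : Type*} [NormedAddCommGroup H]
    [InnerProductSpace ℝ H] [CompleteSpace H] {T : H →L[ℝ] H} (hT : IsCompactOperator T)
    (hS : (T : H →ₗ[ℝ] H).IsSymmetric) (hpos : ∀ f, 0 ≤ inner ℝ (T f) f) {ν₀ : ℝ} (hν₀ : 0 < ν₀)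
    {f : H} (hf : ∀ ν, ν₀ ≤ ν → f ∈ (eigenspace (T : H →ₗ[ℝ] H) ν)ᗮ) (hf0 : f ≠ 0) :
    inner ℝ (T f) f < ν₀ * ‖f‖ ^ 2 := by
  have hfm : f ∈ ((⨆ ν ∈ Set.Ici ν₀, eigenspace (T : H →ₗ[ℝ] H) ν)ᗮ : Submodule ℝ H) := by
    rw [Submodule.mem_orthogonal]
    intro u hu
    have hle : (⨆ ν ∈ Set.Ici ν₀, eigenspace (T : H →ₗ[ℝ] H) ν) ≤ (ℝ ∙ f)ᗮ := by
      refine iSup₂_le fun ν hν x hx => ?_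
      rw [Submodule.mem_orthogonal_singleton_iff_inner_left]
      exact (Submodule.mem_orthogonal _ _).mp (hf ν hν) x hx
    have := hle hu
    rwa [Submodule.mem_orthogonal_singleton_iff_inner_left] at this
  generalize hV : ((⨆ ν ∈ Set.Ici ν₀, eigenspace (T : H →ₗ[ℝ] H) ν)ᗮ : Submodule ℝ H) = V at hfm
  obtain ⟨S, hSc, hSs, hST, hSe⟩ :=
    exists_restrict_compl_eigenspaces hT hS (Set.Ici ν₀) hV.symm
  have : CompleteSpace V := by subst hV; infer_instance
  set x : V := ⟨f, hfm⟩
  have hx0 : x ≠ 0 := fun h => hf0 (congrArg Subtype.val h)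
  have : Nontrivial V := ⟨x, 0, hx0⟩
  have hfx : inner ℝ (T f) f = inner ℝ (S x) x := by
    rw [Submodule.coe_inner, hST]
  have hnx : ‖f‖ = ‖x‖ := rfl
  have hxp : 0 < ‖x‖ := norm_pos_iff.mpr hx0
  rw [hfx, hnx]
  have hbd : ∀ y : V, S.rayleighQuotient y ≤ ‖S‖ := fun y =>
    (le_abs_self _).trans (S.rayleighQuotient_le_norm y)
  by_cases hn : ‖S‖ < ν₀
  · have h1 : inner ℝ (S x) x ≤ ‖S x‖ * ‖x‖ := real_inner_le_norm _ _
    have h2 := S.le_opNorm x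
    have h3 : ‖S x‖ * ‖x‖ ≤ ‖S‖ * ‖x‖ * ‖x‖ := mul_le_mul_of_nonneg_right h2 hxp.le
    have h4 : ‖S‖ * (‖x‖ * ‖x‖) < ν₀ * (‖x‖ * ‖x‖) := mul_lt_mul_of_pos_right hn (by positivity)
    nlinarith
  · exfalso
    push Not at hn
    have hne : ‖S‖ ≠ 0 := by linarith
    rcases hSc.hasEigenvalue_or_mem_resolventSet hne with h | h
    · exact hSe _ hn h
    · obtain ⟨e, he, hb⟩ := S.rayleighQuotient_le_of_norm_mem_resolventSet h
      have h1 : ∀ y, |S.rayleighQuotient y| ≤ ‖S‖ - e := by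
        intro y
        rw [abs_of_nonneg]
        · exact hb y
        · have : 0 ≤ inner ℝ (S y) y := by
            have := hpos y
            rwa [← hST, ← Submodule.coe_inner] at this
          unfold ContinuousLinearMap.rayleighQuotient ContinuousLinearMap.reApplyInnerSelf
          exact div_nonneg (by simpa using this) (sq_nonneg _)
      have h2 := S.norm_eq_iSup_rayleighQuotient hSs
      have h3 : (⨆ y, |S.rayleighQuotient y|) ≤ ‖S‖ - e := ciSup_le h1
      linarith

open Module.End in
theorem finrank_iSup_eigenspaces {H : Type*} [NormedAddCommGroup H]
    [InnerProductSpace ℝ H] [CompleteSpace H] {T : H →L[ℝ] H} (hT : IsCompactOperator T)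
    (s : Finset ℝ) (hs : ∀ ν ∈ s, ν ≠ 0) :
    FiniteDimensional ℝ (⨆ ν ∈ s, eigenspace (T : H →ₗ[ℝ] H) ν : Submodule ℝ H) ∧
      Module.finrank ℝ (⨆ ν ∈ s, eigenspace (T : H →ₗ[ℝ] H) ν : Submodule ℝ H) =
        ∑ ν ∈ s, Module.finrank ℝ (eigenspace (T : H →ₗ[ℝ] H) ν) := by
  classical
  induction s using Finset.induction_on with
  | empty =>
    have h0 : (⨆ ν ∈ (∅ : Finset ℝ), eigenspace (T : H →ₗ[ℝ] H) ν) = ⊥ := by simp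
    rw [h0]
    exact ⟨inferInstance, by simp⟩
  | insert a s ha ih =>
    obtain ⟨h1, h2⟩ := ih fun ν hν => hs ν (Finset.mem_insert_of_mem hν)
    have h3 := ContinuousLinearMap.finite_dimensional_eigenspace hT a
      (hs a (Finset.mem_insert_self _ _))
    rw [Finset.iSup_insert, Finset.sum_insert ha]
    refine ⟨Submodule.finiteDimensional_sup _ _, ?_⟩
    have h4 := Submodule.finrank_sup_add_finrank_inf_eq (eigenspace (T : H →ₗ[ℝ] H) a)
      (⨆ ν ∈ s, eigenspace (T : H →ₗ[ℝ] H) ν)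
    have h5 : Disjoint (eigenspace (T : H →ₗ[ℝ] H) a)
        (⨆ ν ∈ s, eigenspace (T : H →ₗ[ℝ] H) ν) :=
      (eigenspaces_iSupIndep (T : H →ₗ[ℝ] H)).disjoint_biSup (y := (s : Set ℝ)) ha
    rw [disjoint_iff.mp h5, finrank_bot, h2] at h4
    simpa using h4

open Module.End in
theorem lt_inner_of_mem_iSup_eigenspaces {H : Type*} [NormedAddCommGroup H]
    [InnerProductSpace ℝ H] {T : H →L[ℝ] H}
    (hS : (T : H →ₗ[ℝ] H).IsSymmetric) {ν₀ : ℝ}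
    (s : Finset ℝ) (hs : ∀ ν ∈ s, ν₀ < ν) {f : H}
    (hf : f ∈ (⨆ ν ∈ s, eigenspace (T : H →ₗ[ℝ] H) ν : Submodule ℝ H)) (hf0 : f ≠ 0) :
    ν₀ * ‖f‖ ^ 2 < inner ℝ (T f) f := by
  classical
  obtain ⟨g, rfl⟩ := (Submodule.mem_iSup_finset_iff_exists_sum _ _).mp hf
  have horth := hS.orthogonalFamily_eigenspaces
  have hT : T (∑ ν ∈ s, (g ν : H)) = ∑ ν ∈ s, ((ν • g ν : eigenspace (T : H →ₗ[ℝ] H) ν) : H) := by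
    rw [map_sum]
    exact Finset.sum_congr rfl fun ν _ => mem_eigenspace_iff.mp (g ν).2
  have e1 : ‖∑ ν ∈ s, (g ν : H)‖ ^ 2 = ∑ ν ∈ s, ‖g ν‖ ^ 2 := horth.norm_sum g s
  have e2 : inner ℝ (T (∑ ν ∈ s, (g ν : H))) (∑ ν ∈ s, (g ν : H)) = ∑ ν ∈ s, ν * ‖g ν‖ ^ 2 := by
    rw [hT]
    refine (horth.inner_sum (fun ν => ν • g ν) g s).trans (Finset.sum_congr rfl fun ν _ => ?_)
    rw [inner_smul_left, real_inner_self_eq_norm_sq]; rfl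
  rw [e1, e2, Finset.mul_sum]
  have : ∃ ν ∈ s, (g ν : H) ≠ 0 := by
    by_contra! h
    exact hf0 (Finset.sum_eq_zero h)
  obtain ⟨ν, hν, hg⟩ := this
  refine Finset.sum_lt_sum (fun i hi => ?_) ⟨ν, hν, ?_⟩
  · have := hs i hi
    nlinarith [sq_nonneg ‖g i‖]
  · have := hs ν hν
    have : 0 < ‖g ν‖ := norm_pos_iff.mpr fun h => hg (by simp [h])
    have : 0 < ‖g ν‖ ^ 2 := by positivity
    nlinarith

open Module.End in
/-- Counting the eigenvalues of a positive compact symmetric operator above and below a level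
`ν₀` from variational information. -/
theorem eigenvalue_count {H : Type*} [NormedAddCommGroup H]
    [InnerProductSpace ℝ H] [CompleteSpace H] {T : H →L[ℝ] H} (hT : IsCompactOperator T)
    (hS : (T : H →ₗ[ℝ] H).IsSymmetric) (hpos : ∀ f, 0 ≤ inner ℝ (T f) f) {ν₀ : ℝ} (hν₀ : 0 < ν₀)
    (k : ℕ)
    (h1 : ∀ E : Submodule ℝ H, FiniteDimensional ℝ E → (∀ f ∈ E, ∃ g, f = T g) →
      (∀ f ∈ E, f ≠ 0 → ν₀ * ‖f‖ ^ 2 < inner ℝ (T f) f) → Module.finrank ℝ E ≤ k)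
    (h2 : Module.finrank ℝ (eigenspace (T : H →ₗ[ℝ] H) ν₀) ≤ 1)
    (h3 : ∀ E : Submodule ℝ H, FiniteDimensional ℝ E → Module.finrank ℝ E ≤ k →
      ∃ f ∈ Eᗮ, f ≠ 0 ∧ ν₀ * ‖f‖ ^ 2 ≤ inner ℝ (T f) f)
    (h4 : ¬ FiniteDimensional ℝ (LinearMap.range (T : H →ₗ[ℝ] H))) :
    (∃ hfin : {ν : ℝ | ν₀ < ν ∧ HasEigenvalue (T : H →ₗ[ℝ] H) ν}.Finite,
      ∑ ν ∈ hfin.toFinset, Module.finrank ℝ (eigenspace (T : H →ₗ[ℝ] H) ν) = k) ∧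
    {ν : ℝ | 0 < ν ∧ ν < ν₀ ∧ HasEigenvalue (T : H →ₗ[ℝ] H) ν}.Infinite := by
  classical
  have bound : ∀ s : Finset ℝ, (∀ ν ∈ s, ν₀ < ν) →
      ∑ ν ∈ s, Module.finrank ℝ (eigenspace (T : H →ₗ[ℝ] H) ν) ≤ k := by
    intro s hs
    obtain ⟨e1, e2⟩ := finrank_iSup_eigenspaces hT s fun ν hν => (hν₀.trans (hs ν hν)).ne'
    rw [← e2]
    refine h1 _ e1 (fun f hf => ?_) fun f hf hf0 => lt_inner_of_mem_iSup_eigenspaces hS s hs hf hf0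
    have hle : (⨆ ν ∈ s, eigenspace (T : H →ₗ[ℝ] H) ν : Submodule ℝ H) ≤
        LinearMap.range (T : H →ₗ[ℝ] H) := by
      refine iSup₂_le fun ν hν x hx => ⟨ν⁻¹ • x, ?_⟩
      have hν0 : ν ≠ 0 := (hν₀.trans (hs ν hν)).ne'
      rw [map_smul, mem_eigenspace_iff.mp hx, smul_smul, inv_mul_cancel₀ hν0, one_smul]
    obtain ⟨g, hg⟩ := hle hf
    exact ⟨g, hg.symm⟩
  have fin1 : ∀ ν, ν₀ < ν → HasEigenvalue (T : H →ₗ[ℝ] H) ν →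
      1 ≤ Module.finrank ℝ (eigenspace (T : H →ₗ[ℝ] H) ν) := by
    intro ν hν he
    have := ContinuousLinearMap.finite_dimensional_eigenspace hT ν (hν₀.trans hν).ne'
    exact Submodule.one_le_finrank_iff.mpr he
  have hfin : {ν : ℝ | ν₀ < ν ∧ HasEigenvalue (T : H →ₗ[ℝ] H) ν}.Finite := by
    by_contra hinf
    obtain ⟨s, hs, hc⟩ := Set.Infinite.exists_subset_card_eq hinf (k + 1)
    have := bound s fun ν hν => (hs hν).1
    have h5 : s.card ≤ ∑ ν ∈ s, Module.finrank ℝ (eigenspace (T : H →ₗ[ℝ] H) ν) := by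
      rw [Finset.card_eq_sum_ones]
      exact Finset.sum_le_sum fun ν hν => fin1 ν (hs hν).1 (hs hν).2
    omega
  refine ⟨⟨hfin, ?_⟩, ?_⟩
  · have hs : ∀ ν ∈ hfin.toFinset, ν₀ < ν := fun ν hν => ((Set.Finite.mem_toFinset _).mp hν).1
    refine le_antisymm (bound _ hs) ?_
    by_contra! hlt
    obtain ⟨e1, e2⟩ := finrank_iSup_eigenspaces hT hfin.toFinset
      fun ν hν => (hν₀.trans (hs ν hν)).ne'
    have e3 := ContinuousLinearMap.finite_dimensional_eigenspace hT ν₀ hν₀.ne'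
    set G := (⨆ ν ∈ hfin.toFinset, eigenspace (T : H →ₗ[ℝ] H) ν : Submodule ℝ H)
    have e4 := Submodule.finrank_add_le_finrank_add_finrank G (eigenspace (T : H →ₗ[ℝ] H) ν₀)
    obtain ⟨f, hf, hf0, hfi⟩ := h3 (G ⊔ eigenspace (T : H →ₗ[ℝ] H) ν₀)
      (Submodule.finiteDimensional_sup _ _) (by omega)
    refine absurd hfi (not_le.mpr (inner_lt_of_mem_compl_eigenspaces hT hS hpos hν₀ ?_ hf0))
    intro ν hν
    rcases hν.eq_or_lt with rfl | hν
    · exact Submodule.orthogonal_le le_sup_right hf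
    · by_cases he : HasEigenvalue (T : H →ₗ[ℝ] H) ν
      · refine Submodule.orthogonal_le (le_trans ?_ le_sup_left) hf
        exact le_iSup₂_of_le ν ((Set.Finite.mem_toFinset _).mpr ⟨hν, he⟩) le_rfl
      · have : eigenspace (T : H →ₗ[ℝ] H) ν = ⊥ := by
          by_contra h; exact he h
        rw [this, Submodule.bot_orthogonal_eq_top]; trivial
  · intro hfin2
    apply h4
    have hAfin : ({ν : ℝ | ν ≠ 0 ∧ HasEigenvalue (T : H →ₗ[ℝ] H) ν}).Finite := by
      refine ((hfin.union hfin2).union (Set.finite_singleton ν₀)).subset ?_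
      rintro ν ⟨hν, he⟩
      have : 0 ≤ ν := eigenvalue_nonneg_of_nonneg he fun x => by
        rw [real_inner_comm]; exact hpos x
      have : 0 < ν := lt_of_le_of_ne this hν.symm
      rcases lt_trichotomy ν ν₀ with h | h | h
      · exact Or.inl (Or.inr ⟨this, h, he⟩)
      · exact Or.inr h
      · exact Or.inl (Or.inl ⟨h, he⟩)
    obtain ⟨e1, -⟩ := finrank_iSup_eigenspaces hT hAfin.toFinset
      fun ν hν => ((Set.Finite.mem_toFinset _).mp hν).1
    set G := (⨆ ν ∈ hAfin.toFinset, eigenspace (T : H →ₗ[ℝ] H) ν : Submodule ℝ H)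
    obtain ⟨S, hSc, hSs, hST, hSe⟩ := exists_restrict_compl_eigenspaces hT hS
      (hAfin.toFinset : Set ℝ) (V := Gᗮ) rfl
    have hS0 : S = 0 := by
      refine (ContinuousLinearMap.eq_zero_of_forall_hasEigenvalue_eq_zero hSc hSs).mp ?_
      intro ν he
      by_contra hν
      refine hSe ν ((Set.Finite.mem_toFinset _).mpr ⟨hν, ?_⟩) he
      obtain ⟨x, hx⟩ := he.exists_hasEigenvector
      have hx2 : T (x : H) = ν • (x : H) := by
        rw [← hST]; exact congrArg Subtype.val hx.apply_eq_smul
      exact hasEigenvalue_of_hasEigenvector (x := (x : H))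
        ⟨mem_eigenspace_iff.mpr hx2, fun h => hx.2 (Subtype.ext h)⟩
    have hle : LinearMap.range (T : H →ₗ[ℝ] H) ≤ G.map (T : H →ₗ[ℝ] H) := by
      rintro _ ⟨f, rfl⟩
      obtain ⟨a, ha, b, hb, rfl⟩ := G.exists_add_mem_mem_orthogonal f
      refine ⟨a, ha, ?_⟩
      have : T b = 0 := by
        have := hST ⟨b, hb⟩
        rw [hS0] at this
        exact this.symm
      simp [this]
    exact Submodule.finiteDimensional_of_le hle

end

section

open MeasureTheory Set

/-- The real Hilbert space `L²` over a bounded interval. -/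
noncomputable abbrev IntervalL2 (a b : ℝ) := Lp ℝ 2 (volume.restrict (Ioc a b))

theorem memLp_Ioc_of_bound {a b : ℝ} {F : ℝ → ℝ} (hF : AEStronglyMeasurable F) (C : ℝ)
    (hC : ∀ x ∈ Ioc a b, |F x| ≤ C) : MemLp F 2 (volume.restrict (Ioc a b)) :=
  MemLp.of_bound hF.restrict C ((ae_restrict_iff' measurableSet_Ioc).mpr (.of_forall hC))

theorem Continuous.memLp_Ioc {F : ℝ → ℝ} (hF : Continuous F) (a b : ℝ) :
    MemLp F 2 (volume.restrict (Ioc a b)) := by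
  obtain ⟨C, hC⟩ := isCompact_Icc.exists_bound_of_continuousOn (s := Icc a b) hF.continuousOn
  exact memLp_Ioc_of_bound hF.aestronglyMeasurable C fun x hx => hC x (Ioc_subset_Icc_self hx)

theorem MeasureTheory.MemLp.intervalIntegrable_Ioc {a b : ℝ} (hab : a ≤ b) {F : ℝ → ℝ}
    (hF : MemLp F 2 (volume.restrict (Ioc a b))) : IntervalIntegrable F volume a b :=
  (intervalIntegrable_iff_integrableOn_Ioc_of_le hab).mpr (hF.integrable one_le_two)

theorem inner_toLp_Ioc {a b : ℝ} (hab : a ≤ b) {F G : ℝ → ℝ}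
    (hF : MemLp F 2 (volume.restrict (Ioc a b))) (hG : MemLp G 2 (volume.restrict (Ioc a b))) :
    inner ℝ (hF.toLp F) (hG.toLp G) = ∫ x in a..b, F x * G x := by
  rw [L2.inner_def, intervalIntegral.integral_of_le hab]
  refine integral_congr_ae ?_
  filter_upwards [hF.coeFn_toLp, hG.coeFn_toLp] with x h1 h2
  rw [h1, h2]
  simp [mul_comm]

theorem toLp_eq_of_eqOn_Icc {a b : ℝ} {F G : ℝ → ℝ}
    (hF : MemLp F 2 (volume.restrict (Ioc a b))) (hG : MemLp G 2 (volume.restrict (Ioc a b)))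
    (h : ∀ x ∈ Icc a b, F x = G x) : hF.toLp F = hG.toLp G := by
  rw [MemLp.toLp_eq_toLp_iff]
  exact (ae_restrict_iff' measurableSet_Ioc).mpr
    (.of_forall fun x hx => h x (Ioc_subset_Icc_self hx))

theorem eqOn_Icc_of_toLp_eq {a b : ℝ} (hab : a < b) {F G : ℝ → ℝ} (hFc : Continuous F)
    (hGc : Continuous G) (h : (hFc.memLp_Ioc a b).toLp F = (hGc.memLp_Ioc a b).toLp G) :
    ∀ x ∈ Icc a b, F x = G x := by
  rw [MemLp.toLp_eq_toLp_iff] at h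
  have h1 : F =ᵐ[volume.restrict (Icc a b)] G := by
    rw [← restrict_Ioc_eq_restrict_Icc]; exact h
  exact fun x hx => Measure.eqOn_Icc_of_ae_eq _ hab.ne h1 hFc.continuousOn hGc.continuousOn hx

/-- Periodic functions extend by their values on one closed period. -/
theorem exists_periodic_extension {E : Type*} [TopologicalSpace E] {a b : ℝ} (hab : a < b)
    {f : ℝ → E} (hf : ContinuousOn f (Icc a b)) (hfab : f a = f b) :
    ∃ g : ℝ → E, Continuous g ∧ Function.Periodic g (b - a) ∧ ∀ x ∈ Icc a b, g x = f x := by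
  have : Fact (0 < b - a) := ⟨by linarith⟩
  have hb : a + (b - a) = b := by ring
  have hper : Function.Periodic (fun x : ℝ => AddCircle.liftIco (b - a) a f x) (b - a) := by
    intro x; simp
  have hIco : ∀ x ∈ Ico a b, AddCircle.liftIco (b - a) a f (x : AddCircle (b - a)) = f x := by
    intro x hx
    exact AddCircle.liftIco_coe_apply (by rwa [hb])
  refine ⟨fun x => AddCircle.liftIco (b - a) a f x, ?_, hper, ?_⟩
  · refine (AddCircle.liftIco_continuous (by rw [hb]; exact hfab) (by rwa [hb])).comp ?_
    exact AddCircle.continuous_mk' (b - a)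
  · intro x hx
    rcases hx.2.eq_or_lt with rfl | h
    · have h1 := hper a
      simp only [show a + (x - a) = x by ring] at h1
      show AddCircle.liftIco (x - a) a f (x : AddCircle (x - a)) = f x
      rw [h1, hIco a ⟨le_rfl, hab⟩, hfab]
    · exact hIco x ⟨hx.1, h⟩

/-- Periodic functions agreeing on a closed period agree. -/
theorem Function.Periodic.eq_of_eqOn_Icc {E : Type*} {a b : ℝ} (hab : a < b) {f g : ℝ → E}
    (hf : Function.Periodic f (b - a)) (hg : Function.Periodic g (b - a))
    (h : ∀ x ∈ Icc a b, f x = g x) : f = g := by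
  funext x
  obtain ⟨y, hy, hxy⟩ := hf.exists_mem_Ico (by linarith : 0 < b - a) x a
  have hfg : Function.Periodic (fun x => (f x, g x)) (b - a) := fun x => by
    simp only [hf x, hg x]
  obtain ⟨y, hy, hxy⟩ := hfg.exists_mem_Ico (by linarith : 0 < b - a) x a
  simp only [Prod.mk.injEq] at hxy
  rw [hxy.1, hxy.2]
  refine h y ⟨hy.1, ?_⟩
  have := hy.2
  linarith

theorem integral_hinge_mul {a b : ℝ} {F M M1 : ℝ → ℝ}
    (hF : IntervalIntegrable F volume a b) (hM : ∀ x, HasDerivAt M (M1 x) x)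
    (hM1 : Continuous M1) (hF1 : ∀ x ∈ Ioo a b, HasDerivWithinAt M1 (F x) (Ioi x) x)
    {x : ℝ} (hx : x ∈ Icc a b) :
    ∫ t in a..b, max (x - t) 0 * F t = M x - M a - (x - a) * M1 a := by
  have hMc : Continuous M := continuous_iff_continuousAt.mpr fun x => (hM x).continuousAt
  have hsub1 : uIcc a x ⊆ uIcc a b := by
    rw [uIcc_of_le hx.1, uIcc_of_le (hx.1.trans hx.2)]; exact Icc_subset_Icc_right hx.2
  have hsub2 : uIcc x b ⊆ uIcc a b := by
    rw [uIcc_of_le hx.2, uIcc_of_le (hx.1.trans hx.2)]; exact Icc_subset_Icc_left hx.1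
  have hI : IntervalIntegrable (fun t => max (x - t) 0 * F t) volume a b :=
    hF.continuousOn_mul (by fun_prop)
  rw [← intervalIntegral.integral_add_adjacent_intervals (hI.mono_set hsub1) (hI.mono_set hsub2)]
  have e2 : ∫ t in x..b, max (x - t) 0 * F t = 0 := by
    rw [intervalIntegral.integral_congr (g := fun _ => 0)]
    · simp
    · intro t ht
      rw [uIcc_of_le hx.2] at ht
      simp [max_eq_right (by linarith [ht.1] : x - t ≤ 0)]
  have e1 : ∫ t in a..x, max (x - t) 0 * F t = ∫ t in a..x, (x - t) * F t := by
    refine intervalIntegral.integral_congr fun t ht => ?_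
    rw [uIcc_of_le hx.1] at ht
    simp only [max_eq_left (by linarith [ht.2] : 0 ≤ x - t)]
  have e3 : ∫ t in a..x, (x - t) * F t = ((x - x) * M1 x + M x) - ((x - a) * M1 a + M a) := by
    refine intervalIntegral.integral_eq_sub_of_hasDeriv_right
      (f := fun t => (x - t) * M1 t + M t) (by fun_prop) ?_
      ((hF.mono_set hsub1).continuousOn_mul (by fun_prop))
    intro t ht
    rw [min_eq_left hx.1, max_eq_right hx.1] at ht
    have h1 := hF1 t ⟨ht.1, ht.2.trans_le hx.2⟩
    have h2 : HasDerivWithinAt (fun t : ℝ => x - t) (-1) (Ioi t) t :=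
      ((hasDerivAt_id t).const_sub x).hasDerivWithinAt
    exact ((h2.mul h1).add (hM t).hasDerivWithinAt).congr_deriv (by ring)
  rw [e2, e1, e3]
  ring

/-- A continuous periodic curve in `L²` representing the solution operator of the periodic
second-order problem `M'' = F` normalised by `∫ ω M = 0`. -/
structure IsGreenKernel (a b : ℝ) (ω : ℝ → ℝ) (k : ℝ → IntervalL2 a b) : Prop where
  continuous : Continuous k
  periodic : Function.Periodic k (b - a)
  inner_one : ∀ x, inner ℝ (k x)
    (((continuous_const (y := (1 : ℝ))).memLp_Ioc a b).toLp (fun _ => (1 : ℝ))) = 0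
  integral_eq_zero : ∀ f, ∫ x in a..b, ω x * inner ℝ (k x) f = 0
  inner_eq : ∀ (F M M1 : ℝ → ℝ) (hF : MemLp F 2 (volume.restrict (Ioc a b))),
    (∀ x, HasDerivAt M (M1 x) x) → Continuous M1 →
    (∀ x ∈ Ioo a b, HasDerivWithinAt M1 (F x) (Ioi x) x) → M a = M b → M1 a = M1 b →
    ∫ x in a..b, ω x * M x = 0 → ∀ x ∈ Icc a b, inner ℝ (k x) (hF.toLp F) = M x

theorem exists_isGreenKernel {a b : ℝ} (hab : a < b) {ω : ℝ → ℝ} (hω : Continuous ω)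
    (hΩ : (∫ x in a..b, ω x) ≠ 0) : ∃ k : ℝ → IntervalL2 a b, IsGreenKernel a b ω k := by
  set L := b - a with hL
  have hLpos : 0 < L := by linarith
  have hle := hab.le
  have hhc : ∀ x : ℝ, Continuous fun t : ℝ => max (x - t) 0 := fun x => by fun_prop
  let r : ℝ → IntervalL2 a b := fun x => ((hhc x).memLp_Ioc a b).toLp _
  have hr : Continuous r := by
    set C : ℝ := (measureUnivNNReal (volume.restrict (Ioc a b)) : ℝ) ^ (2 : ENNReal).toReal⁻¹
      with hC
    have hbd : ∀ x y, ‖r x - r y‖ ≤ C * |x - y| := by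
      intro x y
      have h1 : r x - r y = (((hhc x).memLp_Ioc a b).sub ((hhc y).memLp_Ioc a b)).toLp _ :=
        (MemLp.toLp_sub _ _).symm
      rw [h1]
      refine Lp.norm_le_of_ae_bound (abs_nonneg _) ?_
      filter_upwards [(((hhc x).memLp_Ioc a b).sub ((hhc y).memLp_Ioc a b)).coeFn_toLp] with t ht
      rw [ht]
      have := abs_max_sub_max_le_abs (x - t) (y - t) 0
      simpa using this
    refine continuous_iff_continuousAt.mpr fun x => ?_
    rw [ContinuousAt, tendsto_iff_norm_sub_tendsto_zero]
    refine squeeze_zero (fun _ => norm_nonneg _) (fun y => hbd y x) ?_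
    have : Filter.Tendsto (fun y : ℝ => C * |y - x|) (nhds x) (nhds (C * |x - x|)) :=
      Continuous.tendsto (by fun_prop) x
    simpa using this
  have hec : Continuous fun t : ℝ => b - t := by fun_prop
  let e : IntervalL2 a b := (hec.memLp_Ioc a b).toLp _
  let one : IntervalL2 a b := ((continuous_const (y := (1 : ℝ))).memLp_Ioc a b).toLp (fun _ => 1)
  let g : ℝ → IntervalL2 a b := fun x => r x - ((x - a) / L) • e
  have hg : Continuous g := by fun_prop
  let K₀ : ℝ → IntervalL2 a b := fun x => g x - (inner ℝ (g x) one / L) • one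
  have hK₀ : Continuous K₀ := by fun_prop
  set Ω := ∫ x in a..b, ω x
  let K : ℝ → IntervalL2 a b := fun x => K₀ x - Ω⁻¹ • ∫ y in a..b, ω y • K₀ y
  have hK : Continuous K := by fun_prop
  have hone : inner ℝ one one = L := by
    rw [inner_toLp_Ioc hle]; simp [hL]
  have hK₀one : ∀ x, inner ℝ (K₀ x) one = 0 := by
    intro x
    simp only [K₀, inner_sub_left, inner_smul_left, hone]
    simp only [conj_trivial]
    field_simp
    ring
  have hint : ∀ f, inner ℝ (∫ y in a..b, ω y • K₀ y) f = ∫ y in a..b, ω y * inner ℝ (K₀ y) f := by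
    intro f
    rw [real_inner_comm]
    have h1 := ContinuousLinearMap.intervalIntegral_comp_comm (innerSL ℝ f)
      ((by fun_prop : Continuous fun y => ω y • K₀ y).intervalIntegrable (μ := volume) a b)
    simp only [innerSL_apply_apply] at h1
    rw [← h1]
    refine intervalIntegral.integral_congr fun y _ => ?_
    simp only [inner_smul_right, real_inner_comm]
  have hKin : ∀ x f, inner ℝ (K x) f =
      inner ℝ (K₀ x) f - Ω⁻¹ * ∫ y in a..b, ω y * inner ℝ (K₀ y) f := by
    intro x f
    simp only [K, inner_sub_left, inner_smul_left, hint, conj_trivial]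
  have hKone : ∀ x, inner ℝ (K x) one = 0 := by
    intro x
    rw [hKin, hK₀one]
    simp [hK₀one]
  have hra : r a = 0 := by
    have h0 : (((continuous_const (y := (0 : ℝ))).memLp_Ioc a b).toLp (fun _ => (0 : ℝ)) :
      IntervalL2 a b) = 0 := MemLp.toLp_zero _
    rw [← h0]
    refine toLp_eq_of_eqOn_Icc _ _ fun t ht => ?_
    exact max_eq_right (by linarith [ht.1])
  have hrb : r b = e := by
    refine toLp_eq_of_eqOn_Icc _ _ fun t ht => ?_
    exact max_eq_left (by linarith [ht.2])
  have hgab : g a = g b := by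
    simp only [g, hra, hrb]
    rw [sub_self, ← hL, div_self hLpos.ne']
    simp
  have hKab : K a = K b := by simp only [K, K₀, hgab]
  obtain ⟨k, hkc, hkp, hkK⟩ := exists_periodic_extension hab hK.continuousOn hKab
  have hper : ∀ P : IntervalL2 a b → Prop, (∀ x, P (K x)) → ∀ x, P (k x) := by
    intro P hP x
    obtain ⟨y, hy, hxy⟩ := hkp.exists_mem_Ico hLpos x a
    rw [hxy, hkK y ⟨hy.1, by linarith [hy.2]⟩]
    exact hP y
  refine ⟨k, hkc, hkp, hper (fun v => inner ℝ v one = 0) hKone, ?_, ?_⟩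
  · intro f
    have h1 : ∫ x in a..b, ω x * inner ℝ (k x) f =
        ∫ x in a..b, (ω x * inner ℝ (K₀ x) f -
          ω x * (Ω⁻¹ * ∫ y in a..b, ω y * inner ℝ (K₀ y) f)) := by
      refine intervalIntegral.integral_congr fun x hx => ?_
      rw [uIcc_of_le hle] at hx
      simp only [hkK x hx, hKin, mul_sub]
    have hc : Continuous fun x => ω x * inner ℝ (K₀ x) f := by fun_prop
    rw [h1, intervalIntegral.integral_sub (hc.intervalIntegrable _ _)
      ((by fun_prop : Continuous fun x =>
        ω x * (Ω⁻¹ * ∫ y in a..b, ω y * inner ℝ (K₀ y) f)).intervalIntegrable _ _),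
      intervalIntegral.integral_mul_const]
    field_simp
    ring
  · intro F M M1 hF hM hM1 hF1 hMab hM1ab hMω x hx
    have hMc : Continuous M := continuous_iff_continuousAt.mpr fun x => (hM x).continuousAt
    have hFi := MemLp.intervalIntegrable_Ioc hle hF
    have hFone : inner ℝ one (hF.toLp F) = 0 := by
      rw [inner_toLp_Ioc hle]
      simp only [one_mul]
      rw [intervalIntegral.integral_eq_sub_of_hasDeriv_right hM1.continuousOn (by
        rwa [min_eq_left hle, max_eq_right hle]) hFi, hM1ab, sub_self]
    have hrF : ∀ y ∈ Icc a b, inner ℝ (r y) (hF.toLp F) = M y - M a - (y - a) * M1 a := by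
      intro y hy
      rw [inner_toLp_Ioc hle]
      exact integral_hinge_mul hFi hM hM1 hF1 hy
    have heF : inner ℝ e (hF.toLp F) = - (b - a) * M1 a := by
      rw [← hrb, hrF b ⟨hle, le_rfl⟩, hMab]; ring
    have hK₀F : ∀ y ∈ Icc a b, inner ℝ (K₀ y) (hF.toLp F) = M y - M a := by
      intro y hy
      simp only [K₀, g, inner_sub_left, inner_smul_left, hFone, heF, hrF y hy, conj_trivial]
      rw [← hL]
      field_simp
      ring
    rw [hkK x hx, hKin, hK₀F x hx]
    have h1 : ∫ y in a..b, ω y * inner ℝ (K₀ y) (hF.toLp F) =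
        ∫ y in a..b, (ω y * M y - ω y * M a) := by
      refine intervalIntegral.integral_congr fun y hy => ?_
      rw [uIcc_of_le hle] at hy
      simp only [hK₀F y hy, mul_sub]
    rw [h1, intervalIntegral.integral_sub 
      ((by fun_prop : Continuous fun y => ω y * M y).intervalIntegrable _ _)
      ((by fun_prop : Continuous fun y => ω y * M a).intervalIntegrable _ _),
      intervalIntegral.integral_mul_const, hMω]
    field_simp
    ring

end

section

open MeasureTheory Set

theorem periodic_of_hasDerivAt {a b : ℝ} {f f' : ℝ → ℝ} (hf : ∀ x, HasDerivAt f (f' x) x)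
    (hf' : Function.Periodic f' (b - a)) (hab : f a = f b) : Function.Periodic f (b - a) := by
  have h : ∀ x, HasDerivAt (fun x => f (x + (b - a)) - f x) 0 x := fun x => by
    have h1 := ((hf (x + (b - a))).comp_add_const x (b - a)).sub (hf x)
    rw [hf' x, sub_self] at h1
    exact h1
  intro x
  have h2 := is_const_of_deriv_eq_zero (fun x => (h x).differentiableAt) (fun x => (h x).deriv) x a
  simp only [add_sub_cancel, hab, sub_self] at h2
  linarith

theorem exists_double_primitive {a b : ℝ} (hab : a < b) {w ω : ℝ → ℝ} (hw : Continuous w)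
    (hw0 : ∫ x in a..b, w x = 0) (hω : Continuous ω) (hΩ : (∫ x in a..b, ω x) ≠ 0) :
    ∃ Y Y1 : ℝ → ℝ, (∀ x, HasDerivAt Y (Y1 x) x) ∧ (∀ x, HasDerivAt Y1 (w x) x) ∧
      Y a = Y b ∧ Y1 a = Y1 b ∧ ∫ x in a..b, ω x * Y x = 0 := by
  let A : ℝ → ℝ := fun x => ∫ t in a..x, w t
  have hA : ∀ x, HasDerivAt A (w x) x := fun x =>
    (hw.integral_hasStrictDerivAt a x).hasDerivAt
  have hAc : Continuous A := continuous_iff_continuousAt.mpr fun x => (hA x).continuousAt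
  let c := (∫ t in a..b, A t) / (b - a)
  let Y1 : ℝ → ℝ := fun x => A x - c
  have hY1 : ∀ x, HasDerivAt Y1 (w x) x := fun x => (hA x).sub_const c
  have hY1c : Continuous Y1 := by fun_prop
  let B : ℝ → ℝ := fun x => ∫ t in a..x, Y1 t
  have hB : ∀ x, HasDerivAt B (Y1 x) x := fun x =>
    (hY1c.integral_hasStrictDerivAt a x).hasDerivAt
  have hBc : Continuous B := continuous_iff_continuousAt.mpr fun x => (hB x).continuousAt
  let d := (∫ t in a..b, ω t * B t) / ∫ t in a..b, ω t
  refine ⟨fun x => B x - d, Y1, fun x => (hB x).sub_const d, hY1, ?_, ?_, ?_⟩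
  · have h1 : B b = 0 := by
      show ∫ t in a..b, (A t - c) = 0
      rw [intervalIntegral.integral_sub (hAc.intervalIntegrable _ _) (by simp)]
      simp only [intervalIntegral.integral_const, smul_eq_mul, c]
      rw [mul_div_cancel₀ _ (by linarith), sub_self]
    have h2 : B a = 0 := by simp [B]
    simp only [h1, h2]
  · have h1 : A b = 0 := hw0
    have h2 : A a = 0 := by simp [A]
    simp only [Y1, h1, h2]
  · simp only [mul_sub]
    rw [intervalIntegral.integral_sub
      ((by fun_prop : Continuous fun x => ω x * B x).intervalIntegrable _ _)
      ((by fun_prop : Continuous fun x => ω x * d).intervalIntegrable _ _),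
      intervalIntegral.integral_mul_const]
    simp only [d]
    field_simp
    ring

theorem intervalIntegral_mem_of_isClosed {E : Type*} [NormedAddCommGroup E] [NormedSpace ℝ E]
    [CompleteSpace E] {S : Submodule ℝ E} (hS : IsClosed (S : Set E)) {a b : ℝ} {A : ℝ → E}
    (hA : Continuous A) (hAS : ∀ x, A x ∈ S) : ∫ x in a..b, A x ∈ S := by
  have : CompleteSpace S := hS.completeSpace_coe
  have h2 := ContinuousLinearMap.intervalIntegral_comp_comm S.subtypeL
    ((hA.subtype_mk hAS).intervalIntegrable (μ := volume) a b)
  simp only [Submodule.subtypeL_apply] at h2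
  rw [h2]
  exact (∫ x in a..b, (⟨A x, hAS x⟩ : S)).2

/-- Integral operator attached to a Green kernel. -/
structure IsGreenOperator (a b : ℝ) (ω : ℝ → ℝ) (k : ℝ → IntervalL2 a b)
    (T : IntervalL2 a b →L[ℝ] IntervalL2 a b) : Prop where
  compact : IsCompactOperator T
  inner_eq : ∀ f h, inner ℝ (T f) h = ∫ x in a..b, ω x * inner ℝ (k x) f * inner ℝ (k x) h
  eq_toLp : ∀ (f : IntervalL2 a b) (Y Y1 : ℝ → ℝ) (hY : Continuous Y),
    (∀ x, HasDerivAt Y (Y1 x) x) → (∀ x, HasDerivAt Y1 (ω x * inner ℝ (k x) f) x) →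
    Y a = Y b → Y1 a = Y1 b → ∫ x in a..b, Y x = 0 → T f = (hY.memLp_Ioc a b).toLp Y

theorem IsGreenOperator.isSymmetric {a b : ℝ} {ω : ℝ → ℝ} {k : ℝ → IntervalL2 a b}
    {T : IntervalL2 a b →L[ℝ] IntervalL2 a b} (h : IsGreenOperator a b ω k T) :
    (T : IntervalL2 a b →ₗ[ℝ] IntervalL2 a b).IsSymmetric := by
  intro f g
  have h1 := h.inner_eq f g
  have h2 := h.inner_eq g f
  rw [real_inner_comm] at h2
  refine h1.trans (Eq.trans ?_ h2.symm)
  congr 1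
  funext x
  ring

theorem exists_isGreenOperator {a b : ℝ} (hab : a < b) {ω : ℝ → ℝ} (hω : Continuous ω)
    (hΩ : (∫ x in a..b, ω x) ≠ 0) {k : ℝ → IntervalL2 a b} (hk : IsGreenKernel a b ω k) :
    ∃ T, IsGreenOperator a b ω k T := by
  have hle := hab.le
  have hkc := hk.continuous
  let A : ℝ → IntervalL2 a b →L[ℝ] IntervalL2 a b := fun x =>
    ω x • InnerProductSpace.rankOne ℝ (k x) (k x)
  have hA : Continuous A := by
    refine hω.smul ?_
    exact ((InnerProductSpace.rankOne ℝ).continuous.comp hkc).clm_apply hkc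
  have hAi : IntervalIntegrable A volume a b := hA.intervalIntegrable _ _
  have hinner : ∀ f h, inner ℝ ((∫ x in a..b, A x) f) h =
      ∫ x in a..b, ω x * inner ℝ (k x) f * inner ℝ (k x) h := by
    intro f h
    rw [ContinuousLinearMap.intervalIntegral_apply hAi, real_inner_comm]
    have h1 := ContinuousLinearMap.intervalIntegral_comp_comm (innerSL ℝ h)
      ((hA.clm_apply continuous_const).intervalIntegrable (μ := volume) (u := fun x => A x f) a b)
    simp only [innerSL_apply_apply] at h1
    rw [← h1]
    refine intervalIntegral.integral_congr fun y _ => ?_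
    simp only [A, smul_apply, InnerProductSpace.rankOne_apply,
      inner_smul_right, real_inner_comm]
    ring
  refine ⟨∫ x in a..b, A x, ?_, hinner, ?_⟩
  · have hcl : IsClosed (compactOperator (RingHom.id ℝ) (IntervalL2 a b) (IntervalL2 a b) :
        Set (IntervalL2 a b →L[ℝ] IntervalL2 a b)) := isClosed_setOfPred_isCompactOperator
    have hAk : ∀ x, A x ∈ compactOperator (RingHom.id ℝ) (IntervalL2 a b) (IntervalL2 a b) := by
      intro x
      refine Submodule.smul_mem _ _ ?_
      show IsCompactOperator (InnerProductSpace.rankOne ℝ (k x) (k x))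
      have h1 : (InnerProductSpace.rankOne ℝ (k x) (k x) : IntervalL2 a b → IntervalL2 a b) =
          (ContinuousLinearMap.toSpanSingleton ℝ (k x)) ∘ (innerSL ℝ (k x)) := by
        funext f
        simp [InnerProductSpace.rankOne_apply]
      rw [h1]
      exact (isCompactOperator_of_locallyCompactSpace_rng
        (ContinuousLinearMap.toSpanSingleton ℝ (k x))).comp_clm (innerSL ℝ (k x))
    exact intervalIntegral_mem_of_isClosed hcl hA hAk
  · intro f Y Y1 hY hY' hY1 hYab hY1ab hY0
    refine Dense.eq_of_inner_left ℝ (BoundedContinuousFunction.toLp_denseRange ℝ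
      (volume.restrict (Ioc a b)) (p := 2) ℝ (by simp)) ?_
    rintro _ ⟨H, rfl⟩
    have hHc : Continuous H := H.continuous
    have hH : BoundedContinuousFunction.toLp 2 (volume.restrict (Ioc a b)) ℝ H =
        (hHc.memLp_Ioc a b).toLp H := rfl
    rw [hH, hinner, inner_toLp_Ioc hle]
    set c := (∫ x in a..b, H x) / (b - a)
    have hG : Continuous fun x => H x - c := by fun_prop
    have hG0 : ∫ x in a..b, (H x - c) = 0 := by
      rw [intervalIntegral.integral_sub (hHc.intervalIntegrable _ _) (by simp)]
      simp only [intervalIntegral.integral_const, smul_eq_mul, c]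
      rw [mul_div_cancel₀ _ (by linarith), sub_self]
    obtain ⟨M, M1, hM, hM1, hMab, hM1ab, hM0⟩ := exists_double_primitive hab hG hG0 hω hΩ
    have hMc : Continuous M := continuous_iff_continuousAt.mpr fun x => (hM x).continuousAt
    have hM1c : Continuous M1 := continuous_iff_continuousAt.mpr fun x => (hM1 x).continuousAt
    have hY1c : Continuous Y1 := continuous_iff_continuousAt.mpr fun x => (hY1 x).continuousAt
    have hkG := hk.inner_eq _ M M1 (hG.memLp_Ioc a b) hM hM1c
      (fun x _ => (hM1 x).hasDerivWithinAt) hMab hM1ab hM0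
    have hkH : ∀ x ∈ Icc a b, inner ℝ (k x) ((hHc.memLp_Ioc a b).toLp H) = M x := by
      intro x hx
      have h1 : (hHc.memLp_Ioc a b).toLp H = (hG.memLp_Ioc a b).toLp _ +
          c • (((continuous_const (y := (1 : ℝ))).memLp_Ioc a b).toLp (fun _ => (1 : ℝ))) := by
        rw [← MemLp.toLp_const_smul, ← MemLp.toLp_add]
        refine toLp_eq_of_eqOn_Icc _ _ fun t _ => ?_
        simp
      rw [h1, inner_add_right, inner_smul_right, hk.inner_one, mul_zero, add_zero, hkG x hx]
    have e1 : ∫ x in a..b, ω x * inner ℝ (k x) f * inner ℝ (k x) ((hHc.memLp_Ioc a b).toLp H) =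
        ∫ x in a..b, ω x * inner ℝ (k x) f * M x := by
      refine intervalIntegral.integral_congr fun x hx => ?_
      rw [uIcc_of_le hle] at hx
      simp only [hkH x hx]
    have e2 : ∫ x in a..b, (ω x * inner ℝ (k x) f * M x - Y x * (H x - c)) =
        (Y1 b * M b - Y b * M1 b) - (Y1 a * M a - Y a * M1 a) := by
      refine intervalIntegral.integral_eq_sub_of_hasDerivAt
        (f := fun x => Y1 x * M x - Y x * M1 x) (fun x _ => ?_) ?_
      · exact (((hY1 x).mul (hM x)).sub ((hY' x).mul (hM1 x))).congr_deriv (by ring)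
      · exact Continuous.intervalIntegrable (by fun_prop) _ _
    rw [intervalIntegral.integral_sub
      (Continuous.intervalIntegrable (by fun_prop) _ _)
      (Continuous.intervalIntegrable (by fun_prop) _ _), hYab, hY1ab, hMab, hM1ab, sub_self] at e2
    have e3 : ∫ x in a..b, Y x * (H x - c) = ∫ x in a..b, Y x * H x := by
      simp only [mul_sub]
      rw [intervalIntegral.integral_sub
        (Continuous.intervalIntegrable (by fun_prop) _ _)
        (Continuous.intervalIntegrable (by fun_prop) _ _),
        intervalIntegral.integral_mul_const, hY0, zero_mul, sub_zero]
    rw [e1, ← e3]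
    linarith

end

section

open MeasureTheory Set

theorem Function.Periodic.of_hasDerivAt {c : ℝ} {f f' : ℝ → ℝ} (hf : ∀ x, HasDerivAt f (f' x) x)
    (hp : Function.Periodic f c) : Function.Periodic f' c := by
  intro x
  have h1 := (hf (x + c)).comp_add_const x c
  have h2 : (fun x => f (x + c)) = f := funext hp
  rw [h2] at h1
  exact h1.unique (hf x)

theorem continuous_of_hasDerivAt {f f' : ℝ → ℝ} (hf : ∀ x, HasDerivAt f (f' x) x) :
    Continuous f := continuous_iff_continuousAt.mpr fun x => (hf x).continuousAt

/-- Periodic solutions of `M'' = F`, `F'' = μ ω M`, recorded by their component `F`. -/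
def weightedModes (p : ℝ) (ω : ℝ → ℝ) (μ : ℝ) : Submodule ℝ (ℝ → ℝ) where
  carrier := {F | ∃ F1 M M1 : ℝ → ℝ, (∀ x, HasDerivAt F (F1 x) x) ∧
    (∀ x, HasDerivAt F1 (μ * (ω x * M x)) x) ∧ (∀ x, HasDerivAt M (M1 x) x) ∧
    (∀ x, HasDerivAt M1 (F x) x) ∧ Function.Periodic F p ∧ Function.Periodic M p}
  add_mem' := by
    rintro F G ⟨F1, M, M1, h1, h2, h3, h4, h5, h6⟩ ⟨G1, K, K1, g1, g2, g3, g4, g5, g6⟩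
    refine ⟨F1 + G1, M + K, M1 + K1, fun x => (h1 x).add (g1 x), fun x => ?_,
      fun x => (h3 x).add (g3 x), fun x => (h4 x).add (g4 x), h5.add g5, h6.add g6⟩
    exact ((h2 x).add (g2 x)).congr_deriv (by simp only [Pi.add_apply]; ring)
  zero_mem' := ⟨0, 0, 0, fun x => hasDerivAt_const x 0, fun x => by
    simp, fun x => hasDerivAt_const x 0,
    fun x => hasDerivAt_const x 0, fun x => rfl, fun x => rfl⟩
  smul_mem' := by
    rintro c F ⟨F1, M, M1, h1, h2, h3, h4, h5, h6⟩
    refine ⟨c • F1, c • M, c • M1, fun x => (h1 x).const_smul c, fun x => ?_,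
      fun x => (h3 x).const_smul c, fun x => (h4 x).const_smul c, h5.smul c, h6.smul c⟩
    exact ((h2 x).const_smul c).congr_deriv (by simp only [Pi.smul_apply, smul_eq_mul]; ring)

section

variable {a b : ℝ} {ω : ℝ → ℝ} {k : ℝ → IntervalL2 a b}
  {T : IntervalL2 a b →L[ℝ] IntervalL2 a b}

theorem IsGreenKernel.inner_eq_of_periodic (hab : a < b) (hk : IsGreenKernel a b ω k)
    {F M M1 : ℝ → ℝ} (hF : Continuous F) (hM : ∀ x, HasDerivAt M (M1 x) x)
    (hM1 : ∀ x, HasDerivAt M1 (F x) x) (hMp : Function.Periodic M (b - a))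
    (hM0 : ∫ x in a..b, ω x * M x = 0) (x : ℝ) :
    inner ℝ (k x) ((hF.memLp_Ioc a b).toLp F) = M x := by
  have hb : a + (b - a) = b := by ring
  have hMab : M a = M b := by rw [← hMp a, hb]
  have hM1ab : M1 a = M1 b := by rw [← (hMp.of_hasDerivAt hM) a, hb]
  have h1 := hk.inner_eq F M M1 (hF.memLp_Ioc a b) hM (continuous_of_hasDerivAt hM1)
    (fun x _ => (hM1 x).hasDerivWithinAt) hMab hM1ab hM0
  have h2 : Function.Periodic (fun x => inner ℝ (k x) ((hF.memLp_Ioc a b).toLp F)) (b - a) :=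
    fun x => by simp only [hk.periodic x]
  exact congrFun (h2.eq_of_eqOn_Icc hab hMp h1) x

/-- Elements in the range of the Green operator have regular representatives. -/
theorem IsGreenOperator.exists_representative (hab : a < b) (hω : Continuous ω)
    (hωp : Function.Periodic ω (b - a))
    (hΩ : (∫ x in a..b, ω x) ≠ 0) (hk : IsGreenKernel a b ω k) (hT : IsGreenOperator a b ω k T)
    (f : IntervalL2 a b) :
    ∃ (F F1 M M1 : ℝ → ℝ) (hF : Continuous F), (∀ x, HasDerivAt F (F1 x) x) ∧
      (∀ x, HasDerivAt F1 (ω x * inner ℝ (k x) f) x) ∧ (∀ x, HasDerivAt M (M1 x) x) ∧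
      (∀ x, HasDerivAt M1 (F x) x) ∧ Function.Periodic F (b - a) ∧ Function.Periodic M (b - a) ∧
      ∫ x in a..b, ω x * M x = 0 ∧
      T f = (hF.memLp_Ioc a b).toLp F ∧ ∀ x, inner ℝ (k x) (T f) = M x := by
  have hkc := hk.continuous
  have hw : Continuous fun x => ω x * inner ℝ (k x) f := by fun_prop
  have hwp : Function.Periodic (fun x => ω x * inner ℝ (k x) f) (b - a) := fun x => by
    simp only [hωp x, hk.periodic x]
  obtain ⟨F, F1, hF, hF1, hFab, hF1ab, hF0⟩ := exists_double_primitive hab hw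
    (hk.integral_eq_zero f) (continuous_const (y := (1 : ℝ))) (by simp; linarith)
  have hF0 : ∫ x in a..b, F x = 0 := by simpa using hF0
  have hFc := continuous_of_hasDerivAt hF
  have hF1p := periodic_of_hasDerivAt hF1 hwp hF1ab
  have hFp := periodic_of_hasDerivAt hF hF1p hFab
  obtain ⟨M, M1, hM, hM1, hMab, hM1ab, hM0⟩ := exists_double_primitive hab hFc hF0 hω hΩ
  have hM1p := periodic_of_hasDerivAt hM1 hFp hM1ab
  have hMp := periodic_of_hasDerivAt hM hM1p hMab
  have hTf := hT.eq_toLp f F F1 hFc hF hF1 hFab hF1ab hF0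
  refine ⟨F, F1, M, M1, hFc, hF, hF1, hM, hM1, hFp, hMp, hM0, hTf, fun x => ?_⟩
  rw [hTf]
  exact hk.inner_eq_of_periodic hab hFc hM hM1 hMp hM0 x

theorem IsGreenOperator.inner_self_nonneg (hab : a < b) (hω : ∀ x, 0 < ω x)
    (hT : IsGreenOperator a b ω k T) (f : IntervalL2 a b) : 0 ≤ inner ℝ (T f) f := by
  rw [hT.inner_eq]
  refine intervalIntegral.integral_nonneg hab.le fun x _ => ?_
  have := hω x
  rw [mul_assoc]
  exact mul_nonneg this.le (mul_self_nonneg _)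

theorem IsGreenOperator.map_mode (hab : a < b) (hk : IsGreenKernel a b ω k)
    (hT : IsGreenOperator a b ω k T) (hω : Continuous ω) {μ : ℝ} (hμ : μ ≠ 0) {F : ℝ → ℝ}
    (hF : F ∈ weightedModes (b - a) ω μ) (hFc : Continuous F) :
    T ((hFc.memLp_Ioc a b).toLp F) = μ⁻¹ • (hFc.memLp_Ioc a b).toLp F := by
  obtain ⟨F1, M, M1, h1, h2, h3, h4, h5, h6⟩ := hF
  have hb : a + (b - a) = b := by ring
  have hMc := continuous_of_hasDerivAt h3
  have hFab : F a = F b := by rw [← h5 a, hb]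
  have hF1ab : F1 a = F1 b := by rw [← (h5.of_hasDerivAt h1) a, hb]
  have hM1ab : M1 a = M1 b := by rw [← (h6.of_hasDerivAt h3) a, hb]
  have hM0 : ∫ x in a..b, ω x * M x = 0 := by
    have e : ∫ x in a..b, μ * (ω x * M x) = F1 b - F1 a :=
      intervalIntegral.integral_eq_sub_of_hasDerivAt (fun x _ => h2 x)
        (Continuous.intervalIntegrable (by fun_prop) _ _)
    rw [hF1ab, sub_self, intervalIntegral.integral_const_mul] at e
    exact (mul_eq_zero.mp e).resolve_left hμ
  have hF0 : ∫ x in a..b, F x = 0 := by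
    rw [intervalIntegral.integral_eq_sub_of_hasDerivAt (fun x _ => h4 x)
        (Continuous.intervalIntegrable (by fun_prop) _ _), hM1ab, sub_self]
  have hin := hk.inner_eq_of_periodic hab hFc h3 h4 h6 hM0
  have hY : Continuous (μ⁻¹ • F) := by fun_prop
  rw [hT.eq_toLp _ (μ⁻¹ • F) (μ⁻¹ • F1) hY (fun x => (h1 x).const_smul _) ?_ (by simp [hFab])
    (by simp [hF1ab]) (by simp [hF0])]
  · exact MemLp.toLp_const_smul _ _
  · intro x
    refine ((h2 x).const_smul μ⁻¹).congr_deriv ?_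
    rw [hin]
    simp only [smul_eq_mul]
    field_simp

theorem weightedModes_continuous {p μ : ℝ} {F : ℝ → ℝ} (hF : F ∈ weightedModes p ω μ) :
    Continuous F := by
  obtain ⟨F1, M, M1, h1, -⟩ := hF
  exact continuous_of_hasDerivAt h1

open Module.End in
/-- The eigenspaces of the Green operator are the spaces of periodic modes. -/
theorem IsGreenOperator.exists_equiv_eigenspace (hab : a < b) (hω : Continuous ω)
    (hωp : Function.Periodic ω (b - a))
    (hΩ : (∫ x in a..b, ω x) ≠ 0) (hk : IsGreenKernel a b ω k) (hT : IsGreenOperator a b ω k T)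
    {μ : ℝ} (hμ : μ ≠ 0) :
    Nonempty (weightedModes (b - a) ω μ ≃ₗ[ℝ]
      eigenspace (T : IntervalL2 a b →ₗ[ℝ] IntervalL2 a b) μ⁻¹) := by
  let Φ : weightedModes (b - a) ω μ →ₗ[ℝ]
      eigenspace (T : IntervalL2 a b →ₗ[ℝ] IntervalL2 a b) μ⁻¹ :=
    { toFun := fun F => ⟨((weightedModes_continuous F.2).memLp_Ioc a b).toLp F,
        mem_eigenspace_iff.mpr (hT.map_mode hab hk hω hμ F.2 (weightedModes_continuous F.2))⟩
      map_add' := fun F G => Subtype.ext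
        (MemLp.toLp_add ((weightedModes_continuous F.2).memLp_Ioc a b)
          ((weightedModes_continuous G.2).memLp_Ioc a b))
      map_smul' := fun c F => Subtype.ext
        (MemLp.toLp_const_smul c ((weightedModes_continuous F.2).memLp_Ioc a b)) }
  refine ⟨LinearEquiv.ofBijective Φ ⟨?_, ?_⟩⟩
  · intro F G hFG
    have h1 := congrArg Subtype.val hFG
    have h2 := eqOn_Icc_of_toLp_eq hab (weightedModes_continuous F.2)
      (weightedModes_continuous G.2) h1
    have hFp : Function.Periodic (F : ℝ → ℝ) (b - a) := by
      obtain ⟨_, _, _, -, -, -, -, h, -⟩ := F.2; exact h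
    have hGp : Function.Periodic (G : ℝ → ℝ) (b - a) := by
      obtain ⟨_, _, _, -, -, -, -, h, -⟩ := G.2; exact h
    exact Subtype.ext (hFp.eq_of_eqOn_Icc hab hGp h2)
  · rintro ⟨f, hf⟩
    have hTf : T f = μ⁻¹ • f := mem_eigenspace_iff.mp hf
    obtain ⟨F, F1, M, M1, hFc, hF, hF1, hM, hM1, hFp, hMp, -, hTF, hkM⟩ :=
      hT.exists_representative hab hω hωp hΩ hk f
    have hkf : ∀ x, inner ℝ (k x) f = μ * M x := by
      intro x
      rw [← hkM x, hTf, inner_smul_right]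
      field_simp
    have hmem : μ • F ∈ weightedModes (b - a) ω μ := by
      refine ⟨μ • F1, μ • M, μ • M1, fun x => (hF x).const_smul μ, fun x => ?_,
        fun x => (hM x).const_smul μ, fun x => (hM1 x).const_smul μ, hFp.smul μ, hMp.smul μ⟩
      refine ((hF1 x).const_smul μ).congr_deriv ?_
      rw [hkf]; simp
    refine ⟨⟨μ • F, hmem⟩, Subtype.ext ?_⟩
    show MemLp.toLp (μ • F) ((weightedModes_continuous hmem).memLp_Ioc a b) = f
    rw [MemLp.toLp_const_smul (c := μ) (hFc.memLp_Ioc a b), ← hTF, hTf, smul_smul,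
      mul_inv_cancel₀ hμ, one_smul]

theorem IsGreenOperator.not_finiteDimensional_range (hab : a < b) (hω : Continuous ω)
    (hωpos : ∀ x, 0 < ω x) (hΩ : (∫ x in a..b, ω x) ≠ 0) (hk : IsGreenKernel a b ω k)
    (hT : IsGreenOperator a b ω k T) :
    ¬ FiniteDimensional ℝ
      (LinearMap.range (T : IntervalL2 a b →ₗ[ℝ] IntervalL2 a b)) := by
  intro hfin
  have hc : ∀ q : Polynomial ℝ, Continuous fun x => (Polynomial.X * q).eval x :=
    fun q => Polynomial.continuous _
  let J : Polynomial ℝ →ₗ[ℝ] IntervalL2 a b :=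
    { toFun := fun q => ((hc q).memLp_Ioc a b).toLp _
      map_add' := fun p q => by
        rw [← MemLp.toLp_add]
        exact toLp_eq_of_eqOn_Icc _ _ fun x _ => by simp [mul_add]
      map_smul' := fun c q => by
        rw [RingHom.id_apply, ← MemLp.toLp_const_smul]
        exact toLp_eq_of_eqOn_Icc _ _ fun x _ => by simp }
  let Φ := (T : IntervalL2 a b →ₗ[ℝ] IntervalL2 a b).rangeRestrict ∘ₗ J
  have hinj : Function.Injective Φ := by
    rw [← LinearMap.ker_eq_bot, LinearMap.ker_eq_bot']
    intro q hq
    have hTq : T (J q) = 0 := congrArg Subtype.val hq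
    set c := (∫ x in a..b, (Polynomial.X * q).eval x) / (b - a)
    have hG : Continuous fun x => (Polynomial.X * q).eval x - c := (hc q).sub continuous_const
    have hG0 : ∫ x in a..b, ((Polynomial.X * q).eval x - c) = 0 := by
      rw [intervalIntegral.integral_sub ((hc q).intervalIntegrable _ _) (by simp)]
      simp only [intervalIntegral.integral_const, smul_eq_mul, c]
      rw [mul_div_cancel₀ _ (by linarith), sub_self]
    obtain ⟨M, M1, hM, hM1, hMab, hM1ab, hM0⟩ := exists_double_primitive hab hG hG0 hω hΩ
    have hkG := hk.inner_eq _ M M1 (hG.memLp_Ioc a b) hM (continuous_of_hasDerivAt hM1)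
      (fun x _ => (hM1 x).hasDerivWithinAt) hMab hM1ab hM0
    have hkJ : ∀ x ∈ Icc a b, inner ℝ (k x) (J q) = M x := by
      intro x hx
      have h1 : J q = (hG.memLp_Ioc a b).toLp _ +
          c • (((continuous_const (y := (1 : ℝ))).memLp_Ioc a b).toLp (fun _ => (1 : ℝ))) := by
        rw [← MemLp.toLp_const_smul, ← MemLp.toLp_add]
        refine toLp_eq_of_eqOn_Icc ((hc q).memLp_Ioc a b) _ fun t _ => ?_
        simp
      rw [h1, inner_add_right, inner_smul_right, hk.inner_one, mul_zero, add_zero, hkG x hx]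
    have hz : ∫ x in a..b, ω x * inner ℝ (k x) (J q) * inner ℝ (k x) (J q) = 0 := by
      rw [← hT.inner_eq, hTq, inner_zero_left]
    have hkc := hk.continuous
    have hMz : ∀ x ∈ Icc a b, M x = 0 := by
      intro x hx
      by_contra hne
      refine hz.not_gt (intervalIntegral.integral_pos hab ?_ ?_ ⟨x, hx, ?_⟩)
      · exact Continuous.continuousOn (by fun_prop)
      · intro y _
        rw [mul_assoc]
        exact mul_nonneg (hωpos y).le (mul_self_nonneg _)
      · rw [hkJ x hx, mul_assoc]
        exact mul_pos (hωpos x) (mul_self_pos.mpr hne)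
    have hM1z : ∀ x ∈ Ioo a b, M1 x = 0 := fun x hx => by
      have h1 : HasDerivAt M 0 x := (hasDerivAt_const x (0 : ℝ)).congr_of_eventuallyEq
        (Filter.eventually_of_mem (Icc_mem_nhds hx.1 hx.2) hMz)
      exact (hM x).unique h1
    have hGz : ∀ x ∈ Ioo a b, (Polynomial.X * q).eval x - c = 0 := fun x hx => by
      have h1 : HasDerivAt M1 0 x := (hasDerivAt_const x (0 : ℝ)).congr_of_eventuallyEq
        (Filter.eventually_of_mem (Ioo_mem_nhds hx.1 hx.2) hM1z)
      exact (hM1 x).unique h1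
    have hpoly : Polynomial.X * q = Polynomial.C c := by
      refine Polynomial.eq_of_infinite_eval_eq _ _ ((Ioo_infinite hab).mono fun x hx => ?_)
      simp only [mem_ofPred_eq, Polynomial.eval_C]
      linarith [hGz x hx]
    have hc0 : c = 0 := by simpa using (congrArg (Polynomial.eval 0) hpoly).symm
    rw [hc0, Polynomial.C_0] at hpoly
    exact (mul_eq_zero.mp hpoly).resolve_left Polynomial.X_ne_zero
  exact Polynomial.not_finite (Module.Finite.of_injective Φ hinj)

end

end

section

open MeasureTheory Set

/-- A periodic factorization of the fourth order equation `m'''' = κ ω m` through the first order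
operator `m' - R m` and Hill's equation `u'' + q u = 0`, `q = R² + 3 R'`, together with a
fundamental system `ψ`, `η` of Hill's equation and the consecutive zeros of `ψ`. -/
structure HillFactorization where
  (ω R R1 ρ1 ψ ψ1 η η1 m0 : ℝ → ℝ)
  (κ c W : ℝ)
  n : ℕ
  z : ℕ → ℝ
  n_pos : 0 < n
  κ_pos : 0 < κ
  c_pos : 0 < c
  W_pos : 0 < W
  ω_continuous : Continuous ω
  ω_pos : ∀ x, 0 < ω x
  ω_periodic : Function.Periodic ω (z n - z 0)
  R_pos : ∀ x, 0 < R x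
  R_periodic : Function.Periodic R (z n - z 0)
  hasDerivAt_R : ∀ x, HasDerivAt R (R1 x) x
  hasDerivAt_R1 : ∀ x, HasDerivAt R1 (ρ1 x - 2 * R x * R1 x) x
  hasDerivAt_ρ1 : ∀ x, HasDerivAt ρ1 (κ * ω x - (R1 x + R x ^ 2) ^ 2 - 2 * ρ1 x * R x) x
  hasDerivAt_ψ : ∀ x, HasDerivAt ψ (ψ1 x) x
  hasDerivAt_ψ1 : ∀ x, HasDerivAt ψ1 (-((R x ^ 2 + 3 * R1 x) * ψ x)) x
  hasDerivAt_η : ∀ x, HasDerivAt η (η1 x) x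
  hasDerivAt_η1 : ∀ x, HasDerivAt η1 (-((R x ^ 2 + 3 * R1 x) * η x)) x
  hasDerivAt_m0 : ∀ x, HasDerivAt m0 (R x * m0 x + ψ x) x
  m0_periodic : Function.Periodic m0 (z n - z 0)
  wronskian : ∀ x, ψ x * η1 x - ψ1 x * η x = W
  η_end : η (z n) = η (z 0)
  η1_end : η1 (z n) = η1 (z 0) - c * ψ1 (z 0)
  z_strictMono : StrictMono z
  ψ_zero : ∀ i, ψ (z i) = 0
  ψ_ne_zero : ∀ i, ∀ x ∈ Ioo (z i) (z (i + 1)), ψ x ≠ 0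

theorem eq_zero_of_hasDerivAt_mul_of_periodic {p : ℝ} {w r G : ℝ → ℝ}
    (hw : ∀ x, HasDerivAt w (r x * w x) x) (hG : ∀ x, HasDerivAt G (r x) x)
    (hGp : ∀ x, G (x + p) ≠ G x) (hp : Function.Periodic w p) : w = 0 := by
  have h1 : ∀ x, HasDerivAt (fun x => w x * Real.exp (-G x)) 0 x := fun x =>
    ((hw x).mul (hG x).neg.exp).congr_deriv (by simp only [Pi.neg_apply]; ring)
  funext x
  have h2 : w (x + p) * Real.exp (-G (x + p)) = w x * Real.exp (-G x) :=
    is_const_of_deriv_eq_zero (fun x => (h1 x).differentiableAt) (fun x => (h1 x).deriv) _ _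
  rw [hp] at h2
  by_contra hne
  have h3 := Real.exp_injective (mul_left_cancel₀ hne h2)
  exact hGp x (neg_injective h3)

namespace HillFactorization

variable (S : HillFactorization)

/-- The potential of Hill's equation. -/
noncomputable def q (x : ℝ) : ℝ := S.R x ^ 2 + 3 * S.R1 x

theorem z_lt : S.z 0 < S.z S.n := S.z_strictMono S.n_pos

theorem add_sub_z : S.z 0 + (S.z S.n - S.z 0) = S.z S.n := by ring

theorem continuous_R : Continuous S.R := continuous_of_hasDerivAt S.hasDerivAt_R

theorem continuous_R1 : Continuous S.R1 := continuous_of_hasDerivAt S.hasDerivAt_R1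

theorem continuous_ρ1 : Continuous S.ρ1 := continuous_of_hasDerivAt S.hasDerivAt_ρ1

theorem continuous_q : Continuous S.q := by
  have := S.continuous_R; have := S.continuous_R1
  unfold q; fun_prop

theorem periodic_R1 : Function.Periodic S.R1 (S.z S.n - S.z 0) :=
  S.R_periodic.of_hasDerivAt S.hasDerivAt_R

theorem periodic_ρ1 : Function.Periodic S.ρ1 (S.z S.n - S.z 0) := by
  have h := S.periodic_R1.of_hasDerivAt S.hasDerivAt_R1
  intro x
  have h1 := h x
  simp only [S.R_periodic x, S.periodic_R1 x] at h1
  linarith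

theorem integral_ω_pos : 0 < ∫ x in S.z 0..S.z S.n, S.ω x :=
  intervalIntegral.intervalIntegral_pos_of_pos (S.ω_continuous.intervalIntegrable _ _) S.ω_pos
    S.z_lt

theorem ψ1_mul_η (i : ℕ) : S.ψ1 (S.z i) * S.η (S.z i) = -S.W := by
  have := S.wronskian (S.z i)
  rw [S.ψ_zero, zero_mul] at this
  linarith

theorem ψ1_ne_zero (i : ℕ) : S.ψ1 (S.z i) ≠ 0 := fun h => by
  have := S.ψ1_mul_η i
  rw [h, zero_mul] at this
  linarith [S.W_pos]

theorem η_ne_zero (i : ℕ) : S.η (S.z i) ≠ 0 := fun h => by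
  have := S.ψ1_mul_η i
  rw [h, mul_zero] at this
  linarith [S.W_pos]

/-- A primitive of `R`. -/
theorem exists_primitive_R : ∃ G : ℝ → ℝ, (∀ x, HasDerivAt G (S.R x) x) ∧
    StrictMono G := by
  have h : ∀ x, HasDerivAt (fun x => ∫ t in (0 : ℝ)..x, S.R t) (S.R x) x := fun x =>
    S.continuous_R.integral_hasStrictDerivAt 0 x |>.hasDerivAt
  exact ⟨_, h, strictMono_of_deriv_pos fun x => (h x).deriv ▸ S.R_pos x⟩

theorem eq_zero_of_hasDerivAt_R_mul {w : ℝ → ℝ} (hw : ∀ x, HasDerivAt w (S.R x * w x) x)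
    (hp : Function.Periodic w (S.z S.n - S.z 0)) : w = 0 := by
  obtain ⟨G, hG, hGm⟩ := S.exists_primitive_R
  exact eq_zero_of_hasDerivAt_mul_of_periodic hw hG
    (fun x => (hGm (by linarith [S.z_lt])).ne') hp

theorem eq_zero_of_hasDerivAt_neg_R_mul {w : ℝ → ℝ} (hw : ∀ x, HasDerivAt w (-S.R x * w x) x)
    (hp : Function.Periodic w (S.z S.n - S.z 0)) : w = 0 := by
  obtain ⟨G, hG, hGm⟩ := S.exists_primitive_R
  exact eq_zero_of_hasDerivAt_mul_of_periodic hw (fun x => (hG x).neg)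
    (fun x h => (hGm (by linarith [S.z_lt] : x < x + (S.z S.n - S.z 0))).ne' (neg_injective h)) hp

/-- The energy identity: the quadratic form of `m'''' - κ ω m` agrees with that of Hill's equation
along `u = m' - R m`. -/
theorem integral_energy {F M M1 : ℝ → ℝ}
    (hF : MemLp F 2 (volume.restrict (Ioc (S.z 0) (S.z S.n))))
    (hM : ∀ x, HasDerivAt M (M1 x) x) (hM1 : Continuous M1)
    (hM1' : ∀ x ∈ Ioo (S.z 0) (S.z S.n), HasDerivWithinAt M1 (F x) (Ioi x) x)
    (hMab : M (S.z 0) = M (S.z S.n)) (hM1ab : M1 (S.z 0) = M1 (S.z S.n)) :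
    ∫ x in S.z 0..S.z S.n, (F x * F x - S.κ * (S.ω x * M x * M x)) =
      ∫ x in S.z 0..S.z S.n, ((F x - S.R1 x * M x - S.R x * M1 x) ^ 2 -
        S.q x * (M1 x - S.R x * M x) ^ 2) := by
  have hab := S.z_lt
  have hRc := S.continuous_R
  have hR1c := S.continuous_R1
  have hρc := S.continuous_ρ1
  have hωc := S.ω_continuous
  have hqc := S.continuous_q
  have hMc := continuous_of_hasDerivAt hM
  have hFi := hF.intervalIntegrable_Ioc hab.le
  have hFF : IntervalIntegrable (fun x => F x * F x) volume (S.z 0) (S.z S.n) := by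
    have := hF.integrable_sq
    simp only [pow_two] at this
    exact (intervalIntegrable_iff_integrableOn_Ioc_of_le hab.le).mpr this
  have hc : ∀ {g : ℝ → ℝ}, Continuous g → IntervalIntegrable g volume (S.z 0) (S.z S.n) :=
    fun hg => hg.intervalIntegrable _ _
  have hi1 : IntervalIntegrable (fun x => F x * F x - S.κ * (S.ω x * M x * M x)) volume
      (S.z 0) (S.z S.n) := hFF.sub (hc (by fun_prop))
  have hi2 : IntervalIntegrable (fun x => (F x - S.R1 x * M x - S.R x * M1 x) ^ 2 -
        S.q x * (M1 x - S.R x * M x) ^ 2) volume (S.z 0) (S.z S.n) := by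
    have h1 : IntervalIntegrable (fun x => (-2 * (S.R1 x * M x + S.R x * M1 x)) * F x) volume
      (S.z 0) (S.z S.n) := hFi.continuousOn_mul (by fun_prop)
    have h2 := (hFF.add h1).add (hc (g := fun x => (S.R1 x * M x + S.R x * M1 x) ^ 2 -
      S.q x * (M1 x - S.R x * M x) ^ 2) (by fun_prop))
    refine h2.congr ?_
    intro x _
    ring
  rw [← sub_eq_zero, ← intervalIntegral.integral_sub hi1 hi2]
  have hd : ∀ x ∈ Ioo (min (S.z 0) (S.z S.n)) (max (S.z 0) (S.z S.n)), HasDerivWithinAt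
      (fun x => -S.ρ1 x * M x ^ 2 + 2 * (S.R1 x + S.R x ^ 2) * M x * (M1 x - S.R x * M x) +
        S.R x * (M1 x - S.R x * M x) ^ 2)
      ((F x * F x - S.κ * (S.ω x * M x * M x)) - ((F x - S.R1 x * M x - S.R x * M1 x) ^ 2 -
        S.q x * (M1 x - S.R x * M x) ^ 2)) (Ioi x) x := by
    intro x hx
    rw [min_eq_left hab.le, max_eq_right hab.le] at hx
    have dM := (hM x).hasDerivWithinAt (s := Ioi x)
    have dR := (S.hasDerivAt_R x).hasDerivWithinAt (s := Ioi x)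
    have dR1 := (S.hasDerivAt_R1 x).hasDerivWithinAt (s := Ioi x)
    have dρ := (S.hasDerivAt_ρ1 x).hasDerivWithinAt (s := Ioi x)
    have du := (hM1' x hx).sub (dR.mul dM)
    refine (((dρ.neg.mul (dM.pow 2)).add ((((dR1.add (dR.pow 2)).const_mul 2).mul dM).mul du)).add
      (dR.mul (du.pow 2))).congr_deriv ?_
    simp only [Pi.mul_apply, Pi.add_apply, Pi.pow_apply, Pi.sub_apply, Pi.neg_apply, q]
    push_cast
    ring
  rw [intervalIntegral.integral_eq_sub_of_hasDeriv_right (Continuous.continuousOn (by fun_prop)) hd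
    (hi1.sub hi2)]
  have e1 := S.R_periodic (S.z 0)
  have e2 := S.periodic_R1 (S.z 0)
  have e3 := S.periodic_ρ1 (S.z 0)
  rw [S.add_sub_z] at e1 e2 e3
  rw [e1, e2, e3, hMab, hM1ab, sub_self]

/-- The periodic solutions of `m'''' = κ ω m` are the multiples of `m0`. -/
theorem eq_smul_m0 {F F1 M M1 : ℝ → ℝ} (hF : ∀ x, HasDerivAt F (F1 x) x)
    (hF1 : ∀ x, HasDerivAt F1 (S.κ * (S.ω x * M x)) x) (hM : ∀ x, HasDerivAt M (M1 x) x)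
    (hM1 : ∀ x, HasDerivAt M1 (F x) x) (hFp : Function.Periodic F (S.z S.n - S.z 0))
    (hMp : Function.Periodic M (S.z S.n - S.z 0)) : ∃ α : ℝ, ∀ x, M x = α * S.m0 x := by
  have hM1p := hMp.of_hasDerivAt hM
  have hF1p := hFp.of_hasDerivAt hF
  have hw : (fun x => F1 x - (S.ρ1 x - 2 * S.R x * S.R1 x) * M x - 2 * S.R1 x * M1 x - S.R x * F x
      + S.q x * (M1 x - S.R x * M x)) = 0 := by
    refine S.eq_zero_of_hasDerivAt_neg_R_mul (fun x => ?_) fun x => ?_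
    · have dR := S.hasDerivAt_R x
      have dR1 := S.hasDerivAt_R1 x
      have dq : HasDerivAt S.q _ x := (dR.pow 2).add (dR1.const_mul 3)
      refine (((((hF1 x).sub (((S.hasDerivAt_ρ1 x).sub ((dR.const_mul 2).mul dR1)).mul (hM x))).sub
        ((dR1.const_mul 2).mul (hM1 x))).sub (dR.mul (hF x))).add
        (dq.mul ((hM1 x).sub (dR.mul (hM x))))).congr_deriv ?_
      simp only [Pi.mul_apply, Pi.sub_apply, q]
      push_cast
      ring
    · simp only [q, hFp x, hF1p x, hMp x, hM1p x, S.R_periodic x, S.periodic_R1 x, S.periodic_ρ1 x]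
  have hu : ∀ x, HasDerivAt (fun x => M1 x - S.R x * M x) (F x - S.R1 x * M x - S.R x * M1 x) x :=
    fun x => ((hM1 x).sub ((S.hasDerivAt_R x).mul (hM x))).congr_deriv (by ring)
  have hu1 : ∀ x, HasDerivAt (fun x => F x - S.R1 x * M x - S.R x * M1 x)
      (-(S.q x * (M1 x - S.R x * M x))) x := fun x => by
    refine (((hF x).sub ((S.hasDerivAt_R1 x).mul (hM x))).sub
      ((S.hasDerivAt_R x).mul (hM1 x))).congr_deriv ?_
    have := congrFun hw x
    simp only [Pi.zero_apply] at this
    linarith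
  have hup : Function.Periodic (fun x => M1 x - S.R x * M x) (S.z S.n - S.z 0) := fun x => by
    simp only [hMp x, hM1p x, S.R_periodic x]
  have hu1p := hup.of_hasDerivAt hu
  set u := fun x => M1 x - S.R x * M x with hudef
  set u1 := fun x => F x - S.R1 x * M x - S.R x * M1 x with hu1def
  have hA : ∀ x y, u x * S.ψ1 x - u1 x * S.ψ x = u y * S.ψ1 y - u1 y * S.ψ y := by
    have h : ∀ x, HasDerivAt (fun x => u x * S.ψ1 x - u1 x * S.ψ x) 0 x := fun x =>
      (((hu x).mul (S.hasDerivAt_ψ1 x)).sub ((hu1 x).mul (S.hasDerivAt_ψ x))).congr_deriv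
        (by simp only [q, hudef, hu1def]; ring)
    exact is_const_of_deriv_eq_zero (fun x => (h x).differentiableAt) fun x => (h x).deriv
  have hB : ∀ x y, u x * S.η1 x - u1 x * S.η x = u y * S.η1 y - u1 y * S.η y := by
    have h : ∀ x, HasDerivAt (fun x => u x * S.η1 x - u1 x * S.η x) 0 x := fun x =>
      (((hu x).mul (S.hasDerivAt_η1 x)).sub ((hu1 x).mul (S.hasDerivAt_η x))).congr_deriv
        (by simp only [q, hudef, hu1def]; ring)
    exact is_const_of_deriv_eq_zero (fun x => (h x).differentiableAt) fun x => (h x).deriv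
  have hua : u (S.z 0) = 0 := by
    have h1 := hB (S.z S.n) (S.z 0)
    have e1 := hup (S.z 0)
    have e2 := hu1p (S.z 0)
    rw [S.add_sub_z] at e1 e2
    rw [e1, e2, S.η_end, S.η1_end] at h1
    have h2 : u (S.z 0) * (S.c * S.ψ1 (S.z 0)) = 0 := by linarith
    exact (mul_eq_zero.mp h2).resolve_right (mul_ne_zero S.c_pos.ne' (S.ψ1_ne_zero 0))
  have hA0 : ∀ x, u x * S.ψ1 x - u1 x * S.ψ x = 0 := fun x => by
    rw [hA x (S.z 0), hua, S.ψ_zero]; ring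
  set α := (u (S.z 0) * S.η1 (S.z 0) - u1 (S.z 0) * S.η (S.z 0)) / S.W with hα
  have huα : ∀ x, u x = α * S.ψ x := fun x => by
    have h1 := hB x (S.z 0)
    have h2 := hA0 x
    have h3 := S.wronskian x
    have h4 := S.W_pos.ne'
    rw [hα, ← h1, div_mul_eq_mul_div, eq_div_iff h4, ← h3]
    linear_combination (-S.η x) * h2
  refine ⟨α, ?_⟩
  have hd : (fun x => M x - α * S.m0 x) = 0 := by
    refine S.eq_zero_of_hasDerivAt_R_mul (fun x => ?_) fun x => by
      simp only [hMp x, S.m0_periodic x]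
    refine ((hM x).sub ((S.hasDerivAt_m0 x).const_mul α)).congr_deriv ?_
    have := huα x
    simp only [hudef] at this
    linear_combination this
  intro x
  have := congrFun hd x
  simp only [Pi.zero_apply] at this
  linarith

end HillFactorization

end

section

open MeasureTheory Set

theorem continuousAt_mul_div_of_hasDerivAt {f g : ℝ → ℝ} {f' g' x : ℝ} (hf : HasDerivAt f f' x)
    (hg : HasDerivAt g g' x) (hf0 : f x = 0) (hg0 : g x = 0) (hg' : g' ≠ 0) :
    ContinuousAt (fun t => f t * (f t / g t)) x := by
  have h1 := (hasDerivAt_iff_tendsto_slope.mp hf).div (hasDerivAt_iff_tendsto_slope.mp hg) hg'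
  have h2 := (hf.continuousAt.tendsto.mono_left nhdsWithin_le_nhds).mul h1
  rw [continuousAt_iff_punctured_nhds]
  simp only [hf0, zero_mul] at h2 ⊢
  refine h2.congr' ?_
  filter_upwards [self_mem_nhdsWithin] with t ht
  have ht' : t - x ≠ 0 := sub_ne_zero.mpr ht
  simp only [Pi.div_apply, slope_def_field, hf0, hg0, sub_zero]
  rw [div_div_div_cancel_right₀ ht']

/-- Jacobi's inequality between zeros of a solution of Hill's equation. -/
theorem integral_jacobi_nonneg {a b : ℝ} (hab : a < b) {q ψ ψ1 y y1 : ℝ → ℝ}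
    (hq : Continuous q) (hψ : ∀ x, HasDerivAt ψ (ψ1 x) x)
    (hψ1 : ∀ x, HasDerivAt ψ1 (-(q x * ψ x)) x) (hψa : ψ a = 0) (hψb : ψ b = 0)
    (hψa' : ψ1 a ≠ 0) (hψb' : ψ1 b ≠ 0) (hne : ∀ x ∈ Ioo a b, ψ x ≠ 0)
    (hy : ∀ x, HasDerivAt y (y1 x) x) (hy1 : Continuous y1) (hya : y a = 0) (hyb : y b = 0) :
    0 ≤ ∫ x in a..b, (y1 x ^ 2 - q x * y x ^ 2) := by
  have hyc := continuous_of_hasDerivAt hy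
  have hψc := continuous_of_hasDerivAt hψ
  have hψ1c := continuous_of_hasDerivAt hψ1
  have hint : Continuous fun x => y1 x ^ 2 - q x * y x ^ 2 := by fun_prop
  have h := intervalIntegral.sub_le_integral_of_hasDeriv_right_of_le hab.le
    (g := fun x => y x * (y x / ψ x) * ψ1 x) (φ := fun x => y1 x ^ 2 - q x * y x ^ 2)
    (g' := fun x => y1 x ^ 2 - q x * y x ^ 2 - (y1 x - y x * ψ1 x / ψ x) ^ 2) ?_ ?_
    hint.integrableOn_Icc ?_
  · simpa [hya, hyb] using h
  · intro x hx
    refine (ContinuousAt.mul ?_ hψ1c.continuousAt).continuousWithinAt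
    by_cases hxa : x = a
    · subst hxa; exact continuousAt_mul_div_of_hasDerivAt (hy _) (hψ _) hya hψa hψa'
    by_cases hxb : x = b
    · subst hxb; exact continuousAt_mul_div_of_hasDerivAt (hy _) (hψ _) hyb hψb hψb'
    exact hyc.continuousAt.mul (hyc.continuousAt.div hψc.continuousAt
      (hne x ⟨lt_of_le_of_ne hx.1 (Ne.symm hxa), lt_of_le_of_ne hx.2 hxb⟩))
  · intro x hx
    have h0 := hne x hx
    refine ((((hy x).mul ((hy x).div (hψ x) h0)).mul (hψ1 x)).congr_deriv ?_).hasDerivWithinAt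
    simp only [Pi.mul_apply, Pi.div_apply]
    field_simp
    ring
  · intro x _
    linarith [sq_nonneg (y1 x - y x * ψ1 x / ψ x)]

namespace HillFactorization

variable (S : HillFactorization)

/-- Nonnegativity of Hill's quadratic form on functions agreeing with `t η` at the zeros of `ψ`. -/
theorem integral_hill_nonneg {u u1 : ℝ → ℝ} (hu : ∀ x, HasDerivAt u (u1 x) x)
    (hu1 : Continuous u1) (t : ℝ) (huz : ∀ i ≤ S.n, u (S.z i) = t * S.η (S.z i)) :
    0 ≤ ∫ x in S.z 0..S.z S.n, (u1 x ^ 2 - S.q x * u x ^ 2) := by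
  have hqc := S.continuous_q
  have huc := continuous_of_hasDerivAt hu
  have hηc := continuous_of_hasDerivAt S.hasDerivAt_η
  have hη1c := continuous_of_hasDerivAt S.hasDerivAt_η1
  set y := fun x => u x - t * S.η x with hydef
  set y1 := fun x => u1 x - t * S.η1 x with hy1def
  have hy : ∀ x, HasDerivAt y (y1 x) x := fun x => (hu x).sub ((S.hasDerivAt_η x).const_mul t)
  have hy1c : Continuous y1 := by fun_prop
  have hyc : Continuous y := by fun_prop
  have hyz : ∀ i ≤ S.n, y (S.z i) = 0 := fun i hi => by simp [hydef, huz i hi]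
  have hyi : Continuous fun x => y1 x ^ 2 - S.q x * y x ^ 2 := by fun_prop
  have h1 : 0 ≤ ∫ x in S.z 0..S.z S.n, (y1 x ^ 2 - S.q x * y x ^ 2) := by
    rw [← intervalIntegral.sum_integral_adjacent_intervals fun k _ =>
      hyi.intervalIntegrable _ _]
    refine Finset.sum_nonneg fun i hi => ?_
    have hi' := Finset.mem_range.mp hi
    exact integral_jacobi_nonneg (S.z_strictMono i.lt_succ_self) hqc S.hasDerivAt_ψ
      S.hasDerivAt_ψ1 (S.ψ_zero i) (S.ψ_zero (i + 1)) (S.ψ1_ne_zero i) (S.ψ1_ne_zero (i + 1))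
      (S.ψ_ne_zero i) hy hy1c (hyz i hi'.le) (hyz (i + 1) hi')
  have hd : ∀ x, HasDerivAt (fun x => 2 * t * (y x * S.η1 x) + t ^ 2 * (S.η x * S.η1 x))
      ((u1 x ^ 2 - S.q x * u x ^ 2) - (y1 x ^ 2 - S.q x * y x ^ 2)) x := fun x => by
    refine ((((hy x).mul (S.hasDerivAt_η1 x)).const_mul (2 * t)).add
      (((S.hasDerivAt_η x).mul (S.hasDerivAt_η1 x)).const_mul (t ^ 2))).congr_deriv ?_
    simp only [q, hydef, hy1def]
    ring
  have hui : Continuous fun x => u1 x ^ 2 - S.q x * u x ^ 2 := by fun_prop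
  have h2 := intervalIntegral.integral_eq_sub_of_hasDerivAt (a := S.z 0) (b := S.z S.n)
    (fun x _ => hd x) ((hui.sub hyi).intervalIntegrable _ _)
  rw [intervalIntegral.integral_sub (hui.intervalIntegrable _ _) (hyi.intervalIntegrable _ _),
    hyz 0 (Nat.zero_le _), hyz S.n le_rfl, S.η_end, S.η1_end] at h2
  have h3 : t ^ 2 * (S.η (S.z 0) * (S.η1 (S.z 0) - S.c * S.ψ1 (S.z 0))) -
      t ^ 2 * (S.η (S.z 0) * S.η1 (S.z 0)) = t ^ 2 * (S.c * S.W) := by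
    linear_combination (-t ^ 2 * S.c) * S.ψ1_mul_η 0
  have h4 : 0 ≤ t ^ 2 * (S.c * S.W) :=
    mul_nonneg (sq_nonneg t) (mul_nonneg S.c_pos.le S.W_pos.le)
  linarith

variable {k : ℝ → IntervalL2 (S.z 0) (S.z S.n)}
  {T : IntervalL2 (S.z 0) (S.z S.n) →L[ℝ] IntervalL2 (S.z 0) (S.z S.n)}

theorem finrank_le_of_lt_inner (hk : IsGreenKernel (S.z 0) (S.z S.n) S.ω k)
    (hT : IsGreenOperator (S.z 0) (S.z S.n) S.ω k T)
    (E : Submodule ℝ (IntervalL2 (S.z 0) (S.z S.n))) (hE : FiniteDimensional ℝ E)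
    (hET : ∀ f ∈ E, ∃ g, f = T g)
    (hlt : ∀ f ∈ E, f ≠ 0 → S.κ⁻¹ * ‖f‖ ^ 2 < inner ℝ (T f) f) :
    Module.finrank ℝ E + 2 ≤ S.n := by
  have hab := S.z_lt
  have hrep : ∀ f : E, ∃ (F M M1 : ℝ → ℝ) (hF : Continuous F), (∀ x, HasDerivAt M (M1 x) x) ∧
      (∀ x, HasDerivAt M1 (F x) x) ∧ Function.Periodic M (S.z S.n - S.z 0) ∧
      ∫ x in S.z 0..S.z S.n, S.ω x * M x = 0 ∧
      (f : IntervalL2 (S.z 0) (S.z S.n)) = (hF.memLp_Ioc (S.z 0) (S.z S.n)).toLp F ∧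
      ∀ x, inner ℝ (k x) (f : IntervalL2 (S.z 0) (S.z S.n)) = M x := fun f => by
    obtain ⟨g, hg⟩ := hET f f.2
    obtain ⟨F, F1, M, M1, hFc, -, -, hM, hM1, -, hMp, hM0, hTF, hkM⟩ :=
      hT.exists_representative hab S.ω_continuous S.ω_periodic S.integral_ω_pos.ne' hk g
    rw [← hg] at hTF hkM
    exact ⟨F, M, M1, hFc, hM, hM1, hMp, hM0, hTF, hkM⟩
  have hdiff : ∀ (f : E) (x : ℝ), DifferentiableAt ℝ (fun x => inner ℝ (k x) (f : _)) x := by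
    intro f x
    obtain ⟨F, M, M1, hFc, hM, -, -, -, -, hkM⟩ := hrep f
    rw [show (fun x => inner ℝ (k x) (f : IntervalL2 (S.z 0) (S.z S.n))) = M from funext hkM]
    exact (hM x).differentiableAt
  let ℓ (x : ℝ) : E →ₗ[ℝ] ℝ :=
    { toFun := fun f => deriv (fun x => inner ℝ (k x) (f : IntervalL2 (S.z 0) (S.z S.n))) x -
        S.R x * inner ℝ (k x) (f : IntervalL2 (S.z 0) (S.z S.n))
      map_add' := fun f g => by
        have h : (fun x => inner ℝ (k x) ((f + g : E) : IntervalL2 (S.z 0) (S.z S.n))) =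
            (fun x => inner ℝ (k x) (f : IntervalL2 (S.z 0) (S.z S.n))) +
            fun x => inner ℝ (k x) (g : IntervalL2 (S.z 0) (S.z S.n)) := by
          funext x; simp [inner_add_right]
        rw [h, deriv_add (hdiff f x) (hdiff g x), Submodule.coe_add, inner_add_right]
        ring
      map_smul' := fun r f => by
        have h : (fun x => inner ℝ (k x) ((r • f : E) : IntervalL2 (S.z 0) (S.z S.n))) =
            fun x => r * inner ℝ (k x) (f : IntervalL2 (S.z 0) (S.z S.n)) := by
          funext x; simp [inner_smul_right]
        rw [h, deriv_const_mul _ (hdiff f x), Submodule.coe_smul, inner_smul_right]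
        simp only [RingHom.id_apply, smul_eq_mul]
        ring }
  let Λ : (E × ℝ × ℝ) →ₗ[ℝ] (Fin S.n → ℝ) :=
    { toFun := fun v i => ℓ (S.z i) v.1 - v.2.1 * S.R (S.z i) - v.2.2 * S.η (S.z i)
      map_add' := fun v w => by
        funext i
        simp only [Prod.fst_add, Prod.snd_add, map_add, Pi.add_apply]
        ring
      map_smul' := fun r v => by
        funext i
        simp only [Prod.smul_fst, Prod.smul_snd, map_smul, Pi.smul_apply, smul_eq_mul,
          RingHom.id_apply]
        ring }
  by_contra! hcon
  have hker : LinearMap.ker Λ ≠ ⊥ := by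
    refine LinearMap.ker_ne_bot_of_finrank_lt ?_
    simp only [Module.finrank_fintype_fun_eq_card, Fintype.card_fin, Module.finrank_prod,
      Module.finrank_self]
    lia
  obtain ⟨⟨f, c, t⟩, hv, hv0⟩ := Submodule.exists_mem_ne_zero_of_ne_bot hker
  have hΛ : ∀ i < S.n, ℓ (S.z i) f - c * S.R (S.z i) - t * S.η (S.z i) = 0 := fun i hi =>
    congrFun (LinearMap.mem_ker.mp hv) ⟨i, hi⟩
  obtain ⟨F, M, M1, hFc, hM, hM1, hMp, hM0, hfF, hkM⟩ := hrep f
  have hℓ : ∀ x, ℓ x f = M1 x - S.R x * M x := fun x => by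
    show deriv (fun x => inner ℝ (k x) (f : IntervalL2 (S.z 0) (S.z S.n))) x -
      S.R x * inner ℝ (k x) (f : IntervalL2 (S.z 0) (S.z S.n)) = _
    rw [show (fun x => inner ℝ (k x) (f : IntervalL2 (S.z 0) (S.z S.n))) = M from funext hkM,
      hkM, (hM x).deriv]
  have hM1p := hMp.of_hasDerivAt hM
  have hM1c := continuous_of_hasDerivAt hM1
  have hMc := continuous_of_hasDerivAt hM
  have hRc := S.continuous_R
  have hR1c := S.continuous_R1
  have hωc := S.ω_continuous
  set u := fun x => M1 x - S.R x * (M x + c) with hudef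
  have hu : ∀ x, HasDerivAt u (F x - S.R1 x * (M x + c) - S.R x * M1 x) x := fun x =>
    ((hM1 x).sub ((S.hasDerivAt_R x).mul ((hM x).add_const c))).congr_deriv (by ring)
  have huz : ∀ i ≤ S.n, u (S.z i) = t * S.η (S.z i) := by
    have h1 : ∀ i < S.n, u (S.z i) = t * S.η (S.z i) := fun i hi => by
      have := hΛ i hi
      rw [hℓ] at this
      simp only [hudef]
      linarith
    intro i hi
    rcases hi.lt_or_eq with hi | rfl
    · exact h1 i hi
    · rw [S.η_end, ← h1 0 S.n_pos, ← S.add_sub_z]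
      simp only [hudef, hM1p _, hMp _, S.R_periodic _]
  have hend := S.add_sub_z
  have hen := S.integral_energy (hFc.memLp_Ioc _ _) (fun x => (hM x).add_const c) hM1c
    (fun x _ => (hM1 x).hasDerivWithinAt) (by rw [← hMp (S.z 0), hend])
    (by rw [← hM1p (S.z 0), hend])
  have hnn := S.integral_hill_nonneg hu (by fun_prop) t huz
  rw [← hen] at hnn
  have hexp : ∫ x in S.z 0..S.z S.n, (F x * F x - S.κ * (S.ω x * (M x + c) * (M x + c))) =
      ‖f‖ ^ 2 - S.κ * inner ℝ (T f) (f : IntervalL2 (S.z 0) (S.z S.n)) -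
        S.κ * c ^ 2 * ∫ x in S.z 0..S.z S.n, S.ω x := by
    have e1 : ‖f‖ ^ 2 = ∫ x in S.z 0..S.z S.n, F x * F x := by
      rw [← inner_toLp_Ioc hab.le (hFc.memLp_Ioc _ _) (hFc.memLp_Ioc _ _), ← hfF,
        real_inner_self_eq_norm_sq, Submodule.norm_coe]
    have e2 : inner ℝ (T f) (f : IntervalL2 (S.z 0) (S.z S.n)) =
        ∫ x in S.z 0..S.z S.n, S.ω x * M x * M x := by
      rw [hT.inner_eq]
      simp only [hkM]
    have hc : ∀ {g : ℝ → ℝ}, Continuous g → IntervalIntegrable g volume (S.z 0) (S.z S.n) :=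
      fun hg => hg.intervalIntegrable _ _
    have e3 : ∫ x in S.z 0..S.z S.n, (F x * F x - S.κ * (S.ω x * (M x + c) * (M x + c))) =
        ∫ x in S.z 0..S.z S.n, (F x * F x - S.κ * (S.ω x * M x * M x) -
          (2 * S.κ * c) * (S.ω x * M x) - (S.κ * c ^ 2) * S.ω x) :=
      intervalIntegral.integral_congr fun x _ => by ring
    rw [e1, e2, e3, intervalIntegral.integral_sub (hc (by fun_prop)) (hc (by fun_prop)),
      intervalIntegral.integral_sub (hc (by fun_prop)) (hc (by fun_prop)),
      intervalIntegral.integral_sub (hc (by fun_prop)) (hc (by fun_prop)),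
      intervalIntegral.integral_const_mul, intervalIntegral.integral_const_mul,
      intervalIntegral.integral_const_mul, hM0]
    ring
  rw [hexp] at hnn
  have hκ := S.κ_pos
  have hc0 : 0 ≤ S.κ * c ^ 2 * ∫ x in S.z 0..S.z S.n, S.ω x :=
    mul_nonneg (mul_nonneg hκ.le (sq_nonneg c)) S.integral_ω_pos.le
  have hf0 : f = 0 := by
    by_contra hne
    have h1 := hlt f f.2 (by simpa using hne)
    rw [inv_mul_lt_iff₀ hκ, Submodule.norm_coe] at h1
    linarith
  subst hf0
  have hcz : c = 0 := by
    by_contra hne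
    have : 0 < S.κ * c ^ 2 * ∫ x in S.z 0..S.z S.n, S.ω x :=
      mul_pos (mul_pos hκ (by positivity)) S.integral_ω_pos
    simp at hnn
    linarith
  have htz : t = 0 := by
    have := hΛ 0 S.n_pos
    rw [map_zero, hcz] at this
    have h2 : t * S.η (S.z 0) = 0 := by linarith
    exact (mul_eq_zero.mp h2).resolve_right (S.η_ne_zero 0)
  exact hv0 (by rw [hcz, htz]; rfl)

end HillFactorization

end

section

open MeasureTheory Set

theorem continuous_indicator_Ico {a b : ℝ} (hab : a < b) {g : ℝ → ℝ} (hg : Continuous g)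
    (ha : g a = 0) (hb : g b = 0) : Continuous ((Ico a b).indicator g) := by
  refine hg.indicator fun x hx => ?_
  rw [frontier_Ico hab] at hx
  rcases hx with rfl | rfl
  exacts [ha, hb]

theorem hasDerivWithinAt_indicator_Ico {a b : ℝ} {g g' : ℝ → ℝ}
    (hg : ∀ x, HasDerivAt g (g' x) x) (x : ℝ) :
    HasDerivWithinAt ((Ico a b).indicator g) ((Ico a b).indicator g' x) (Ioi x) x := by
  rcases lt_or_ge x a with hxa | hxa
  · rw [indicator_of_notMem fun h => hxa.not_ge h.1]
    refine ((hasDerivAt_const x (0 : ℝ)).congr_of_eventuallyEq ?_).hasDerivWithinAt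
    filter_upwards [Iio_mem_nhds hxa] with t ht
    exact indicator_of_notMem (fun h => (mem_Iio.mp ht).not_ge h.1) _
  rcases lt_or_ge x b with hxb | hxb
  · rw [indicator_of_mem (mem_Ico.mpr ⟨hxa, hxb⟩)]
    refine (hg x).hasDerivWithinAt.congr_of_eventuallyEq ?_
      (indicator_of_mem (mem_Ico.mpr ⟨hxa, hxb⟩) _)
    filter_upwards [Ioo_mem_nhdsGT hxb] with t ht
    exact indicator_of_mem (mem_Ico.mpr ⟨hxa.trans ht.1.le, ht.2⟩) _
  · rw [indicator_of_notMem fun h => hxb.not_gt h.2]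
    refine (hasDerivAt_const x (0 : ℝ)).hasDerivWithinAt.congr_of_eventuallyEq ?_
      (indicator_of_notMem (fun h => hxb.not_gt h.2) _)
    filter_upwards [self_mem_nhdsWithin] with t ht
    exact indicator_of_notMem (fun h => (hxb.trans (mem_Ioi.mp ht).le).not_gt h.2) _

theorem MeasureTheory.MemLp.exists_toLp_sum {α ι : Type*} [MeasurableSpace α] {μ : Measure α}
    {f : ι → α → ℝ} (hf : ∀ i, MemLp (f i) 2 μ) (c : ι → ℝ) (s : Finset ι) :
    ∃ hF : MemLp (fun x => ∑ i ∈ s, c i * f i x) 2 μ,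
      hF.toLp _ = ∑ i ∈ s, c i • (hf i).toLp (f i) := by
  classical
  induction s using Finset.induction_on with
  | empty => exact ⟨by simp, by simp; rfl⟩
  | insert i s hi ih =>
    obtain ⟨hF, h⟩ := ih
    have h1 : (fun x => ∑ j ∈ insert i s, c j * f j x) =
        c i • f i + fun x => ∑ j ∈ s, c j * f j x := by
      funext x
      simp [Finset.sum_insert hi]
    refine ⟨h1 ▸ ((hf i).const_smul (c i)).add hF, ?_⟩
    rw [Finset.sum_insert hi, ← h, ← MemLp.toLp_const_smul, ← MemLp.toLp_add]
    congr 1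

namespace HillFactorization

variable (S : HillFactorization)

theorem exists_hasDerivAt_R_mul_add {u : ℝ → ℝ} (hu : Continuous u) :
    ∃ m : ℝ → ℝ, (∀ x, HasDerivAt m (S.R x * m x + u x) x) ∧ m (S.z 0) = m (S.z S.n) := by
  obtain ⟨G, hG, hGm⟩ := S.exists_primitive_R
  have hGc := continuous_of_hasDerivAt hG
  have hJ : ∀ x, HasDerivAt (fun x => ∫ t in S.z 0..x, u t * Real.exp (-G t))
      (u x * Real.exp (-G x)) x := fun x =>
    (show Continuous fun t => u t * Real.exp (-G t) by fun_prop).integral_hasStrictDerivAt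
      (S.z 0) x |>.hasDerivAt
  set J := fun x => ∫ t in S.z 0..x, u t * Real.exp (-G t) with hJdef
  have hne : Real.exp (G (S.z 0)) - Real.exp (G (S.z S.n)) ≠ 0 := by
    have := Real.exp_lt_exp.mpr (hGm S.z_lt)
    linarith
  set d := Real.exp (G (S.z S.n)) * J (S.z S.n) / (Real.exp (G (S.z 0)) - Real.exp (G (S.z S.n)))
    with hd
  refine ⟨fun x => Real.exp (G x) * (d + J x), fun x => ?_, ?_⟩
  · refine ((hG x).exp.mul ((hJ x).const_add d)).congr_deriv ?_
    have h1 : Real.exp (G x) * Real.exp (-G x) = 1 := by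
      rw [← Real.exp_add, add_neg_cancel, Real.exp_zero]
    linear_combination u x * h1
  · have h0 : J (S.z 0) = 0 := by simp [hJdef]
    have h1 : d * (Real.exp (G (S.z 0)) - Real.exp (G (S.z S.n))) =
        Real.exp (G (S.z S.n)) * J (S.z S.n) := by rw [hd]; field_simp
    simp only [h0]
    linear_combination h1

/-- The restriction of `ψ` to the cell between two consecutive zeros. -/
noncomputable def cell (i : ℕ) (g : ℝ → ℝ) : ℝ → ℝ := (Ico (S.z i) (S.z (i + 1))).indicator g

theorem cell_mul_cell {i j : ℕ} (hij : i ≠ j) (g h : ℝ → ℝ) (x : ℝ) :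
    S.cell i g x * S.cell j h x = 0 := by
  have hd : Disjoint (Ico (S.z i) (S.z (i + 1))) (Ico (S.z j) (S.z (j + 1))) :=
    S.z_strictMono.monotone.pairwise_disjoint_on_Ico_succ hij
  by_cases hx : x ∈ Ico (S.z i) (S.z (i + 1))
  · rw [cell, cell, indicator_of_notMem (disjoint_left.mp hd hx), mul_zero]
  · rw [cell, indicator_of_notMem hx, zero_mul]

theorem continuous_cell (i : ℕ) {g : ℝ → ℝ} (hg : Continuous g) (h : ∀ i, g (S.z i) = 0) :
    Continuous (S.cell i g) :=
  continuous_indicator_Ico (S.z_strictMono i.lt_succ_self) hg (h i) (h (i + 1))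

theorem memLp_cell (i : ℕ) {g : ℝ → ℝ} (hg : Continuous g) (a b : ℝ) :
    MemLp (S.cell i g) 2 (volume.restrict (Ioc a b)) :=
  (hg.memLp_Ioc a b).indicator measurableSet_Ico

theorem intervalIntegrable_cell (i : ℕ) {g : ℝ → ℝ} (hg : Continuous g) {a b : ℝ} (hab : a ≤ b) :
    IntervalIntegrable (S.cell i g) volume a b :=
  (S.memLp_cell i hg a b).intervalIntegrable_Ioc hab

theorem integral_cell (i : ℕ) : ∫ x in S.z 0..S.z S.n,
    S.cell i (fun x => S.ψ1 x ^ 2 - S.q x * S.ψ x ^ 2) x = 0 := by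
  have hψc := continuous_of_hasDerivAt S.hasDerivAt_ψ
  have hψ1c := continuous_of_hasDerivAt S.hasDerivAt_ψ1
  have hqc := S.continuous_q
  have hd : ∀ x, HasDerivAt (fun x => S.ψ x * S.ψ1 x) (S.ψ1 x ^ 2 - S.q x * S.ψ x ^ 2) x :=
    fun x => ((S.hasDerivAt_ψ x).mul (S.hasDerivAt_ψ1 x)).congr_deriv (by simp only [q]; ring)
  simp only [cell]
  rw [intervalIntegral.integral_eq_sub_of_hasDeriv_right
    (S.continuous_cell i (g := fun x => S.ψ x * S.ψ1 x) (by fun_prop)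
      fun i => by simp [S.ψ_zero]).continuousOn
    (fun x _ => hasDerivWithinAt_indicator_Ico hd x)
    (S.intervalIntegrable_cell i (by fun_prop) S.z_lt.le)]
  simp [indicator_apply, cell, S.ψ_zero]

variable {k : ℝ → IntervalL2 (S.z 0) (S.z S.n)}
  {T : IntervalL2 (S.z 0) (S.z S.n) →L[ℝ] IntervalL2 (S.z 0) (S.z S.n)}

theorem exists_mem_orthogonal (hk : IsGreenKernel (S.z 0) (S.z S.n) S.ω k)
    (hT : IsGreenOperator (S.z 0) (S.z S.n) S.ω k T)
    (E : Submodule ℝ (IntervalL2 (S.z 0) (S.z S.n))) (hE : FiniteDimensional ℝ E)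
    (hEn : Module.finrank ℝ E + 2 ≤ S.n) :
    ∃ f ∈ Eᗮ, f ≠ 0 ∧ S.κ⁻¹ * ‖f‖ ^ 2 ≤ inner ℝ (T f) f := by
  have hab := S.z_lt
  have hψc := continuous_of_hasDerivAt S.hasDerivAt_ψ
  have hψ1c := continuous_of_hasDerivAt S.hasDerivAt_ψ1
  have hRc := S.continuous_R
  have hR1c := S.continuous_R1
  have hωc := S.ω_continuous
  have huc : ∀ i, Continuous (S.cell i S.ψ) := fun i => S.continuous_cell i hψc S.ψ_zero
  have huR : ∀ i x, HasDerivWithinAt (S.cell i S.ψ) (S.cell i S.ψ1 x) (Ioi x) x := fun i x =>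
    hasDerivWithinAt_indicator_Ico S.hasDerivAt_ψ x
  have huz : ∀ i j, S.cell i S.ψ (S.z j) = 0 := fun i j => by
    simp [cell, indicator_apply, S.ψ_zero]
  choose m hm hmab using fun i => S.exists_hasDerivAt_R_mul_add (huc i)
  have hmc : ∀ i, Continuous (m i) := fun i => continuous_of_hasDerivAt (hm i)
  set fc : ℕ → ℝ → ℝ := fun i x =>
    S.R1 x * m i x + S.R x * (S.R x * m i x + S.cell i S.ψ x) + S.cell i S.ψ1 x with hfc
  have hf : ∀ i, MemLp (fc i) 2 (volume.restrict (Ioc (S.z 0) (S.z S.n))) := fun i =>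
    (Continuous.memLp_Ioc (F := fun x => S.R1 x * m i x +
      S.R x * (S.R x * m i x + S.cell i S.ψ x)) (by have := huc i; have := hmc i; fun_prop)
      _ _).add (S.memLp_cell i hψ1c _ _)
  let K : (Fin S.n → ℝ) →ₗ[ℝ] ℝ × E :=
    ∑ i : Fin S.n, (LinearMap.proj i : (Fin S.n → ℝ) →ₗ[ℝ] ℝ).smulRight
      ((∫ x in S.z 0..S.z S.n, S.ω x * m i x), E.orthogonalProjectionOnto ((hf i).toLp (fc i)))
  have hker : LinearMap.ker K ≠ ⊥ := by
    refine LinearMap.ker_ne_bot_of_finrank_lt ?_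
    simp only [Module.finrank_fintype_fun_eq_card, Fintype.card_fin, Module.finrank_prod,
      Module.finrank_self]
    lia
  obtain ⟨c, hc, hc0⟩ := Submodule.exists_mem_ne_zero_of_ne_bot hker
  have hKc : ∑ i : Fin S.n, c i • ((∫ x in S.z 0..S.z S.n, S.ω x * m i x),
      E.orthogonalProjectionOnto ((hf i).toLp (fc i))) = 0 := by
    have := LinearMap.mem_ker.mp hc
    simpa [K, LinearMap.sum_apply] using this
  obtain ⟨hF, hFsum⟩ := MemLp.exists_toLp_sum (fun i : Fin S.n => hf i) c Finset.univ
  set F := fun x => ∑ i : Fin S.n, c i * fc i x with hFdef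
  set M := fun x => ∑ i : Fin S.n, c i * m i x with hMdef
  set u := fun x => ∑ i : Fin S.n, c i * S.cell i S.ψ x with hudef
  set v := fun x => ∑ i : Fin S.n, c i * S.cell i S.ψ1 x with hvdef
  have hM : ∀ x, HasDerivAt M (S.R x * M x + u x) x := fun x => by
    refine (HasDerivAt.fun_sum fun (i : Fin S.n) _ => (hm i x).const_mul (c i)).congr_deriv ?_
    simp only [hMdef, hudef, Finset.mul_sum, ← Finset.sum_add_distrib]
    exact Finset.sum_congr rfl fun i _ => by ring
  have hu : ∀ x, HasDerivWithinAt u (v x) (Ioi x) x := fun x =>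
    HasDerivWithinAt.fun_sum fun (i : Fin S.n) _ => (huR i x).const_mul (c i)
  have hFv : ∀ x, F x = S.R1 x * M x + S.R x * (S.R x * M x + u x) + v x := fun x => by
    simp only [hFdef, hMdef, hudef, hvdef, hfc, Finset.mul_sum, ← Finset.sum_add_distrib]
    exact Finset.sum_congr rfl fun i _ => by ring
  have hMc := continuous_of_hasDerivAt hM
  have hucont : Continuous u := continuous_finsetSum _ fun i _ => (huc i).const_mul (c i)
  have hM1 : ∀ x ∈ Ioo (S.z 0) (S.z S.n),
      HasDerivWithinAt (fun x => S.R x * M x + u x) (F x) (Ioi x) x := fun x _ =>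
    (((S.hasDerivAt_R x).mul (hM x)).hasDerivWithinAt.add (hu x)).congr_deriv (hFv x).symm
  have hMab : M (S.z 0) = M (S.z S.n) := Finset.sum_congr rfl fun i _ => by rw [hmab]
  have huz' : ∀ j, u (S.z j) = 0 := fun j => Finset.sum_eq_zero fun i _ => by rw [huz, mul_zero]
  have hM1ab : S.R (S.z 0) * M (S.z 0) + u (S.z 0) = S.R (S.z S.n) * M (S.z S.n) + u (S.z S.n) := by
    rw [huz', huz', hMab, ← S.R_periodic (S.z 0), S.add_sub_z]
  have hM0 : ∫ x in S.z 0..S.z S.n, S.ω x * M x = 0 := by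
    have h1 := congrArg Prod.fst hKc
    simp only [Prod.fst_sum, Prod.smul_fst, smul_eq_mul, Prod.fst_zero] at h1
    simp only [hMdef, Finset.mul_sum]
    rw [intervalIntegral.integral_finsetSum fun i _ => by
      have := hmc i
      exact Continuous.intervalIntegrable (by fun_prop) _ _, ← h1]
    refine Finset.sum_congr rfl fun i _ => ?_
    rw [← intervalIntegral.integral_const_mul]
    exact intervalIntegral.integral_congr fun x _ => by ring
  have hkM := hk.inner_eq F M _ hF hM (by fun_prop) hM1 hMab hM1ab hM0
  have hen := S.integral_energy hF hM (by fun_prop) hM1 hMab hM1ab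
  have huv : ∀ x, (F x - S.R1 x * M x - S.R x * (S.R x * M x + u x)) ^ 2 -
      S.q x * (S.R x * M x + u x - S.R x * M x) ^ 2 =
      ∑ i : Fin S.n, c i ^ 2 * S.cell i (fun x => S.ψ1 x ^ 2 - S.q x * S.ψ x ^ 2) x := by
    intro x
    have hsq : ∀ g : ℝ → ℝ, (∑ i : Fin S.n, c i * S.cell i g x) ^ 2 =
        ∑ i : Fin S.n, c i ^ 2 * S.cell i g x ^ 2 := fun g => by
      rw [pow_two, Finset.sum_mul_sum]
      refine Finset.sum_congr rfl fun i _ => ?_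
      rw [Finset.sum_eq_single i]
      · ring
      · intro j _ hj
        have := S.cell_mul_cell (fun h => hj (Fin.ext h.symm) : (i : ℕ) ≠ j) g g x
        linear_combination c i * c j * this
      · simp
    have h1 : F x - S.R1 x * M x - S.R x * (S.R x * M x + u x) = v x := by rw [hFv]; ring
    have h2 : S.R x * M x + u x - S.R x * M x = u x := by ring
    rw [h1, h2, hvdef, hudef]
    simp only [hsq, Finset.mul_sum, ← Finset.sum_sub_distrib]
    refine Finset.sum_congr rfl fun i _ => ?_
    simp only [cell, indicator_apply]
    split_ifs <;> ring
  have hzero : ∫ x in S.z 0..S.z S.n, (F x * F x - S.κ * (S.ω x * M x * M x)) = 0 := by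
    rw [hen]
    simp only [huv]
    rw [intervalIntegral.integral_finsetSum fun i _ => by
      have := S.continuous_q
      exact (S.intervalIntegrable_cell i (by fun_prop) hab.le).const_mul _]
    refine Finset.sum_eq_zero fun i _ => ?_
    rw [intervalIntegral.integral_const_mul, S.integral_cell, mul_zero]
  refine ⟨hF.toLp F, ?_, ?_, ?_⟩
  · have h2 := congrArg Prod.snd hKc
    simp only [Prod.snd_sum, Prod.smul_snd, Prod.snd_zero, ← map_smul, ← map_sum] at h2
    rw [← hFsum] at h2
    exact (Submodule.orthogonalProjectionOnto_eq_zero_iff).mp h2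
  · intro h0
    have hMz : ∀ x ∈ Icc (S.z 0) (S.z S.n), M x = 0 := fun x hx => by
      rw [← hkM x hx, h0, inner_zero_right]
    have huzero : ∀ x ∈ Ioo (S.z 0) (S.z S.n), u x = 0 := fun x hx => by
      have h1 : HasDerivAt M 0 x := (hasDerivAt_const x (0 : ℝ)).congr_of_eventuallyEq
        (Filter.eventually_of_mem (Icc_mem_nhds hx.1 hx.2) hMz)
      have h2 := (hM x).unique h1
      rwa [hMz x (Ioo_subset_Icc_self hx), mul_zero, zero_add] at h2
    refine hc0 (funext fun i => ?_)
    obtain ⟨x, hx⟩ := nonempty_Ioo.mpr (S.z_strictMono (i : ℕ).lt_succ_self)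
    have hxI : x ∈ Ioo (S.z 0) (S.z S.n) :=
      ⟨(S.z_strictMono.monotone (Nat.zero_le _)).trans_lt hx.1,
        hx.2.trans_le (S.z_strictMono.monotone i.2)⟩
    have h1 := huzero x hxI
    have hcx : S.cell i (fun _ => 1) x = 1 := indicator_of_mem (Ioo_subset_Ico_self hx) _
    rw [hudef] at h1
    simp only at h1
    rw [Finset.sum_eq_single i] at h1
    · rw [cell, indicator_of_mem (Ioo_subset_Ico_self hx)] at h1
      exact (mul_eq_zero.mp h1).resolve_right (S.ψ_ne_zero i x hx)
    · intro j _ hj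
      have := S.cell_mul_cell (fun h => hj (Fin.ext h) : (j : ℕ) ≠ i) S.ψ (fun _ => 1) x
      rw [hcx, mul_one] at this
      rw [this, mul_zero]
    · simp
  · have hFF : IntervalIntegrable (fun x => F x * F x) volume (S.z 0) (S.z S.n) := by
      have := hF.integrable_sq
      simp only [pow_two] at this
      exact (intervalIntegrable_iff_integrableOn_Ioc_of_le hab.le).mpr this
    rw [intervalIntegral.integral_sub hFF (Continuous.intervalIntegrable (by fun_prop) _ _),
      intervalIntegral.integral_const_mul] at hzero
    have e1 : ‖hF.toLp F‖ ^ 2 = ∫ x in S.z 0..S.z S.n, F x * F x := by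
      rw [← inner_toLp_Ioc hab.le hF hF, real_inner_self_eq_norm_sq]
    have e2 : inner ℝ (T (hF.toLp F)) (hF.toLp F) =
        ∫ x in S.z 0..S.z S.n, S.ω x * M x * M x := by
      rw [hT.inner_eq]
      refine intervalIntegral.integral_congr fun x hx => ?_
      rw [uIcc_of_le hab.le] at hx
      simp only [hkM x hx]
    rw [e1, e2, inv_mul_le_iff₀ S.κ_pos]
    linarith

end HillFactorization

end

section

open MeasureTheory Set Module.End

namespace HillFactorization

variable (S : HillFactorization)

/-- The second derivative of `m0`. -/
noncomputable def m0'' (x : ℝ) : ℝ :=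
  S.R1 x * S.m0 x + S.R x * (S.R x * S.m0 x + S.ψ x) + S.ψ1 x

theorem weightedModes_κ_le :
    weightedModes (S.z S.n - S.z 0) S.ω S.κ ≤ Submodule.span ℝ {S.m0''} := by
  rintro F ⟨F1, M, M1, hF, hF1, hM, hM1, hFp, hMp⟩
  obtain ⟨α, hα⟩ := S.eq_smul_m0 hF hF1 hM hM1 hFp hMp
  rw [Submodule.mem_span_singleton]
  refine ⟨α, funext fun x => ?_⟩
  have h1 : ∀ x, M1 x = α * (S.R x * S.m0 x + S.ψ x) := fun x => by
    have h := hM x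
    rw [funext hα] at h
    exact h.unique ((S.hasDerivAt_m0 x).const_mul α)
  have h2 := hM1 x
  rw [funext h1] at h2
  exact (h2.unique ((((S.hasDerivAt_R x).mul (S.hasDerivAt_m0 x)).add
    (S.hasDerivAt_ψ x)).const_mul α)).symm

/-- Counting the periodic modes of a factorized problem below and above `κ`. -/
theorem weightedModes_count :
    (∀ μ < 0, weightedModes (S.z S.n - S.z 0) S.ω μ = ⊥) ∧
    (∃ hfin : {μ : ℝ | 0 < μ ∧ μ < S.κ ∧ weightedModes (S.z S.n - S.z 0) S.ω μ ≠ ⊥}.Finite,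
      ∑ μ ∈ hfin.toFinset, Module.finrank ℝ (weightedModes (S.z S.n - S.z 0) S.ω μ) = S.n - 2) ∧
    {μ : ℝ | S.κ < μ ∧ weightedModes (S.z S.n - S.z 0) S.ω μ ≠ ⊥}.Infinite := by
  have hab := S.z_lt
  have hΩ := S.integral_ω_pos.ne'
  have hωc := S.ω_continuous
  obtain ⟨k, hk⟩ := exists_isGreenKernel hab hωc hΩ
  obtain ⟨T, hT⟩ := exists_isGreenOperator hab hωc hΩ hk
  have hequiv := fun {μ : ℝ} (hμ : μ ≠ 0) =>
    hT.exists_equiv_eigenspace hab hωc S.ω_periodic hΩ hk hμ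
  have hfr : ∀ {μ : ℝ}, μ ≠ 0 → Module.finrank ℝ (weightedModes (S.z S.n - S.z 0) S.ω μ) =
      Module.finrank ℝ (eigenspace (T : IntervalL2 (S.z 0) (S.z S.n) →ₗ[ℝ] _) μ⁻¹) := fun hμ =>
    (hequiv hμ).elim fun e => e.finrank_eq
  have hbot : ∀ {μ : ℝ}, μ ≠ 0 → (weightedModes (S.z S.n - S.z 0) S.ω μ ≠ ⊥ ↔
      HasEigenvalue (T : IntervalL2 (S.z 0) (S.z S.n) →ₗ[ℝ] _) μ⁻¹) := fun hμ => by
    obtain ⟨e⟩ := hequiv hμ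
    rw [hasEigenvalue_iff, ← Submodule.nontrivial_iff_ne_bot, ← Submodule.nontrivial_iff_ne_bot]
    exact e.toEquiv.nontrivial_congr
  have hpos := hT.inner_self_nonneg hab S.ω_pos
  have hκ := S.κ_pos
  obtain ⟨⟨hfin, hsum⟩, hinf⟩ := eigenvalue_count hT.compact hT.isSymmetric hpos
    (inv_pos.mpr hκ) (S.n - 2)
    (fun E hE hET hlt => by
      have := S.finrank_le_of_lt_inner hk hT E hE hET hlt
      lia)
    (by
      rw [← hfr hκ.ne']
      exact (Submodule.finrank_mono S.weightedModes_κ_le).trans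
        ((finrank_span_le_card _).trans (by simp)))
    (fun E hE hEn => by
      by_cases h2 : 2 ≤ S.n
      · exact S.exists_mem_orthogonal hk hT E hE (by lia)
      · exfalso
        have := S.finrank_le_of_lt_inner hk hT ⊥ inferInstance
          (fun f hf => ⟨0, by rw [map_zero]; exact (Submodule.mem_bot ℝ).mp hf⟩)
          (fun f hf h0 => absurd ((Submodule.mem_bot ℝ).mp hf) h0)
        lia)
    (hT.not_finiteDimensional_range hab hωc S.ω_pos hΩ hk)
  refine ⟨fun μ hμ => ?_, ?_, ?_⟩
  · by_contra hne
    obtain ⟨f, hf⟩ := ((hbot hμ.ne).mp hne).exists_hasEigenvector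
    have h1 := hpos f
    rw [show T f = μ⁻¹ • f from hf.apply_eq_smul, inner_smul_left, real_inner_self_eq_norm_sq] at h1
    have h2 : 0 < ‖f‖ ^ 2 := by
      have := norm_pos_iff.mpr hf.2
      positivity
    exact (mul_neg_of_neg_of_pos (inv_lt_zero.mpr hμ) h2).not_ge h1
  · have himg : {μ : ℝ | 0 < μ ∧ μ < S.κ ∧ weightedModes (S.z S.n - S.z 0) S.ω μ ≠ ⊥} =
        Inv.inv '' {ν : ℝ | S.κ⁻¹ < ν ∧
          HasEigenvalue (T : IntervalL2 (S.z 0) (S.z S.n) →ₗ[ℝ] _) ν} := by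
      ext μ
      rw [image_inv_eq_inv, Set.mem_inv]
      simp only [mem_ofPred_eq]
      constructor
      · rintro ⟨h0, h1, h2⟩
        exact ⟨(inv_lt_inv₀ hκ h0).mpr h1, (hbot h0.ne').mp h2⟩
      · rintro ⟨h1, h2⟩
        have h0 : 0 < μ := inv_pos.mp ((inv_pos.mpr hκ).trans h1)
        exact ⟨h0, (inv_lt_inv₀ hκ h0).mp h1, (hbot h0.ne').mpr h2⟩
    have hfin' := hfin.image Inv.inv
    rw [← himg] at hfin'
    refine ⟨hfin', ?_⟩
    rw [← hsum]
    refine Finset.sum_nbij' Inv.inv Inv.inv ?_ ?_ (fun _ _ => inv_inv _) (fun _ _ => inv_inv _) ?_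
    · intro μ hμ
      rw [Set.Finite.mem_toFinset, himg] at hμ
      obtain ⟨ν, hν, rfl⟩ := hμ
      rw [Set.Finite.mem_toFinset, inv_inv]
      exact hν
    · intro ν hν
      rw [Set.Finite.mem_toFinset] at hν ⊢
      rw [himg]
      exact mem_image_of_mem _ hν
    · intro μ hμ
      rw [Set.Finite.mem_toFinset] at hμ
      exact hfr hμ.1.ne'
  · refine (hinf.image inv_injective.injOn).mono ?_
    rintro _ ⟨ν, ⟨h0, h1, h2⟩, rfl⟩
    refine ⟨?_, (hbot (inv_ne_zero h0.ne')).mpr (by rwa [inv_inv])⟩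
    exact (lt_inv_comm₀ h0 hκ).mp h1

end HillFactorization

end

section

open MeasureTheory Set

/-- A travelling wave profile in the variables `g = γ - U`, `P = U'`, `Q = U''`, with `γ = r²` and
`κ = γ³ - 6 I`. -/
structure IsWaveProfile (r κ : ℝ) (g P Q : ℝ → ℝ) : Prop where
  g_pos : ∀ x, 0 < g x
  speed_pos : ∀ x, 0 < r + P x
  hasDerivAt_g : ∀ x, HasDerivAt g (-P x) x
  hasDerivAt_P : ∀ x, HasDerivAt P (Q x) x
  g_mul_Q : ∀ x, g x * Q x = P x ^ 2 + g x - r ^ 2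
  κ_eq : ∀ x, κ = g x ^ 3 * (1 - 3 * Q x)

namespace IsWaveProfile

variable {r κ : ℝ} {g P Q : ℝ → ℝ}

theorem hasDerivAt_Q (h : IsWaveProfile r κ g P Q) (x : ℝ) :
    HasDerivAt Q (-(κ * P x / g x ^ 4)) x := by
  have hQ : Q = fun x => (1 - κ * (g x ^ 3)⁻¹) / 3 := funext fun x => by
    have := (h.g_pos x).ne'
    rw [h.κ_eq x]; field_simp; ring
  have hg := (h.g_pos x).ne'
  rw [hQ]
  refine (((((h.hasDerivAt_g x).pow 3).inv (pow_ne_zero 3 hg)).const_mul κ).const_sub 1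
    |>.div_const 3).congr_deriv ?_
  simp only [Pi.pow_apply]
  field_simp
  push_cast
  ring

end IsWaveProfile

section Identities

variable {g P r : ℝ}

theorem wave_factor_identity (hg : g ≠ 0) (hs : r + P ≠ 0) {κ Q : ℝ}
    (hQ : Q = (P ^ 2 + g - r ^ 2) / g) (hκ : κ = g ^ 3 * (1 - 3 * Q)) :
    κ * Q / (g ^ 4 * (r + P) ^ 2) + 4 * κ * P ^ 2 / (g ^ 5 * (r + P) ^ 2) -
      2 * κ * P * Q / (g ^ 4 * (r + P) ^ 3) + 2 * (1 - 2 * Q) * κ * P / (g ^ 4 * (r + P) ^ 3)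
      + 6 * (1 - Q) * Q ^ 2 / (r + P) ^ 4 =
    κ / g ^ 5 - ((1 - Q) / (r + P) ^ 2) ^ 2 -
      2 * (κ * P / (g ^ 4 * (r + P) ^ 2) - 2 * (1 - Q) * Q / (r + P) ^ 3) / (r + P) := by
  subst hκ hQ
  field_simp
  ring

end Identities

end

section

open MeasureTheory Set

namespace IsWaveProfile

variable {r κ : ℝ} {g P Q : ℝ → ℝ}

theorem Q_eq (h : IsWaveProfile r κ g P Q) (x : ℝ) : Q x = (P x ^ 2 + g x - r ^ 2) / g x := by
  rw [eq_div_iff (h.g_pos x).ne', ← h.g_mul_Q x]; ring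

theorem hasDerivAt_speed (h : IsWaveProfile r κ g P Q) (x : ℝ) :
    HasDerivAt (fun x => r + P x) (Q x) x :=
  (h.hasDerivAt_P x).const_add r

theorem hasDerivAt_R (h : IsWaveProfile r κ g P Q) (x : ℝ) :
    HasDerivAt (fun x => 1 / (r + P x)) (-(Q x / (r + P x) ^ 2)) x := by
  have hs := (h.speed_pos x).ne'
  refine ((hasDerivAt_const x (1 : ℝ)).div (h.hasDerivAt_speed x) hs).congr_deriv ?_
  field_simp; ring

theorem hasDerivAt_R1 (h : IsWaveProfile r κ g P Q) (x : ℝ) :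
    HasDerivAt (fun x => -(Q x / (r + P x) ^ 2))
      ((κ * P x / (g x ^ 4 * (r + P x) ^ 2) - 2 * (1 - Q x) * Q x / (r + P x) ^ 3) -
        2 * (1 / (r + P x)) * (-(Q x / (r + P x) ^ 2))) x := by
  have hs := (h.speed_pos x).ne'
  have hg := (h.g_pos x).ne'
  refine ((h.hasDerivAt_Q x).div ((h.hasDerivAt_speed x).pow 2) (pow_ne_zero 2 hs)).neg.congr_deriv
    ?_
  simp only [Pi.pow_apply]
  field_simp; push_cast; ring

theorem hasDerivAt_ρ1 (h : IsWaveProfile r κ g P Q) (x : ℝ) :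
    HasDerivAt (fun x => κ * P x / (g x ^ 4 * (r + P x) ^ 2) -
      2 * (1 - Q x) * Q x / (r + P x) ^ 3)
      (κ * (1 / g x ^ 5) - (-(Q x / (r + P x) ^ 2) + (1 / (r + P x)) ^ 2) ^ 2 -
        2 * (κ * P x / (g x ^ 4 * (r + P x) ^ 2) - 2 * (1 - Q x) * Q x / (r + P x) ^ 3) *
          (1 / (r + P x))) x := by
  have hs := (h.speed_pos x).ne'
  have hg := (h.g_pos x).ne'
  have hdP := h.hasDerivAt_P x
  have hdQ := h.hasDerivAt_Q x
  have hds := h.hasDerivAt_speed x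
  refine (((hdP.const_mul κ).div (((h.hasDerivAt_g x).pow 4).mul (hds.pow 2))
    (mul_ne_zero (pow_ne_zero 4 hg) (pow_ne_zero 2 hs))).sub
    ((((hdQ.const_sub 1).const_mul 2).mul hdQ).div (hds.pow 3) (pow_ne_zero 3 hs))).congr_deriv ?_
  have key := wave_factor_identity hg hs (h.Q_eq x) (h.κ_eq x)
  simp only [Pi.pow_apply, Pi.mul_apply]
  trans κ * Q x / (g x ^ 4 * (r + P x) ^ 2) + 4 * κ * P x ^ 2 / (g x ^ 5 * (r + P x) ^ 2) -
      2 * κ * P x * Q x / (g x ^ 4 * (r + P x) ^ 3) +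
      2 * (1 - 2 * Q x) * κ * P x / (g x ^ 4 * (r + P x) ^ 3)
      + 6 * (1 - Q x) * Q x ^ 2 / (r + P x) ^ 4
  · field_simp; push_cast; ring
  · rw [key]; field_simp; ring

theorem hasDerivAt_m0 (h : IsWaveProfile r κ g P Q) (x : ℝ) : HasDerivAt (fun x => g x * P x)
    (1 / (r + P x) * (g x * P x) + -(r * (r ^ 2 - g x + r * P x) / (r + P x))) x := by
  have hs := (h.speed_pos x).ne'
  refine ((h.hasDerivAt_g x).mul (h.hasDerivAt_P x)).congr_deriv ?_
  rw [h.g_mul_Q x]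
  field_simp; ring

theorem hasDerivAt_ψ (h : IsWaveProfile r κ g P Q) (x : ℝ) :
    HasDerivAt (fun x => -(r * (r ^ 2 - g x + r * P x) / (r + P x)))
    (-(r * (P x + r * Q x) / (r + P x)) + r * (r ^ 2 - g x + r * P x) * Q x / (r + P x) ^ 2)
    x := by
  have hs := (h.speed_pos x).ne'
  refine ((((h.hasDerivAt_g x).const_sub (r ^ 2)).add ((h.hasDerivAt_P x).const_mul r)).const_mul r
    |>.div (h.hasDerivAt_speed x) hs).neg.congr_deriv ?_
  simp only [Pi.add_apply]
  field_simp; ring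

theorem hasDerivAt_ψ1 (h : IsWaveProfile r κ g P Q) (x : ℝ) : HasDerivAt (fun x =>
    -(r * (P x + r * Q x) / (r + P x)) + r * (r ^ 2 - g x + r * P x) * Q x / (r + P x) ^ 2)
    (-(((1 / (r + P x)) ^ 2 + 3 * -(Q x / (r + P x) ^ 2)) *
      -(r * (r ^ 2 - g x + r * P x) / (r + P x)))) x := by
  have hs := (h.speed_pos x).ne'
  have hg := (h.g_pos x).ne'
  have hdP := h.hasDerivAt_P x
  have hdQ := h.hasDerivAt_Q x
  have hds := h.hasDerivAt_speed x
  refine ((((hdP.add (hdQ.const_mul r)).const_mul r).div hds hs).neg.add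
    ((((((h.hasDerivAt_g x).const_sub (r ^ 2)).add (hdP.const_mul r)).const_mul r).mul hdQ).div
      (hds.pow 2) (pow_ne_zero 2 hs))).congr_deriv ?_
  simp only [Pi.pow_apply, Pi.mul_apply, Pi.add_apply]
  rw [h.κ_eq x, h.Q_eq x]
  field_simp; push_cast; ring

theorem hasDerivAt_e (h : IsWaveProfile r κ g P Q) (x : ℝ) :
    HasDerivAt (fun x => 3 * r ^ 4 * (g x * P x) -
      (κ * (g x + r ^ 2) - 2 * r ^ 4 * g x ^ 2) / (r + P x))
    (3 * r ^ 4 * (g x * Q x - P x ^ 2) - (4 * r ^ 4 * (g x * P x) - κ * P x) / (r + P x) +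
      (κ * (g x + r ^ 2) - 2 * r ^ 4 * g x ^ 2) * Q x / (r + P x) ^ 2) x := by
  have hs := (h.speed_pos x).ne'
  have hdg := h.hasDerivAt_g x
  refine (((hdg.mul (h.hasDerivAt_P x)).const_mul (3 * r ^ 4)).sub
    ((((hdg.add_const (r ^ 2)).const_mul κ).sub ((hdg.pow 2).const_mul (2 * r ^ 4))).div
      (h.hasDerivAt_speed x) hs)).congr_deriv ?_
  simp only [Pi.pow_apply, Pi.sub_apply]
  field_simp; push_cast; ring

theorem hasDerivAt_e1 (h : IsWaveProfile r κ g P Q) (x : ℝ) : HasDerivAt (fun x =>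
    3 * r ^ 4 * (g x * Q x - P x ^ 2) - (4 * r ^ 4 * (g x * P x) - κ * P x) / (r + P x) +
      (κ * (g x + r ^ 2) - 2 * r ^ 4 * g x ^ 2) * Q x / (r + P x) ^ 2)
    (-(κ * P x / g x ^ 2) * -(r * (r ^ 2 - g x + r * P x) / (r + P x)) +
      2 * (r ^ 4 - κ / g x) * (-(r * (P x + r * Q x) / (r + P x)) +
        r * (r ^ 2 - g x + r * P x) * Q x / (r + P x) ^ 2) -
      ((1 / (r + P x)) ^ 2 + 3 * -(Q x / (r + P x) ^ 2)) * (3 * r ^ 4 * (g x * P x) -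
        (κ * (g x + r ^ 2) - 2 * r ^ 4 * g x ^ 2) / (r + P x))) x := by
  have hs := (h.speed_pos x).ne'
  have hg := (h.g_pos x).ne'
  have hdg := h.hasDerivAt_g x
  have hdP := h.hasDerivAt_P x
  have hdQ := h.hasDerivAt_Q x
  have hds := h.hasDerivAt_speed x
  refine ((((hdg.mul hdQ).sub (hdP.pow 2)).const_mul (3 * r ^ 4)).sub
    ((((hdg.mul hdP).const_mul (4 * r ^ 4)).sub (hdP.const_mul κ)).div hds hs) |>.add
    (((((hdg.add_const (r ^ 2)).const_mul κ).sub ((hdg.pow 2).const_mul (2 * r ^ 4))).mul hdQ).div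
      (hds.pow 2) (pow_ne_zero 2 hs))).congr_deriv ?_
  simp only [Pi.pow_apply, Pi.mul_apply, Pi.sub_apply]
  rw [h.κ_eq x, h.Q_eq x]
  field_simp; push_cast; ring

theorem hasDerivAt_τ1 (h : IsWaveProfile r κ g P Q) (x : ℝ) :
    HasDerivAt (fun x => r ^ 4 - κ / g x) (-(κ * P x / g x ^ 2)) x := by
  have hg := (h.g_pos x).ne'
  refine (((hasDerivAt_const x κ).div (h.hasDerivAt_g x) hg).const_sub (r ^ 4)).congr_deriv ?_
  field_simp; ring

theorem hasDerivAt_τ (h : IsWaveProfile r κ g P Q) {J : ℝ → ℝ}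
    (hJ : ∀ x, HasDerivAt J (3 * g x * P x ^ 2 + 2 * (r ^ 2 - g x) ^ 2) x) (x : ℝ) :
    HasDerivAt (fun x => r ^ 2 * (g x * P x) + J x) (r ^ 4 - κ / g x) x := by
  have hg := (h.g_pos x).ne'
  refine ((((h.hasDerivAt_g x).mul (h.hasDerivAt_P x)).const_mul (r ^ 2)).add
    (hJ x)).congr_deriv ?_
  rw [h.κ_eq x, h.Q_eq x]
  field_simp; ring

theorem wronskian_eq (h : IsWaveProfile r κ g P Q) (x : ℝ) :
    -(r * (r ^ 2 - g x + r * P x) / (r + P x)) *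
      (-(r ^ 4 - κ / g x) * -(r * (r ^ 2 - g x + r * P x) / (r + P x)) +
        (3 * r ^ 4 * (g x * Q x - P x ^ 2) - (4 * r ^ 4 * (g x * P x) - κ * P x) / (r + P x) +
          (κ * (g x + r ^ 2) - 2 * r ^ 4 * g x ^ 2) * Q x / (r + P x) ^ 2)) -
      (-(r * (P x + r * Q x) / (r + P x)) + r * (r ^ 2 - g x + r * P x) * Q x / (r + P x) ^ 2) *
        (3 * r ^ 4 * (g x * P x) - (κ * (g x + r ^ 2) - 2 * r ^ 4 * g x ^ 2) / (r + P x)) =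
    2 * r ^ 2 * (r ^ 6 - κ) := by
  have hs := (h.speed_pos x).ne'
  have hg := (h.g_pos x).ne'
  rw [h.κ_eq x, h.Q_eq x]
  field_simp; ring

end IsWaveProfile

end

section

open Set

section SturmComparison

variable {a b k : ℝ} {q y y1 : ℝ → ℝ}

theorem le_sub_of_zeros_of_lt_sq (hk : 0 < k) (hy : ∀ x, HasDerivAt y (y1 x) x)
    (hy1 : ∀ x, HasDerivAt y1 (-(q x * y x)) x) (hq : ∀ x, q x < k ^ 2)
    (hne : ∀ x, y x = 0 → y1 x ≠ 0) (hab : a < b) (ha : y a = 0) (hb : y b = 0) :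
    Real.pi / k ≤ b - a := by
  by_contra! hlt
  set m := (a + b) / 2 with hm
  have hcos : ∀ x ∈ Icc a b, 0 < Real.cos (k * (x - m)) := fun x hx => by
    rw [lt_div_iff₀ hk] at hlt
    apply Real.cos_pos_of_mem_Ioo
    constructor <;> nlinarith [hx.1, hx.2]
  set G : ℝ → ℝ := fun x =>
    y x * y1 x + y x ^ 2 * (k * Real.sin (k * (x - m)) / Real.cos (k * (x - m))) with hG
  have hlin : ∀ x, HasDerivAt (fun x => k * (x - m)) k x := fun x =>
    (((hasDerivAt_id x).sub_const m).const_mul k).congr_deriv (by ring)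
  have hdG : ∀ x ∈ Icc a b, HasDerivAt G ((y1 x + y x * (k * Real.sin (k * (x - m)) /
      Real.cos (k * (x - m)))) ^ 2 + (k ^ 2 - q x) * y x ^ 2) x := fun x hx => by
    have hc := (hcos x hx).ne'
    refine (((hy x).mul (hy1 x)).add (((hy x).pow 2).mul
      (((hlin x).sin.const_mul k).div (hlin x).cos hc))).congr_deriv ?_
    simp only [Pi.pow_apply, Pi.div_apply]
    field_simp
    push_cast
    ring
  have hmono : MonotoneOn G (Icc a b) := by
    refine monotoneOn_of_deriv_nonneg (convex_Icc a b)
      (fun x hx => (hdG x hx).continuousAt.continuousWithinAt)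
      (fun x hx => (hdG x (interior_subset hx)).differentiableAt.differentiableWithinAt)
      fun x hx => ?_
    rw [(hdG x (interior_subset hx)).deriv]
    have := hq x
    have := mul_nonneg (sub_pos.2 this).le (sq_nonneg (y x))
    positivity
  have hGa : G a = 0 := by simp [hG, ha]
  have hGb : G b = 0 := by simp [hG, hb]
  have hG0 : ∀ x ∈ Icc a b, G x = 0 := fun x hx => le_antisymm
    (hGb ▸ hmono hx (right_mem_Icc.2 hab.le) hx.2) (hGa ▸ hmono (left_mem_Icc.2 hab.le) hx hx.1)
  have hy0 : ∀ x ∈ Ioo a b, y x = 0 := fun x hx => by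
    have h1 : G =ᶠ[nhds x] fun _ => 0 := by
      filter_upwards [Icc_mem_nhds hx.1 hx.2] with t ht using hG0 t ht
    have h2 := (hdG x (Ioo_subset_Icc_self hx)).unique
      ((hasDerivAt_const x (0 : ℝ)).congr_of_eventuallyEq h1)
    have h3 := sub_pos.2 (hq x)
    by_contra hne
    have := mul_pos h3 (sq_pos_of_ne_zero hne)
    nlinarith [sq_nonneg (y1 x + y x * (k * Real.sin (k * (x - m)) / Real.cos (k * (x - m))))]
  obtain ⟨x, hx⟩ := nonempty_Ioo.2 hab
  have h1 : y =ᶠ[nhds x] fun _ => 0 := by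
    filter_upwards [Ioo_mem_nhds hx.1 hx.2] with t ht using hy0 t ht
  exact hne x (hy0 x hx) ((hy x).unique ((hasDerivAt_const x (0 : ℝ)).congr_of_eventuallyEq h1))

theorem exists_zero_of_sq_lt (hk : 0 < k) (hy : ∀ x, HasDerivAt y (y1 x) x)
    (hy1 : ∀ x, HasDerivAt y1 (-(q x * y x)) x) (hq : ∀ x, k ^ 2 < q x) (a : ℝ) :
    ∃ x ∈ Icc a (a + Real.pi / k), y x = 0 := by
  by_contra! hne
  have hyc : Continuous y := continuous_of_hasDerivAt hy
  wlog hpos : 0 < y a generalizing y y1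
  · have ha := hne a (left_mem_Icc.2 (by have := Real.pi_pos; simp; positivity))
    refine this (y := fun x => -y x) (y1 := fun x => -y1 x) (fun x => (hy x).neg)
      (fun x => ((hy1 x).neg).congr_deriv (by ring)) (fun x hx => neg_ne_zero.2 (hne x hx))
      hyc.neg (neg_pos.2 (lt_of_le_of_ne (not_lt.1 hpos) ha))
  have hle : a < a + Real.pi / k := by have := Real.pi_pos; simp; positivity
  have hpos' : ∀ x ∈ Icc a (a + Real.pi / k), 0 < y x := fun x hx => by
    by_contra! hx0
    obtain ⟨t, ht, ht0⟩ := intermediate_value_Icc' hx.1 hyc.continuousOn ⟨hx0, hpos.le⟩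
    exact hne t ⟨ht.1, ht.2.trans hx.2⟩ ht0
  set G : ℝ → ℝ := fun x => y x * (k * Real.cos (k * (x - a))) - y1 x * Real.sin (k * (x - a))
    with hG
  have hlin : ∀ x, HasDerivAt (fun x => k * (x - a)) k x := fun x =>
    (((hasDerivAt_id x).sub_const a).const_mul k).congr_deriv (by ring)
  have hdG : ∀ x, HasDerivAt G ((q x - k ^ 2) * y x * Real.sin (k * (x - a))) x := fun x => by
    refine (((hy x).mul ((hlin x).cos.const_mul k)).sub
      ((hy1 x).mul (hlin x).sin)).congr_deriv ?_
    ring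
  have hmono : MonotoneOn G (Icc a (a + Real.pi / k)) := by
    refine monotoneOn_of_deriv_nonneg (convex_Icc _ _)
      (fun x _ => (hdG x).continuousAt.continuousWithinAt)
      (fun x _ => (hdG x).differentiableAt.differentiableWithinAt) fun x hx => ?_
    have hx := interior_subset hx
    rw [(hdG x).deriv]
    have h1 := sub_pos.2 (hq x)
    have h2 := hpos' x hx
    refine mul_nonneg (mul_pos h1 h2).le (Real.sin_nonneg_of_nonneg_of_le_pi
      (mul_nonneg hk.le (sub_nonneg.2 hx.1)) ?_)
    have := hx.2
    rw [← sub_le_iff_le_add', le_div_iff₀ hk] at this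
    linarith
  have h1 := hmono (left_mem_Icc.2 hle.le) (right_mem_Icc.2 hle.le) hle.le
  have h2 : k * (a + Real.pi / k - a) = Real.pi := by field_simp; ring
  simp only [hG, h2, sub_self, mul_zero, Real.cos_zero, Real.sin_zero, Real.cos_pi,
    Real.sin_pi] at h1
  have h3 := mul_pos (hpos' a (left_mem_Icc.2 hle.le)) hk
  have h4 := mul_pos (hpos' _ (right_mem_Icc.2 hle.le)) hk
  linarith

/-- A `2π`-periodic solution of Hill's equation with `q` close to `1` has exactly two zeros per
period. -/
theorem exists_zeros_of_periodic (hy : ∀ x, HasDerivAt y (y1 x) x)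
    (hy1 : ∀ x, HasDerivAt y1 (-(q x * y x)) x) (hq : ∀ x, (12 / 13) ^ 2 < q x)
    (hq' : ∀ x, q x < (10 / 9) ^ 2) (hne : ∀ x, y x = 0 → y1 x ≠ 0)
    (hp : Function.Periodic y (2 * Real.pi)) :
    ∃ z : ℕ → ℝ, StrictMono z ∧ (∀ i, y (z i) = 0) ∧
      (∀ i, ∀ x ∈ Ioo (z i) (z (i + 1)), y x ≠ 0) ∧
      ∀ N : ℕ, z (2 * N) = z 0 + 2 * Real.pi * N := by
  have hpi := Real.pi_pos
  have hgap : ∀ a b, a < b → y a = 0 → y b = 0 → 9 / 10 * Real.pi ≤ b - a :=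
    fun a b hab ha hb => by
      have := le_sub_of_zeros_of_lt_sq (by norm_num) hy hy1 hq' hne hab ha hb
      linarith
  have hex : ∀ a, ∃ x, a ≤ x ∧ x ≤ a + 13 / 12 * Real.pi ∧ y x = 0 := fun a => by
    obtain ⟨x, hx, hx0⟩ := exists_zero_of_sq_lt (by norm_num) hy hy1 hq a
    exact ⟨x, hx.1, by linarith [hx.2], hx0⟩
  obtain ⟨u, -, -, hu⟩ := hex 0
  obtain ⟨v, hv1, hv2, hv⟩ := hex (u + 9 / 10 * Real.pi)
  have hu' : y (u + 2 * Real.pi) = 0 := by rw [hp, hu]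
  have hvu := hgap v _ (by linarith) hv hu'
  have hshift : ∀ (x : ℝ) (j : ℕ), y (x + 2 * Real.pi * j) = y x := fun x j => by
    rw [mul_comm]; exact hp.nat_mul j x
  have hbetween : ∀ a b, a < b → b - a < 9 / 5 * Real.pi → y a = 0 → y b = 0 →
      ∀ x ∈ Ioo a b, y x ≠ 0 := fun a b _ hlt ha hb x hx hx0 => by
    have h1 := hgap a x hx.1 ha hx0
    have h2 := hgap x b hx.2 hx0 hb
    linarith
  set z : ℕ → ℝ := fun i => (if i % 2 = 0 then u else v) + 2 * Real.pi * (i / 2 : ℕ) with hz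
  have hcases : ∀ i, (z i = u + 2 * Real.pi * (i / 2 : ℕ) ∧
        z (i + 1) = v + 2 * Real.pi * (i / 2 : ℕ)) ∨
      (z i = v + 2 * Real.pi * (i / 2 : ℕ) ∧
        z (i + 1) = u + 2 * Real.pi * (i / 2 : ℕ) + 2 * Real.pi) := fun i => by
    rcases Nat.mod_two_eq_zero_or_one i with h | h
    · left
      have h1 : (i + 1) % 2 = 1 := by lia
      have h2 : (i + 1) / 2 = i / 2 := by lia
      simp [hz, h, h1, h2]
    · right
      have h1 : (i + 1) % 2 = 0 := by lia
      have h2 : (i + 1) / 2 = i / 2 + 1 := by lia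
      simp [hz, h, h1, h2]
      ring
  have hstep : ∀ i, z i < z (i + 1) ∧ z (i + 1) - z i < 9 / 5 * Real.pi := fun i => by
    rcases hcases i with ⟨h1, h2⟩ | ⟨h1, h2⟩ <;> rw [h1, h2] <;> constructor <;> linarith
  have hzero : ∀ i, y (z i) = 0 := fun i => by
    rcases hcases i with ⟨h1, -⟩ | ⟨h1, -⟩ <;> rw [h1, hshift] <;> assumption
  refine ⟨z, strictMono_nat_of_lt_succ fun i => (hstep i).1, hzero, fun i =>
    hbetween _ _ (hstep i).1 (hstep i).2 (hzero i) (hzero (i + 1)), fun N => ?_⟩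
  simp [hz]

end SturmComparison

end

section

open Set

namespace IsWaveProfile

variable {r κ : ℝ} {g P Q : ℝ → ℝ}

theorem periodic_P (h : IsWaveProfile r κ g P Q) {p : ℝ} (hp : Function.Periodic g p) :
    Function.Periodic P p := fun x => by
  have := hp.of_hasDerivAt h.hasDerivAt_g x
  simpa using this

theorem exists_hill_data (h : IsWaveProfile r κ g P Q) {p : ℝ} (hp : Function.Periodic g p) :
    ∃ ψ ψ1 e e1 : ℝ → ℝ,
    (∀ x, HasDerivAt (fun x => g x * P x) (1 / (r + P x) * (g x * P x) + ψ x) x) ∧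
    (∀ x, HasDerivAt ψ (ψ1 x) x) ∧
    (∀ x, HasDerivAt ψ1
      (-(((1 / (r + P x)) ^ 2 + 3 * -(Q x / (r + P x) ^ 2)) * ψ x)) x) ∧
    (∀ x, HasDerivAt e (e1 x) x) ∧
    (∀ x, HasDerivAt e1 (-(κ * P x / g x ^ 2) * ψ x + 2 * (r ^ 4 - κ / g x) * ψ1 x -
      ((1 / (r + P x)) ^ 2 + 3 * -(Q x / (r + P x) ^ 2)) * e x) x) ∧
    (∀ x, ψ x * (-(r ^ 4 - κ / g x) * ψ x + e1 x) - ψ1 x * e x = 2 * r ^ 2 * (r ^ 6 - κ)) ∧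
    (∀ x, -(Q x / (r + P x) ^ 2) * (g x * P x) +
      1 / (r + P x) * (1 / (r + P x) * (g x * P x) + ψ x) + ψ1 x = -P x) ∧
    Function.Periodic ψ p ∧ Function.Periodic e p := by
  refine ⟨_, _, _, _, h.hasDerivAt_m0, h.hasDerivAt_ψ, h.hasDerivAt_ψ1, h.hasDerivAt_e,
    h.hasDerivAt_e1, h.wronskian_eq, fun x => ?_, fun x => ?_, fun x => ?_⟩
  · have hs := (h.speed_pos x).ne'
    have hg := (h.g_pos x).ne'
    rw [h.Q_eq x]
    field_simp; ring
  · simp only [hp x, h.periodic_P hp x]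
  · simp only [hp x, h.periodic_P hp x]

theorem exists_hillFactorization (h : IsWaveProfile r κ g P Q) (hr : 0 < r)
    (hκ : 0 < κ) (hκr : κ < r ^ 6)
    (hp : Function.Periodic g (2 * Real.pi))
    (hq : ∀ x, (12 / 13) ^ 2 < (1 - 3 * Q x) / (r + P x) ^ 2)
    (hq' : ∀ x, (1 - 3 * Q x) / (r + P x) ^ 2 < (10 / 9) ^ 2) {N : ℕ} (hN : 0 < N) :
    ∃ S : HillFactorization, (S.ω = fun x => 1 / g x ^ 5) ∧ S.κ = κ ∧ S.n = 2 * N ∧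
      S.z S.n - S.z 0 = 2 * Real.pi * N ∧ S.m0'' = fun x => -P x := by
  obtain ⟨ψ, ψ1, e, e1, hm, hψ, hψ1, he, he1, hW, hP, hψp, hep⟩ := h.exists_hill_data hp
  have hgc := continuous_of_hasDerivAt h.hasDerivAt_g
  have hPc := continuous_of_hasDerivAt h.hasDerivAt_P
  have hpos : 0 < 2 * r ^ 2 * (r ^ 6 - κ) := by have := sub_pos.2 hκr; positivity
  have hqeq : ∀ x, (1 / (r + P x)) ^ 2 + 3 * -(Q x / (r + P x) ^ 2) =
      (1 - 3 * Q x) / (r + P x) ^ 2 := fun x => by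
    have := (h.speed_pos x).ne'
    field_simp; ring
  obtain ⟨z, hz, hz0, hzne, hzN⟩ := exists_zeros_of_periodic hψ hψ1
    (fun x => by rw [hqeq]; exact hq x) (fun x => by rw [hqeq]; exact hq' x)
    (fun x h0 h1 => by
      have := hW x
      rw [h0, h1] at this
      linarith) hψp
  have hL : z (2 * N) - z 0 = 2 * Real.pi * N := by rw [hzN]; ring
  have hper : ∀ {f : ℝ → ℝ}, Function.Periodic f (2 * Real.pi) →
      Function.Periodic f (z (2 * N) - z 0) := fun hf => by
    rw [hL, mul_comm]; exact hf.nat_mul N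
  have hend : ∀ {f : ℝ → ℝ}, Function.Periodic f (2 * Real.pi) → f (z (2 * N)) = f (z 0) :=
    fun hf => by rw [← hper hf (z 0)]; congr 1; ring
  set D : ℝ → ℝ := fun x => 3 * g x * P x ^ 2 + 2 * (r ^ 2 - g x) ^ 2 with hD
  have hDpos : ∀ x, 0 < D x := fun x => by
    have hg := h.g_pos x
    have h1 : 0 ≤ 3 * g x * P x ^ 2 := by positivity
    rcases eq_or_ne (r ^ 2 - g x) 0 with h0 | h0
    · rcases eq_or_ne (P x) 0 with hP0 | hP0
      · have h2 : Q x = 0 := by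
          rw [h.Q_eq, hP0, ← sub_eq_zero.1 h0]; simp
        have h3 := h.κ_eq x
        rw [h2, ← sub_eq_zero.1 h0] at h3
        linarith
      · simp only [hD]; positivity
    · simp only [hD]; positivity
  have hDc : Continuous D := by fun_prop
  obtain ⟨J, hJ⟩ : ∃ J : ℝ → ℝ, ∀ x, HasDerivAt J (D x) x :=
    ⟨fun x => ∫ t in (0 : ℝ)..x, D t, fun x => hDc.integral_hasStrictDerivAt 0 x |>.hasDerivAt⟩
  have hJmono : StrictMono J := strictMono_of_deriv_pos fun x => by
    rw [(hJ x).deriv]; exact hDpos x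
  have hτ := h.hasDerivAt_τ hJ
  refine ⟨{
    ω := fun x => 1 / g x ^ 5
    R := fun x => 1 / (r + P x)
    R1 := fun x => -(Q x / (r + P x) ^ 2)
    ρ1 := fun x => κ * P x / (g x ^ 4 * (r + P x) ^ 2) - 2 * (1 - Q x) * Q x / (r + P x) ^ 3
    ψ := ψ
    ψ1 := ψ1
    η := fun x => -((r ^ 2 * (g x * P x) + J x) * ψ x) + e x
    η1 := fun x => -((r ^ 4 - κ / g x) * ψ x + (r ^ 2 * (g x * P x) + J x) * ψ1 x) + e1 x
    m0 := fun x => g x * P x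
    κ := κ
    c := J (z (2 * N)) - J (z 0)
    W := 2 * r ^ 2 * (r ^ 6 - κ)
    n := 2 * N
    z := z
    n_pos := by lia
    κ_pos := hκ
    c_pos := sub_pos.2 (hJmono (hz (by lia)))
    W_pos := hpos
    ω_continuous := continuous_const.div (hgc.pow 5) fun x => pow_ne_zero 5 (h.g_pos x).ne'
    ω_pos := fun x => by have := h.g_pos x; positivity
    ω_periodic := hper fun x => by simp only [hp x]
    R_pos := fun x => by have := h.speed_pos x; positivity
    R_periodic := hper fun x => by simp only [h.periodic_P hp x]
    hasDerivAt_R := h.hasDerivAt_R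
    hasDerivAt_R1 := h.hasDerivAt_R1
    hasDerivAt_ρ1 := h.hasDerivAt_ρ1
    hasDerivAt_ψ := hψ
    hasDerivAt_ψ1 := hψ1
    hasDerivAt_η := fun x => ((hτ x).mul (hψ x)).neg.add (he x)
    hasDerivAt_η1 := fun x => ((((h.hasDerivAt_τ1 x).mul (hψ x)).add
      ((hτ x).mul (hψ1 x))).neg.add (he1 x)).congr_deriv (by ring)
    hasDerivAt_m0 := hm
    m0_periodic := hper fun x => by simp only [hp x, h.periodic_P hp x]
    wronskian := fun x => by rw [← hW x]; ring
    η_end := by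
      simp only [hz0, mul_zero, neg_zero, zero_add]
      exact hend hep
    η1_end := by
      simp only [hz0, mul_zero, zero_add]
      rw [hend hp, hend (h.periodic_P hp), hend (hψp.of_hasDerivAt hψ), hend (hep.of_hasDerivAt he)]
      ring
    z_strictMono := hz
    ψ_zero := hz0
    ψ_ne_zero := hzne }, rfl, rfl, rfl, hL, funext hP⟩

end IsWaveProfile

end

section

open Set

/-- Small even solutions of the reduced Ostrovsky equation yield wave profiles whose Hill potential
is close to `1`. -/
theorem isWaveProfile_of_ostrovsky {γ I : ℝ} {U : ℝ → ℝ} (hγ : γ ∈ Ioo (1 : ℝ) (1 + 1 / 100))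
    (heven : ∀ z, U (-z) = U z) (hU : ContDiff ℝ (⊤ : ℕ∞) U) (hne : ∃ z w, U z ≠ U w)
    (hode : ∀ z, deriv (fun w => (γ - U w) * deriv U w) z + U z = 0)
    (hb : ∀ z, |U z| ≤ 1 / 100)
    (hI : ∀ z, (1 / 2) * (γ - U z) ^ 2 * (deriv U z) ^ 2 + (γ / 2) * (U z) ^ 2
      - (1 / 3) * (U z) ^ 3 = I) :
    IsWaveProfile (√γ) (γ ^ 3 - 6 * I) (fun x => γ - U x) (deriv U) (iteratedDeriv 2 U) ∧
      0 < γ ^ 3 - 6 * I ∧ γ ^ 3 - 6 * I < √γ ^ 6 ∧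
      (∀ x, (12 / 13) ^ 2 < (1 - 3 * iteratedDeriv 2 U x) / (√γ + deriv U x) ^ 2) ∧
      ∀ x, (1 - 3 * iteratedDeriv 2 U x) / (√γ + deriv U x) ^ 2 < (10 / 9) ^ 2 := by
  obtain ⟨hγ1, hγ2⟩ := hγ
  have hU1 : ∀ x, U x ≤ 1 / 100 := fun x => (abs_le.1 (hb x)).2
  have hU2 : ∀ x, -(1 / 100) ≤ U x := fun x => (abs_le.1 (hb x)).1
  have hdU : ∀ x, HasDerivAt U (deriv U x) x := fun x =>
    (hU.differentiable (by simp) x).hasDerivAt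
  have hdP : ∀ x, HasDerivAt (deriv U) (iteratedDeriv 2 U x) x := fun x => by
    rw [iteratedDeriv_succ, iteratedDeriv_one]
    have h1 : ContDiff ℝ (⊤ : ℕ∞) (deriv U) := (contDiff_infty_iff_deriv.1 hU).2
    exact (h1.differentiable (by simp) x).hasDerivAt
  have hgQ : ∀ x, (γ - U x) * iteratedDeriv 2 U x = deriv U x ^ 2 - U x := fun x => by
    have h1 := hode x
    have h2 : HasDerivAt (fun w => (γ - U w) * deriv U w)
        (-deriv U x * deriv U x + (γ - U x) * iteratedDeriv 2 U x) x :=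
      ((hdU x).const_sub γ).mul (hdP x)
    rw [h2.deriv] at h1
    linarith
  have hcoef : ∀ x, 1 / 3 ≤ γ / 2 - U x / 3 := fun x => by linarith [hU1 x]
  have hInonneg : ∀ x, U x ^ 2 * (1 / 3) ≤ I := fun x => by
    have h1 := mul_le_mul_of_nonneg_left (hcoef x) (sq_nonneg (U x))
    have h2 : 0 ≤ (1 / 2) * (γ - U x) ^ 2 * (deriv U x) ^ 2 := by positivity
    linarith [hI x]
  have hIpos : 0 < I := by
    obtain ⟨a, b, hab⟩ := hne
    by_contra! h0
    have h1 : ∀ x, U x = 0 := fun x => by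
      have := hInonneg x
      have := sq_nonneg (U x)
      exact pow_eq_zero_iff two_ne_zero |>.1 (by linarith)
    exact hab (by rw [h1, h1])
  have hP0 : deriv U 0 = 0 := by
    have h1 : HasDerivAt (fun x => U (-x)) (-deriv U 0) 0 := by
      have := (hdU (-0)).comp (0 : ℝ) (hasDerivAt_neg (0 : ℝ))
      simpa [Function.comp_def] using this
    rw [funext heven] at h1
    linarith [h1.unique (hdU 0)]
  have hIle : I ≤ 6 / 100000 := by
    have h1 := hI 0
    rw [hP0] at h1
    have h2 := hU1 0
    have h3 := hU2 0
    have h4 : U 0 ^ 2 ≤ 1 / 10000 := by nlinarith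
    have h5 : γ / 2 - U 0 / 3 ≤ 6 / 10 := by linarith
    nlinarith [mul_le_mul_of_nonneg_left h5 (sq_nonneg (U 0))]
  have hPsq : ∀ x, deriv U x ^ 2 ≤ 2 / 10000 := fun x => by
    have h1 := hI x
    have h2 := mul_le_mul_of_nonneg_left (hcoef x) (sq_nonneg (U x))
    have h3 : 98 / 100 ≤ (γ - U x) ^ 2 := by nlinarith [hU1 x]
    have h4 := mul_le_mul_of_nonneg_right h3 (sq_nonneg (deriv U x))
    nlinarith [sq_nonneg (U x)]
  have hP : ∀ x, |deriv U x| ≤ 2 / 100 := fun x =>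
    abs_le_of_sq_le_sq (by linarith [hPsq x]) (by norm_num)
  have hr2 : √γ ^ 2 = γ := Real.sq_sqrt (by linarith)
  have hr1 : 1 < √γ := Real.lt_sqrt_of_sq_lt (by linarith)
  have hr3 : √γ < 1 + 1 / 100 := by nlinarith
  have hs1 : ∀ x, 98 / 100 < √γ + deriv U x := fun x => by linarith [(abs_le.1 (hP x)).1]
  have hs2 : ∀ x, √γ + deriv U x < 103 / 100 := fun x => by linarith [(abs_le.1 (hP x)).2]
  have hQ1 : ∀ x, iteratedDeriv 2 U x ≤ 2 / 100 := fun x => by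
    have := hgQ x; have := hPsq x; have := hU1 x; have := hU2 x
    by_contra! hlt
    nlinarith
  have hQ2 : ∀ x, -(2 / 100) ≤ iteratedDeriv 2 U x := fun x => by
    have := hgQ x; have := sq_nonneg (deriv U x); have := hU1 x; have := hU2 x
    by_contra! hlt
    nlinarith
  have hκ : ∀ x, γ ^ 3 - 6 * I = (γ - U x) ^ 3 * (1 - 3 * iteratedDeriv 2 U x) := fun x => by
    rw [← hI x]
    linear_combination 3 * (γ - U x) ^ 2 * hgQ x
  refine ⟨⟨fun x => by linarith [hU1 x], fun x => by linarith [hs1 x],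
    fun x => (hdU x).const_sub γ, hdP, fun x => by rw [hr2, hgQ]; ring, hκ⟩, ?_, ?_, fun x => ?_,
    fun x => ?_⟩
  · rw [hκ 0]
    exact mul_pos (pow_pos (by linarith [hU1 0]) 3) (by linarith [hQ1 0])
  · rw [show √γ ^ 6 = (√γ ^ 2) ^ 3 by ring, hr2]
    linarith
  · have h1 := hs1 x; have h2 := hs2 x; have h3 := hQ1 x
    rw [lt_div_iff₀ (by positivity)]
    nlinarith
  · have h1 := hs1 x; have h2 := hs2 x; have h3 := hQ2 x
    rw [div_lt_iff₀ (by positivity)]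
    nlinarith

end

section

open Set

section SmoothModes

variable {L μ : ℝ} {ω v : ℝ → ℝ}

theorem eq_zero_of_hasDerivAt_of_periodic (hL : 0 < L) {f f1 f2 : ℝ → ℝ} {c : ℝ}
    (hf : ∀ x, HasDerivAt f (f1 x) x) (hf1 : ∀ x, HasDerivAt f1 (c * f2 x) x)
    (hf2 : ∀ x, f2 x ≠ 0) (hp : Function.Periodic f L) : c = 0 ∧ ∀ x, f x = f 0 := by
  have hc : c = 0 := by
    obtain ⟨x, -, hx⟩ := exists_hasDerivAt_eq_zero hL
      (continuous_of_hasDerivAt hf1).continuousOn (by simpa using (hp.of_hasDerivAt hf 0).symm)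
      fun x _ => hf1 x
    exact (mul_eq_zero.1 hx).resolve_right (hf2 x)
  have hconst : ∀ x y, f1 x = f1 y := is_const_of_deriv_eq_zero
    (fun x => (hf1 x).differentiableAt) fun x => by rw [(hf1 x).deriv, hc, zero_mul]
  obtain ⟨y, -, hy⟩ := exists_hasDerivAt_eq_zero hL
    (continuous_of_hasDerivAt hf).continuousOn (by simpa using (hp 0).symm) fun x _ => hf x
  refine ⟨hc, fun x => is_const_of_deriv_eq_zero (fun x => (hf x).differentiableAt)
    (fun x => ?_) x 0⟩
  rw [(hf x).deriv, hconst x y, hy]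

theorem contDiff_of_hasDerivAt_system {F F1 M M1 : ℝ → ℝ} (hω : ContDiff ℝ (⊤ : ℕ∞) ω)
    (hF : ∀ x, HasDerivAt F (F1 x) x) (hF1 : ∀ x, HasDerivAt F1 (μ * (ω x * M x)) x)
    (hM : ∀ x, HasDerivAt M (M1 x) x) (hM1 : ∀ x, HasDerivAt M1 (F x) x) :
    ContDiff ℝ (⊤ : ℕ∞) F := by
  have hstep : ∀ {f f' : ℝ → ℝ} {n : ℕ}, (∀ x, HasDerivAt f (f' x) x) → ContDiff ℝ n f' →
      ContDiff ℝ (n + 1 : ℕ) f := fun {f f' n} hf hf' => by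
    push_cast
    refine contDiff_succ_iff_deriv.2 ⟨fun x => (hf x).differentiableAt, by simp, ?_⟩
    rwa [show deriv f = f' from funext fun x => (hf x).deriv]
  have key : ∀ n : ℕ, ContDiff ℝ n F ∧ ContDiff ℝ n F1 ∧ ContDiff ℝ n M ∧ ContDiff ℝ n M1 :=
    fun n => by
    induction n with
    | zero =>
      simp only [Nat.cast_zero, contDiff_zero]
      exact ⟨continuous_of_hasDerivAt hF, continuous_of_hasDerivAt hF1,
        continuous_of_hasDerivAt hM, continuous_of_hasDerivAt hM1⟩
    | succ n ih =>
      obtain ⟨h1, h2, h3, h4⟩ := ih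
      have hωn : ContDiff ℝ n ω := hω.of_le (by exact_mod_cast le_top)
      exact ⟨hstep hF h2, hstep hF1 (contDiff_const.mul (hωn.mul h3)), hstep hM h4, hstep hM1 h1⟩
  exact contDiff_infty.2 fun n => (key n).1

theorem ContDiff.hasDerivAt_iteratedDeriv_two (hv : ContDiff ℝ (⊤ : ℕ∞) v) :
    (∀ x, HasDerivAt v (deriv v x) x) ∧
      (∀ x, HasDerivAt (deriv v) (iteratedDeriv 2 v x) x) ∧
      ContDiff ℝ (⊤ : ℕ∞) (iteratedDeriv 2 v) := by
  have h1 : ContDiff ℝ (⊤ : ℕ∞) (deriv v) := (contDiff_infty_iff_deriv.1 hv).2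
  rw [iteratedDeriv_succ, iteratedDeriv_one]
  exact ⟨fun x => (hv.differentiable (by simp) x).hasDerivAt,
    fun x => (h1.differentiable (by simp) x).hasDerivAt, (contDiff_infty_iff_deriv.1 h1).2⟩

theorem iteratedDeriv_two_eq {f f1 f2 : ℝ → ℝ} (hf : ∀ x, HasDerivAt f (f1 x) x)
    (hf1 : ∀ x, HasDerivAt f1 (f2 x) x) : iteratedDeriv 2 f = f2 := by
  rw [iteratedDeriv_succ, iteratedDeriv_one, show deriv f = f1 from funext fun x => (hf x).deriv]
  exact funext fun x => (hf1 x).deriv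

/-- For `μ ≠ 0` the modes are the smooth periodic zero-mean solutions of `(ω⁻¹ v'')'' = μ v`. -/
theorem mem_weightedModes_iff (hω : ContDiff ℝ (⊤ : ℕ∞) ω) (hω0 : ∀ x, ω x ≠ 0)
    (hωp : Function.Periodic ω L) (hμ : μ ≠ 0) :
    v ∈ weightedModes L ω μ ↔ ContDiff ℝ (⊤ : ℕ∞) v ∧ Function.Periodic v L ∧
      (∫ z in (0 : ℝ)..L, v z) = 0 ∧
      ∀ z, iteratedDeriv 2 (fun w => (ω w)⁻¹ * iteratedDeriv 2 v w) z = μ * v z := by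
  constructor
  · rintro ⟨F1, M, M1, hF, hF1, hM, hM1, hFp, hMp⟩
    have hv := contDiff_of_hasDerivAt_system hω hF hF1 hM hM1
    refine ⟨hv, hFp, ?_, fun z => ?_⟩
    · rw [intervalIntegral.integral_eq_sub_of_hasDerivAt (fun x _ => hM1 x)
        (hv.continuous.intervalIntegrable _ _)]
      have := hMp.of_hasDerivAt hM 0
      rw [zero_add] at this
      rw [this, sub_self]
    · have h1 : (fun w => (ω w)⁻¹ * iteratedDeriv 2 v w) = fun w => μ * M w := funext fun w => by
        have := hω0 w
        rw [iteratedDeriv_two_eq hF hF1]; field_simp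
      rw [h1, iteratedDeriv_two_eq (fun x => (hM x).const_mul μ) fun x => (hM1 x).const_mul μ]
  · rintro ⟨hv, hp, -, heq⟩
    obtain ⟨h1, h2, h3⟩ := hv.hasDerivAt_iteratedDeriv_two
    have hw : ContDiff ℝ (⊤ : ℕ∞) fun w => (ω w)⁻¹ * iteratedDeriv 2 v w := (hω.inv hω0).mul h3
    obtain ⟨h4, h5, -⟩ := hw.hasDerivAt_iteratedDeriv_two
    refine ⟨deriv v, fun x => μ⁻¹ * ((ω x)⁻¹ * iteratedDeriv 2 v x), _, h1,
      fun x => (h2 x).congr_deriv ?_, fun x => (h4 x).const_mul _,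
      fun x => ((h5 x).const_mul _).congr_deriv ?_, hp, fun x => ?_⟩
    · have := hω0 x
      field_simp
    · rw [heq]; field_simp
    · have := (hp.of_hasDerivAt h1).of_hasDerivAt h2
      simp only [hωp x, this x]

theorem eq_zero_of_iteratedDeriv_two_eq_zero (hL : 0 < L) (hω : ContDiff ℝ (⊤ : ℕ∞) ω)
    (hω0 : ∀ x, ω x ≠ 0) (hωp : Function.Periodic ω L) (hv : ContDiff ℝ (⊤ : ℕ∞) v)
    (hp : Function.Periodic v L) (hint : (∫ z in (0 : ℝ)..L, v z) = 0)
    (heq : ∀ z, iteratedDeriv 2 (fun w => (ω w)⁻¹ * iteratedDeriv 2 v w) z = 0) : v = 0 := by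
  obtain ⟨h1, h2, h3⟩ := hv.hasDerivAt_iteratedDeriv_two
  have hw : ContDiff ℝ (⊤ : ℕ∞) fun w => (ω w)⁻¹ * iteratedDeriv 2 v w := (hω.inv hω0).mul h3
  obtain ⟨h4, h5, -⟩ := hw.hasDerivAt_iteratedDeriv_two
  have hwp : Function.Periodic (fun w => (ω w)⁻¹ * iteratedDeriv 2 v w) L := fun x => by
    have := (hp.of_hasDerivAt h1).of_hasDerivAt h2
    simp only [hωp x, this x]
  obtain ⟨-, hconst⟩ := eq_zero_of_hasDerivAt_of_periodic (f2 := fun _ => 1) (c := 0) hL h4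
    (fun x => (h5 x).congr_deriv (by rw [heq]; ring)) (by simp) hwp
  obtain ⟨-, hv0⟩ := eq_zero_of_hasDerivAt_of_periodic (c := (ω 0)⁻¹ * iteratedDeriv 2 v 0) hL h1
    (fun x => (h2 x).congr_deriv (by
      have := hω0 x
      rw [← hconst x]; field_simp)) hω0 hp
  rw [intervalIntegral.integral_congr fun x _ => hv0 x, intervalIntegral.integral_const,
    sub_zero, smul_eq_mul] at hint
  exact funext fun x => by rw [hv0, (mul_eq_zero.1 hint).resolve_left hL.ne']; rfl

end SmoothModes

end

theorem mem_EigSetM_iff {U g : ℝ → ℝ} {γ I lam : ℝ} {N : ℕ} {v : ℝ → ℝ}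
    (hκ : 0 < γ ^ 3 - 6 * I) (hg : ∀ x, 0 < g x)
    (hgκ : ∀ x, γ ^ 3 - 6 * I = g x ^ 3 * (1 - 3 * iteratedDeriv 2 U x)) :
    v ∈ EigSetM U γ I lam N ↔ ContDiff ℝ (⊤ : ℕ∞) v ∧ Function.Periodic v (2 * π * N) ∧
      (∫ z in (0 : ℝ)..(2 * π * N), v z) = 0 ∧
      ∀ z, iteratedDeriv 2 (fun w => (1 / g w ^ 5)⁻¹ * iteratedDeriv 2 v w) z =
        ((γ ^ 3 - 6 * I) - (γ ^ 3 - 6 * I) ^ ((5 : ℝ) / 3) * lam) * v z := by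
  set κ := γ ^ 3 - 6 * I with hκdef
  have hβ : 0 < κ ^ ((5 : ℝ) / 3) := rpow_pos_of_pos hκ _
  have h1 : ∀ x, (1 - 3 * iteratedDeriv 2 U x) ^ (-(5 : ℝ) / 3) =
      (κ ^ ((5 : ℝ) / 3))⁻¹ * (1 / g x ^ 5)⁻¹ := fun x => by
    have hgx := hg x
    rw [show 1 - 3 * iteratedDeriv 2 U x = κ / g x ^ 3 by rw [hgκ x]; field_simp,
      div_rpow hκ.le (by positivity), neg_div, rpow_neg hκ.le, ← rpow_natCast (g x) 3,
      ← rpow_mul hgx.le, one_div, inv_inv, ← rpow_natCast (g x) 5, div_eq_mul_inv,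
      ← rpow_neg hgx.le]
    norm_num
  have h2 : κ ^ (-(2 : ℝ) / 3) = κ * (κ ^ ((5 : ℝ) / 3))⁻¹ := by
    rw [← rpow_neg hκ.le, mul_comm, ← rpow_add_one hκ.ne']
    norm_num
  refine and_congr_right fun _ => and_congr_right fun _ => and_congr_right fun _ =>
    forall_congr' fun z => ?_
  rw [← hκdef, h2]
  simp only [h1, mul_assoc]
  rw [iteratedDeriv_const_mul_field]
  generalize iteratedDeriv 2 (fun w => (1 / g w ^ 5)⁻¹ * iteratedDeriv 2 v w) z = d
  constructor <;> intro h
  · field_simp at h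
    linarith
  · rw [h]
    field_simp
    ring

theorem EigSetM_eq_weightedModes {U g : ℝ → ℝ} {γ I lam : ℝ} {N : ℕ} (hN : 0 < N)
    (hκ : 0 < γ ^ 3 - 6 * I) (hg : ∀ x, 0 < g x) (hgs : ContDiff ℝ (⊤ : ℕ∞) g)
    (hgp : Function.Periodic g (2 * π))
    (hgκ : ∀ x, γ ^ 3 - 6 * I = g x ^ 3 * (1 - 3 * iteratedDeriv 2 U x))
    (hbot : ∀ μ < 0, weightedModes (2 * π * N) (fun x => 1 / g x ^ 5) μ = ⊥) :
    ((γ ^ 3 - 6 * I) - (γ ^ 3 - 6 * I) ^ ((5 : ℝ) / 3) * lam ≤ 0 → EigSetM U γ I lam N = {0}) ∧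
    ((γ ^ 3 - 6 * I) - (γ ^ 3 - 6 * I) ^ ((5 : ℝ) / 3) * lam ≠ 0 → EigSetM U γ I lam N =
      weightedModes (2 * π * N) (fun x => 1 / g x ^ 5)
        ((γ ^ 3 - 6 * I) - (γ ^ 3 - 6 * I) ^ ((5 : ℝ) / 3) * lam)) := by
  have hL : 0 < 2 * π * N := by positivity
  have hω : ContDiff ℝ (⊤ : ℕ∞) fun x => 1 / g x ^ 5 :=
    contDiff_const.div (hgs.pow 5) fun x => pow_ne_zero 5 (hg x).ne'
  have hω0 : ∀ x, 1 / g x ^ 5 ≠ 0 := fun x => by have := hg x; positivity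
  have hωp : Function.Periodic (fun x => 1 / g x ^ 5) (2 * π * N) := fun x => by
    have : g (x + 2 * π * N) = g x := by rw [mul_comm]; exact hgp.nat_mul N x
    simp only [this]
  have hmodes : (γ ^ 3 - 6 * I) - (γ ^ 3 - 6 * I) ^ ((5 : ℝ) / 3) * lam ≠ 0 →
      EigSetM U γ I lam N = weightedModes (2 * π * N) (fun x => 1 / g x ^ 5)
        ((γ ^ 3 - 6 * I) - (γ ^ 3 - 6 * I) ^ ((5 : ℝ) / 3) * lam) := fun hμ =>
    Set.ext fun v => (mem_EigSetM_iff hκ hg hgκ).trans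
      (mem_weightedModes_iff hω hω0 hωp hμ).symm
  refine ⟨fun hle => ?_, hmodes⟩
  rcases hle.lt_or_eq with hlt | heq
  · rw [hmodes hlt.ne, hbot _ hlt, Submodule.bot_coe]
  · ext v
    rw [mem_EigSetM_iff hκ hg hgκ, heq, Set.mem_singleton_iff]
    constructor
    · rintro ⟨hv, hp, hint, h⟩
      exact eq_zero_of_iteratedDeriv_two_eq_zero hL hω hω0 hωp hv hp hint fun z => by
        rw [h z, zero_mul]
    · rintro rfl
      refine ⟨contDiff_const, fun x => rfl, by simp, fun z => ?_⟩
      have h0 : iteratedDeriv 2 (0 : ℝ → ℝ) = 0 := by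
        rw [iteratedDeriv_two_eq (f1 := 0) (f2 := 0)] <;> exact fun x => hasDerivAt_const x 0
      have h1 : (fun w => (1 / g w ^ 5)⁻¹ * iteratedDeriv 2 (0 : ℝ → ℝ) w) = 0 := by
        rw [h0]; exact funext fun w => mul_zero _
      rw [h1, h0]; simp

theorem IsWaveProfile.mem_weightedModes {r κ : ℝ} {g P Q : ℝ → ℝ} (h : IsWaveProfile r κ g P Q)
    {L : ℝ} (hp : Function.Periodic g L) : P ∈ weightedModes L (fun x => 1 / g x ^ 5) κ := by
  refine ⟨Q, fun x => -(g x * P x), fun x => r ^ 2 - g x, h.hasDerivAt_P,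
    fun x => (h.hasDerivAt_Q x).congr_deriv ?_, fun x => ?_,
    fun x => ((h.hasDerivAt_g x).const_sub (r ^ 2)).congr_deriv (neg_neg _), h.periodic_P hp,
    fun x => by simp only [hp x, h.periodic_P hp x]⟩
  · have := (h.g_pos x).ne'
    field_simp
  · refine ((h.hasDerivAt_g x).mul (h.hasDerivAt_P x)).neg.congr_deriv ?_
    rw [h.g_mul_Q x]; ring

theorem spectrum_M_reduced_ostrovsky :
    ∃ ε > (0:ℝ), ∀ N : ℕ, 1 ≤ N → ∀ γ ∈ Set.Ioo (1:ℝ) (1 + ε), ∀ U : ℝ → ℝ,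
      (∀ z : ℝ, U (-z) = U z) → ContDiff ℝ (⊤ : ℕ∞) U → (∃ z w : ℝ, U z ≠ U w) →
      Function.Periodic U (2 * π) →
      (∀ z : ℝ, deriv (fun w => (γ - U w) * deriv U w) z + U z = 0) →
      (∀ z : ℝ, |U z| ≤ ε) →
      (∀ z : ℝ, 0 < 1 - 3 * iteratedDeriv 2 U z) →
      ∀ I : ℝ,
      (∀ z : ℝ,
        (1/2) * (γ - U z) ^ 2 * (deriv U z) ^ 2
          + (γ / 2) * (U z) ^ 2 - (1/3) * (U z) ^ 3 = I) →
      (∃ hfin : Set.Finite {lam : ℝ | 0 < lam ∧ ∃ v ∈ EigSetM U γ I lam N, v ≠ 0},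
        (∑ lam ∈ hfin.toFinset,
          Module.finrank ℝ (Submodule.span ℝ (EigSetM U γ I lam N))) = 2 * N - 2) ∧
      (EigSetM U γ I 0 N = {v | ∃ c : ℝ, v = fun z => c * deriv U z} ∧ deriv U ≠ 0) ∧
      {lam : ℝ | lam < 0 ∧ ∃ v ∈ EigSetM U γ I lam N, v ≠ 0}.Infinite := by
  refine ⟨1 / 100, by norm_num, fun N hN γ hγ U heven hU hne hUp hode hb _ I hI => ?_⟩
  obtain ⟨h, hκ, hκr, hq, hq'⟩ := isWaveProfile_of_ostrovsky hγ heven hU hne hode hb hI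
  have hgp : Function.Periodic (fun x => γ - U x) (2 * π) := fun x => by simp only [hUp x]
  obtain ⟨S, hSω, hSκ, hSn, hSL, hSm⟩ := h.exists_hillFactorization
    (sqrt_pos.2 (by linarith [hγ.1])) hκ hκr hgp hq hq' hN
  have hV : weightedModes (S.z S.n - S.z 0) S.ω =
      weightedModes (2 * π * N) fun x => 1 / (γ - U x) ^ 5 := by rw [hSL, hSω]
  have hcount := S.weightedModes_count
  have hκle := S.weightedModes_κ_le
  rw [hV, hSκ, hSn] at hcount
  rw [hV, hSκ, hSm] at hκle
  obtain ⟨hbot, ⟨hfin, hsum⟩, hinf⟩ := hcount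
  have hE := fun lam => EigSetM_eq_weightedModes (U := U) (lam := lam) hN hκ h.g_pos
    (contDiff_const.sub hU) hgp h.κ_eq hbot
  have hPmem := h.mem_weightedModes (hgp.nat_mul N)
  rw [mul_comm (N : ℝ)] at hPmem
  generalize weightedModes (2 * π * N) (fun x => 1 / (γ - U x) ^ 5) = V at *
  set κ := γ ^ 3 - 6 * I with hκdef
  have hβ : 0 < κ ^ ((5 : ℝ) / 3) := rpow_pos_of_pos hκ _
  set β := κ ^ ((5 : ℝ) / 3) with hβdef
  have hinv : ∀ μ, κ - β * ((κ - μ) / β) = μ := fun μ => by field_simp; ring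
  have hinv' : ∀ lam, (κ - (κ - β * lam)) / β = lam := fun lam => by field_simp; ring
  have hnebot : ∀ W : Submodule ℝ (ℝ → ℝ), (∃ v ∈ (W : Set (ℝ → ℝ)), v ≠ 0) ↔ W ≠ ⊥ :=
    fun W => W.ne_bot_iff.symm
  have hset : {lam : ℝ | 0 < lam ∧ ∃ v ∈ EigSetM U γ I lam N, v ≠ 0} =
      (fun μ => (κ - μ) / β) '' {μ | 0 < μ ∧ μ < κ ∧ V μ ≠ ⊥} := by
    ext lam
    constructor
    · rintro ⟨hlam, hv⟩
      rcases le_or_gt (κ - β * lam) 0 with hle | hlt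
      · rw [(hE lam).1 hle] at hv
        obtain ⟨v, rfl, hv⟩ := hv
        exact (hv rfl).elim
      · rw [(hE lam).2 hlt.ne', hnebot] at hv
        exact ⟨κ - β * lam, ⟨hlt, by linarith [mul_pos hβ hlam], hv⟩, hinv' lam⟩
    · rintro ⟨μ, ⟨h0, hlt, hV⟩, rfl⟩
      refine ⟨div_pos (sub_pos.2 hlt) hβ, ?_⟩
      rw [(hE _).2 (by rw [hinv]; exact h0.ne'), hinv, hnebot]
      exact hV
  refine ⟨⟨hset ▸ hfin.image _, ?_⟩, ⟨?_, ?_⟩, ?_⟩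
  · rw [← hsum]
    symm
    refine Finset.sum_bij (fun μ _ => (κ - μ) / β) (fun μ hμ => ?_) (fun μ _ ν _ hμν => ?_)
      (fun lam hlam => ?_) fun μ hμ => ?_
    · rw [Set.Finite.mem_toFinset] at hμ ⊢
      rw [hset]
      exact ⟨μ, hμ, rfl⟩
    · rw [← hinv μ, ← hinv ν]
      exact congrArg (fun t => κ - β * t) hμν
    · rw [Set.Finite.mem_toFinset, hset] at hlam
      obtain ⟨μ, hμ, rfl⟩ := hlam
      exact ⟨μ, (Set.Finite.mem_toFinset _).2 hμ, rfl⟩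
    · rw [Set.Finite.mem_toFinset] at hμ
      rw [(hE _).2 (by rw [hinv]; exact hμ.1.ne'), hinv, Submodule.span_eq]
  · have h0 := (hE 0).2 (by rw [mul_zero, sub_zero]; exact hκ.ne')
    rw [mul_zero, sub_zero] at h0
    rw [h0]
    ext v
    constructor
    · intro hv
      obtain ⟨c, rfl⟩ := Submodule.mem_span_singleton.1 (hκle hv)
      exact ⟨-c, funext fun x => by simp⟩
    · rintro ⟨c, rfl⟩
      exact (V κ).smul_mem c hPmem
  · intro h0
    obtain ⟨a, b, hab⟩ := hne
    exact hab (is_const_of_deriv_eq_zero (hU.differentiable (by simp))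
      (fun x => congrFun h0 x) a b)
  · refine (hinf.image (f := fun μ => (κ - μ) / β) fun μ _ ν _ hμν => ?_).mono ?_
    · rw [← hinv μ, ← hinv ν]
      exact congrArg (fun t => κ - β * t) hμν
    · rintro _ ⟨μ, ⟨hlt, hV⟩, rfl⟩
      refine ⟨div_neg_of_neg_of_pos (sub_neg.2 hlt) hβ, ?_⟩
      rw [(hE _).2 (by rw [hinv]; exact (hκ.trans hlt).ne'), hinv, hnebot]
      exact hV
end

section
/- Let c ∈ ℝ. The following are equivalent: (i) c = 1/2; (ii) for every integer N ≥ 1 and every smooth 2πN-periodic function v : ℝ → ℝ with ∫₀^{2πN} v = 0, letting w denote the zero-mean primitive of v, one has ∫₀^{2πN} [ w(z)² − (1 + c)·v(z)² + c·v''(z)² ] dz ≥ 0. -/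
open Real

/-- The zero-mean primitive of a zero-mean `L`-periodic function:
the primitive `z ↦ ∫₀^z v`, shifted so that its mean over `[0, L]` is zero. -/
noncomputable def zeroMeanPrimitive (L : ℝ) (v : ℝ → ℝ) : ℝ → ℝ :=
  fun z => (∫ t in (0:ℝ)..z, v t) - (1 / L) * ∫ t in (0:ℝ)..L, (∫ s in (0:ℝ)..t, v s)

theorem zeroMeanPrimitive_hasDerivAt (L : ℝ) {v : ℝ → ℝ} (hv : Continuous v) (z : ℝ) :
    HasDerivAt (zeroMeanPrimitive L v) (v z) z :=
  (hv.integral_hasStrictDerivAt 0 z).hasDerivAt.sub_const _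

theorem zeroMeanPrimitive_endpoints {L : ℝ} {v : ℝ → ℝ} (h : ∫ z in (0:ℝ)..L, v z = 0) :
    zeroMeanPrimitive L v L = zeroMeanPrimitive L v 0 := by
  simp [zeroMeanPrimitive, h]

/-- At `c = 1/2` the quadratic form is a sum of squares up to an exact derivative. -/
theorem integral_secondVariation_half {L : ℝ} {v : ℝ → ℝ} (hv : ContDiff ℝ (⊤ : ℕ∞) v)
    (hper : Function.Periodic v L) (hmean : ∫ z in (0:ℝ)..L, v z = 0) :
    ∫ z in (0:ℝ)..L, ((zeroMeanPrimitive L v z) ^ 2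
        - (1 + 1 / 2) * (v z) ^ 2 + 1 / 2 * (iteratedDeriv 2 v z) ^ 2) =
      ∫ z in (0:ℝ)..L, ((zeroMeanPrimitive L v z + deriv v z) ^ 2
        + 1 / 2 * (v z + iteratedDeriv 2 v z) ^ 2) := by
  have hw := zeroMeanPrimitive_hasDerivAt L hv.continuous
  have hend := zeroMeanPrimitive_endpoints hmean
  set w := zeroMeanPrimitive L v
  have hwc : Continuous w := continuous_iff_continuousAt.2 fun z => (hw z).continuousAt
  have hvc : Continuous v := hv.continuous
  have hv' (z : ℝ) : HasDerivAt v (deriv v z) z :=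
    (hv.differentiable (by simp) z).hasDerivAt
  have hv1 : ContDiff ℝ (⊤ : ℕ∞) (deriv v) := hv.iterate_deriv 1
  have hv1c : Continuous (deriv v) := hv1.continuous
  have hv2 : iteratedDeriv 2 v = deriv (deriv v) := by
    simp [iteratedDeriv_succ, iteratedDeriv_zero]
  have hv2c : Continuous (deriv (deriv v)) := (hv.iterate_deriv 2).continuous
  have hv'' (z : ℝ) : HasDerivAt (deriv v) (deriv (deriv v) z) z :=
    (hv1.differentiable (by simp) z).hasDerivAt
  have hvL : v L = v 0 := by simpa using hper 0
  have hv1L : deriv v L = deriv v 0 := by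
    have h := deriv_comp_add_const v L 0
    rw [show (fun x => v (x + L)) = v from funext hper, zero_add] at h
    exact h.symm
  rw [hv2, ← sub_eq_zero, ← intervalIntegral.integral_sub
    (Continuous.intervalIntegrable (by fun_prop) _ _)
    (Continuous.intervalIntegrable (by fun_prop) _ _)]
  rw [intervalIntegral.integral_eq_sub_of_hasDerivAt
    (f := fun z => -(2 * (w z * v z) + v z * deriv v z))]
  · simp only [hend, hvL, hv1L, sub_self]
  · intro z _
    refine ((((hw z).mul (hv' z)).const_mul 2).add ((hv' z).mul (hv'' z))).neg.congr_deriv ?_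
    ring
  · exact Continuous.intervalIntegrable (by fun_prop) _ _

theorem zeroMeanPrimitive_cos {κ L : ℝ} (hκ : κ ≠ 0) (hcos : cos (κ * L) = 1) (z : ℝ) :
    zeroMeanPrimitive L (fun x => cos (κ * x)) z = sin (κ * z) / κ := by
  have hprim (t : ℝ) : ∫ s in (0:ℝ)..t, cos (κ * s) = sin (κ * t) / κ := by
    rw [intervalIntegral.integral_comp_mul_left cos hκ, integral_cos]
    simp [div_eq_inv_mul]
  have hmean : ∫ t in (0:ℝ)..L, sin (κ * t) / κ = 0 := by
    rw [intervalIntegral.integral_div, intervalIntegral.integral_comp_mul_left sin hκ,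
      integral_sin]
    simp [hcos]
  simp [zeroMeanPrimitive, hprim, hmean]

theorem iteratedDeriv_two_cos_mul (κ z : ℝ) :
    iteratedDeriv 2 (fun x => cos (κ * x)) z = -κ ^ 2 * cos (κ * z) := by
  have h1 (x : ℝ) : HasDerivAt (fun x => cos (κ * x)) (-κ * sin (κ * x)) x := by
    refine ((hasDerivAt_id x).const_mul κ).cos.congr_deriv ?_
    simp only [id]; ring
  have h2 : HasDerivAt (fun x => -κ * sin (κ * x)) (-κ ^ 2 * cos (κ * z)) z := by
    refine (((hasDerivAt_id z).const_mul κ).sin.const_mul (-κ)).congr_deriv ?_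
    simp only [id]; ring
  rw [iteratedDeriv_succ, iteratedDeriv_one, funext fun x => (h1 x).deriv]
  exact h2.deriv

theorem integral_sin_sq_add_cos_sq {κ L : ℝ} (hκ : κ ≠ 0) (hsin : sin (κ * L) = 0) (a b : ℝ) :
    ∫ z in (0:ℝ)..L, (a * sin (κ * z) ^ 2 + b * cos (κ * z) ^ 2) = (a + b) / 2 * L := by
  rw [intervalIntegral.integral_eq_sub_of_hasDerivAt
    (f := fun z => (a + b) / 2 * z + (b - a) / (2 * κ) * (sin (κ * z) * cos (κ * z)))]
  · simp [hsin]
  · intro z _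
    have hlin := (hasDerivAt_id z).const_mul κ
    refine (((hasDerivAt_id z).const_mul ((a + b) / 2)).add
      ((hlin.sin.mul hlin.cos).const_mul ((b - a) / (2 * κ)))).congr_deriv ?_
    simp only [id]
    field_simp
    linear_combination (-(a + b)) * sin_sq_add_cos_sq (κ * z)
  · exact Continuous.intervalIntegrable (by fun_prop) _ _

theorem integral_secondVariation_cos (c : ℝ) {κ L : ℝ} (hκ : κ ≠ 0) (hcos : cos (κ * L) = 1) :
    ∫ z in (0:ℝ)..L, ((zeroMeanPrimitive L (fun x => cos (κ * x)) z) ^ 2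
        - (1 + c) * cos (κ * z) ^ 2 + c * (iteratedDeriv 2 (fun x => cos (κ * x)) z) ^ 2) =
      (κ ^ 2 - 1) * (c * κ ^ 4 + c * κ ^ 2 - 1) * (L / (2 * κ ^ 2)) := by
  have hsin : sin (κ * L) = 0 := by
    have := sin_sq_add_cos_sq (κ * L)
    rw [hcos] at this
    exact pow_eq_zero_iff two_ne_zero |>.1 (by linarith)
  have hint (z : ℝ) : (sin (κ * z) / κ) ^ 2 - (1 + c) * cos (κ * z) ^ 2
      + c * (-κ ^ 2 * cos (κ * z)) ^ 2 =
      1 / κ ^ 2 * sin (κ * z) ^ 2 + (c * κ ^ 4 - (1 + c)) * cos (κ * z) ^ 2 := by ring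
  simp only [zeroMeanPrimitive_cos hκ hcos, iteratedDeriv_two_cos_mul, hint,
    integral_sin_sq_add_cos_sq hκ hsin]
  field_simp
  ring

/-- A polynomial inequality, valid at every positive rational, that forces `c = 1/2`. -/
theorem eq_half_of_forall_rat {c : ℝ}
    (h : ∀ q : ℚ, 0 < q → 0 ≤ ((q:ℝ) ^ 2 - 1) * (c * (q:ℝ) ^ 4 + c * (q:ℝ) ^ 2 - 1)) :
    c = 1 / 2 := by
  have hcont : Continuous fun x : ℝ => c * x ^ 4 + c * x ^ 2 - 1 := by fun_prop
  rcases lt_trichotomy c (1 / 2) with hc | hc | hc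
  · exfalso
    obtain ⟨ε, hε, hball⟩ := Metric.isOpen_iff.1 (isOpen_lt hcont continuous_const) 1
      (show c * 1 ^ 4 + c * 1 ^ 2 - 1 < (0:ℝ) by linarith)
    obtain ⟨q, hq1, hq2⟩ := exists_rat_btwn (show (1:ℝ) < 1 + ε by linarith)
    have hq : c * (q:ℝ) ^ 4 + c * (q:ℝ) ^ 2 - 1 < 0 :=
      hball (by rw [Metric.mem_ball, Real.dist_eq, abs_lt]; constructor <;> linarith)
    have := h q (by exact_mod_cast (by linarith : (0:ℝ) < q))
    exact absurd this (not_le.2 (mul_neg_of_pos_of_neg (by nlinarith) hq))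
  · exact hc
  · exfalso
    obtain ⟨ε, hε, hball⟩ := Metric.isOpen_iff.1 (isOpen_lt continuous_const hcont) 1
      (show (0:ℝ) < c * 1 ^ 4 + c * 1 ^ 2 - 1 by linarith)
    obtain ⟨q, hq1, hq2⟩ := exists_rat_btwn (show max 0 (1 - ε) < (1:ℝ) by simp [hε])
    obtain ⟨hq0, hqε⟩ := max_lt_iff.1 hq1
    have hq : 0 < c * (q:ℝ) ^ 4 + c * (q:ℝ) ^ 2 - 1 :=
      hball (by rw [Metric.mem_ball, Real.dist_eq, abs_lt]; constructor <;> linarith)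
    have := h q (by exact_mod_cast hq0)
    exact absurd this (not_le.2 (mul_neg_of_neg_of_pos (by nlinarith) hq))

theorem positivity_second_variation_zero_reduced_ostrovsky (c : ℝ) :
    c = 1/2 ↔
    ∀ N : ℕ, 1 ≤ N → ∀ v : ℝ → ℝ, ContDiff ℝ (⊤ : ℕ∞) v →
      Function.Periodic v (2 * π * N) →
      (∫ z in (0:ℝ)..(2 * π * N), v z) = 0 →
      0 ≤ ∫ z in (0:ℝ)..(2 * π * N),
        ((zeroMeanPrimitive (2 * π * N) v z) ^ 2
          - (1 + c) * (v z) ^ 2 + c * (iteratedDeriv 2 v z) ^ 2) := by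
  constructor
  · rintro rfl N - v hv hper hmean
    rw [integral_secondVariation_half hv hper hmean]
    exact intervalIntegral.integral_nonneg (by positivity) fun z _ => by positivity
  · intro h
    refine eq_half_of_forall_rat fun q hq => ?_
    have hκ : (0:ℝ) < q := by exact_mod_cast hq
    have hL : 0 < 2 * π * (q.den : ℝ) := by have := q.den_pos; positivity
    have hκL : (q:ℝ) * (2 * π * q.den) = q.num * (2 * π) := by
      have : (q:ℝ) * q.den = q.num := by exact_mod_cast q.mul_den_eq_num
      linear_combination 2 * π * this
    have hcos : cos ((q:ℝ) * (2 * π * q.den)) = 1 := by rw [hκL, cos_int_mul_two_pi]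
    have hper : Function.Periodic (fun x => cos ((q:ℝ) * x)) (2 * π * q.den) := fun x => by
      simp only [mul_add, hκL, cos_add_int_mul_two_pi]
    have hmean : ∫ z in (0:ℝ)..(2 * π * q.den), cos ((q:ℝ) * z) = 0 := by
      have hsin : sin ((q:ℝ) * (2 * π * q.den)) = 0 := by
        rw [hκL, ← zero_add ((q.num:ℝ) * (2 * π)), sin_add_int_mul_two_pi, sin_zero]
      rw [intervalIntegral.integral_comp_mul_left cos hκ.ne', integral_cos]
      simp [hsin]
    have hpos := h q.den q.den_pos _ (by fun_prop) hper hmean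
    rw [integral_secondVariation_cos c hκ.ne' hcos] at hpos
    exact nonneg_of_mul_nonneg_left hpos (by positivity)
end

section
/- Let γ ∈ ℝ, δ > 0, and let u : ℝ → ℝ be a C² function satisfying u''(ζ) + (γ − u(ζ))·u(ζ) = 0 and u(ζ) ≤ γ − δ for all ζ ∈ ℝ. Define z : ℝ → ℝ by z(ζ) = ∫₀^ζ (γ − u(s)) ds. Then z is a strictly increasing C³ bijection of ℝ onto ℝ, and the function U := u ∘ z⁻¹ is C² and satisfies ((γ − U(z))·U'(z))' + U(z) = 0 for all z ∈ ℝ. -/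
open Real

/-- A function on `ℝ` whose derivative is bounded below by a positive constant is surjective. -/
theorem surjective_of_hasDerivAt_ge {f f' : ℝ → ℝ} {δ : ℝ} (hδ : 0 < δ)
    (hf : ∀ x, HasDerivAt f (f' x) x) (hf' : ∀ x, δ ≤ f' x) : Function.Surjective f := by
  have hg : ∀ x, HasDerivAt (fun x => f x - δ * x) (f' x - δ) x := fun x => by
    exact (hf x).fun_sub (by simpa using (hasDerivAt_id x).const_mul δ)
  have hmono : Monotone fun x => f x - δ * x :=
    monotone_of_deriv_nonneg (fun x => (hg x).differentiableAt) fun x => by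
      rw [(hg x).deriv]
      exact sub_nonneg.2 (hf' x)
  have hcont : Continuous f := continuous_iff_continuousAt.2 fun x => (hf x).continuousAt
  refine hcont.surjective ?_ ?_
  · refine Filter.tendsto_atTop_mono' _ ?_ (Filter.tendsto_atTop_add_const_right _ (f 0)
      (Filter.tendsto_id.const_mul_atTop hδ))
    filter_upwards [Filter.eventually_ge_atTop 0] with x hx
    have := hmono hx
    simp only [id] at this ⊢
    linarith
  · refine Filter.tendsto_atBot_mono' _ ?_ (Filter.tendsto_atBot_add_const_right _ (f 0)
      (Filter.tendsto_id.const_mul_atBot hδ))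
    filter_upwards [Filter.eventually_le_atBot 0] with x hx
    have := hmono hx
    simp only [id] at this ⊢
    linarith

theorem hodograph_transformation_reduced_ostrovsky
    (γ δ : ℝ) (hδ : 0 < δ) (u : ℝ → ℝ) (hu : ContDiff ℝ 2 u)
    (hODE : ∀ ζ : ℝ, iteratedDeriv 2 u ζ + (γ - u ζ) * u ζ = 0)
    (hbd : ∀ ζ : ℝ, u ζ ≤ γ - δ) :
    ∀ z : ℝ → ℝ, (∀ ζ : ℝ, z ζ = ∫ s in (0:ℝ)..ζ, (γ - u s)) →
      StrictMono z ∧ ContDiff ℝ 3 z ∧ Function.Bijective z ∧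
      ContDiff ℝ 2 (u ∘ Function.invFun z) ∧
      (∀ w : ℝ,
        deriv (fun y => (γ - (u ∘ Function.invFun z) y)
            * deriv (u ∘ Function.invFun z) y) w
          + (u ∘ Function.invFun z) w = 0) := by
  intro z hz
  have hpos : ∀ ζ, 0 < γ - u ζ := fun ζ => by linarith [hbd ζ]
  have hne : ∀ ζ, γ - u ζ ≠ 0 := fun ζ => (hpos ζ).ne'
  have hspeed : ContDiff ℝ 2 fun ζ => γ - u ζ := contDiff_const.sub hu
  have hderiv : ∀ ζ, HasDerivAt z (γ - u ζ) ζ := fun ζ => by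
    rw [funext hz]
    exact hspeed.continuous.integral_hasStrictDerivAt 0 ζ |>.hasDerivAt
  have hmono : StrictMono z := strictMono_of_deriv_pos fun ζ => by
    rw [(hderiv ζ).deriv]
    exact hpos ζ
  have hsmooth : ContDiff ℝ 3 z := by
    rw [show (3 : WithTop ℕ∞) = 2 + 1 by norm_num, contDiff_succ_iff_deriv]
    refine ⟨fun ζ => (hderiv ζ).differentiableAt, by simp, ?_⟩
    rwa [funext fun ζ => (hderiv ζ).deriv]
  have hsurj : Function.Surjective z :=
    surjective_of_hasDerivAt_ge hδ hderiv fun ζ => by linarith [hbd ζ]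
  let e : ℝ ≃ₜ ℝ := (hmono.orderIsoOfSurjective z hsurj).toHomeomorph
  have hinv : Function.invFun z = e.symm := by
    funext w
    apply hmono.injective
    rw [Function.rightInverse_invFun hsurj w]
    exact (e.apply_symm_apply w).symm
  have hinv_smooth : ContDiff ℝ 2 (Function.invFun z) := by
    rw [hinv]
    exact e.contDiff_symm_deriv hne hderiv (hsmooth.of_le (by norm_num))
  have hinv_deriv : ∀ w, HasDerivAt (Function.invFun z) (γ - u (Function.invFun z w))⁻¹ w :=
    fun w => (hderiv _).of_local_left_inverse hinv_smooth.continuous.continuousAt (hne _)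
      (Filter.Eventually.of_forall (Function.rightInverse_invFun hsurj))
  have hu_deriv : ∀ ζ, HasDerivAt u (deriv u ζ) ζ := fun ζ =>
    (hu.differentiable (by norm_num) ζ).hasDerivAt
  have hu_deriv2 : ∀ ζ, HasDerivAt (deriv u) (-((γ - u ζ) * u ζ)) ζ := fun ζ => by
    have hu' : ContDiff ℝ (1 + 1) u := by simpa [one_add_one_eq_two] using hu
    have h : DifferentiableAt ℝ (deriv u) ζ :=
      (contDiff_succ_iff_deriv.1 hu').2.2.differentiable one_ne_zero ζ
    have hζ := hODE ζ
    rw [iteratedDeriv_succ, iteratedDeriv_one] at hζ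
    rw [← eq_neg_of_add_eq_zero_left hζ]
    exact h.hasDerivAt
  refine ⟨hmono, hsmooth, ⟨hmono.injective, hsurj⟩, hu.comp hinv_smooth, fun w => ?_⟩
  have hflux : (fun y => (γ - (u ∘ Function.invFun z) y) * deriv (u ∘ Function.invFun z) y)
      = deriv u ∘ Function.invFun z := by
    funext y
    rw [((hu_deriv _).comp y (hinv_deriv y)).deriv, Function.comp_apply, Function.comp_apply]
    field_simp [hne (Function.invFun z y)]
  rw [hflux, ((hu_deriv2 _).comp w (hinv_deriv w)).deriv, Function.comp_apply]
  field_simp [hne (Function.invFun z w)]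
  ring
end
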